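/- Every Turing degree that is bounded by a 2-random Turing degree satisfies the join property. -/

import Mathlib

/-
Common framework: oracle (relative) partial computability via codes,
Turing reducibility, the jump, Cantor-space measure, Martin-Löf randomness
and genericity relative to an oracle, Turing functionals.
-/

open scoped ENNReal

namespace TypicalDegree

/-- Codes for partial functions recursive in an oracle (Kleene-style),
    following `Nat.Partrec.Code` with an extra `oracle` constructor. -/
inductive OracleCode : Type
  | zero : OracleCode
  | succ : OracleCode
  | left : OracleCode
  | right : OracleCode
  | oracle : OracleCode
  | pair : OracleCode → OracleCode → OracleCode
  | comp : OracleCode → OracleCode → OracleCode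
  | prec : OracleCode → OracleCode → OracleCode
  | rfind' : OracleCode → OracleCode

/-- Evaluation of an oracle code relative to an oracle `g : ℕ →. ℕ`. -/
def OracleCode.eval (g : ℕ →. ℕ) : OracleCode → ℕ →. ℕ
  | .zero => pure 0
  | .succ => Nat.succ
  | .left => ↑fun n : ℕ => n.unpair.1
  | .right => ↑fun n : ℕ => n.unpair.2
  | .oracle => g
  | .pair cf cg => fun n => Nat.pair <$> OracleCode.eval g cf n <*> OracleCode.eval g cg n
  | .comp cf cg => fun n => OracleCode.eval g cg n >>= OracleCode.eval g cf
  | .prec cf cg =>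
    Nat.unpaired fun a n =>
      n.rec (OracleCode.eval g cf a) fun y IH => do
        let i ← IH
        OracleCode.eval g cg (Nat.pair a (Nat.pair y i))
  | .rfind' cf =>
    Nat.unpaired fun a m =>
      (Nat.rfind fun n => (fun m => m = 0) <$> OracleCode.eval g cf (Nat.pair a (n + m))).map
        (· + m)

/-- An effective injective numbering of oracle codes. -/
def OracleCode.encodeCode : OracleCode → ℕ
  | .zero => 0
  | .succ => 1
  | .left => 2
  | .right => 3
  | .oracle => 4
  | .pair cf cg => 4 * Nat.pair cf.encodeCode cg.encodeCode + 5
  | .comp cf cg => 4 * Nat.pair cf.encodeCode cg.encodeCode + 6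
  | .prec cf cg => 4 * Nat.pair cf.encodeCode cg.encodeCode + 7
  | .rfind' cf => 4 * Nat.pair cf.encodeCode cf.encodeCode + 8

/-- The characteristic (total) oracle of an element of Cantor space. -/
def chi (X : ℕ → Bool) : ℕ →. ℕ := fun n => Part.some (cond (X n) 1 0)

/-- `f` is partial recursive relative to the oracle `g`. -/
def RedIn (f g : ℕ →. ℕ) : Prop := ∃ c : OracleCode, c.eval g = f

/-- A total function `ℕ → ℕ` viewed as a partial function. -/
def natFun (f : ℕ → ℕ) : ℕ →. ℕ := fun n => Part.some (f n)

/-- Turing reducibility between elements of Cantor space. -/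
def TRed (X Y : ℕ → Bool) : Prop := RedIn (chi X) (chi Y)

/-- Turing equivalence. -/
def TEquiv (X Y : ℕ → Bool) : Prop := TRed X Y ∧ TRed Y X

/-- `X` is computable. -/
def ComputableSeq (X : ℕ → Bool) : Prop := TRed X fun _ => false

/-- `f : ℕ → ℕ` is computable. -/
def ComputableFun (f : ℕ → ℕ) : Prop := RedIn (natFun f) (chi fun _ => false)

/-- The Turing jump of `X`: the halting problem relative to `X`,
    under the numbering `encodeCode`. -/
noncomputable def jump (X : ℕ → Bool) : ℕ → Bool := fun n =>
  @decide (∃ c : OracleCode, c.encodeCode = n ∧ (c.eval (chi X) n).Dom) (Classical.dec _)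

/-- `∅'`, the halting problem. -/
noncomputable def zeroJump : ℕ → Bool := jump fun _ => false

/-- `X` extends the finite binary string `σ` (i.e. `σ ⊂ X`). -/
def extendsStr (X : ℕ → Bool) (σ : List Bool) : Prop :=
  ∀ i : Fin σ.length, X i.1 = σ.get i

/-- `⟦V⟧`: the open set of infinite sequences extending some string in `V`. -/
def openOf (V : Set (List Bool)) : Set (ℕ → Bool) := {X | ∃ σ ∈ V, extendsStr X σ}

/-- The (fair-coin) measure of the open set `⟦V⟧` determined by a set of strings `V`:
    the supremum over `n` of the proportion of length-`n` strings with a prefix in `V`. -/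
noncomputable def stringMeasure (V : Set (List Bool)) : ℝ≥0∞ :=
  ⨆ n : ℕ, (Nat.card {f : Fin n → Bool // ∃ σ ∈ V, σ <+: List.ofFn f} : ℝ≥0∞) / 2 ^ n

/-- The fair-coin (Lebesgue) measure on Cantor space, as the outer measure obtained from
    open coverings by sets of strings; it agrees with Lebesgue measure on measurable sets. -/
noncomputable def cantorMeasure (S : Set (ℕ → Bool)) : ℝ≥0∞ :=
  ⨅ (V : Set (List Bool)) (_ : S ⊆ openOf V), stringMeasure V

/-- `W` is computably enumerable relative to `X`. -/
def CEIn (X : ℕ → Bool) (W : Set (List Bool)) : Prop :=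
  ∃ c : OracleCode, ∀ σ : List Bool, σ ∈ W ↔ (c.eval (chi X) (Encodable.encode σ)).Dom

/-- `W` is computably enumerable. -/
def CE (W : Set (List Bool)) : Prop := CEIn (fun _ => false) W

/-- The c.e. set of strings with index `d`. -/
def ceSetOf (d : OracleCode) : Set (List Bool) :=
  {σ | (d.eval (chi fun _ => false) (Encodable.encode σ)).Dom}

/-- The sequence `V` of sets of strings is uniformly c.e. relative to `X`. -/
def UniformCEIn (X : ℕ → Bool) (V : ℕ → Set (List Bool)) : Prop :=
  ∃ c : OracleCode, ∀ (i : ℕ) (σ : List Bool),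
    σ ∈ V i ↔ (c.eval (chi X) (Nat.pair i (Encodable.encode σ))).Dom

/-- A Martin-Löf test relative to `X`. -/
def MLTest (X : ℕ → Bool) (V : ℕ → Set (List Bool)) : Prop :=
  UniformCEIn X V ∧ ∀ i : ℕ, stringMeasure (V i) < (2 : ℝ≥0∞)⁻¹ ^ i

/-- `Y` is Martin-Löf random relative to `X`. -/
def MLRandomIn (X Y : ℕ → Bool) : Prop :=
  ∀ V : ℕ → Set (List Bool), MLTest X V → ∃ i, Y ∉ openOf (V i)

/-- `Y` is 1-random. -/
def OneRandom (Y : ℕ → Bool) : Prop := MLRandomIn (fun _ => false) Y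

/-- `Y` is 2-random: Martin-Löf random relative to `∅'`. -/
def TwoRandom (Y : ℕ → Bool) : Prop := MLRandomIn zeroJump Y

/-- `Y` is weakly 2-random: it avoids every null `Π⁰₂` class
    (every null intersection of a uniformly c.e. sequence of open sets). -/
def Weak2Random (Y : ℕ → Bool) : Prop :=
  ∀ V : ℕ → Set (List Bool), UniformCEIn (fun _ => false) V →
    cantorMeasure (⋂ i, openOf (V i)) = 0 → Y ∉ ⋂ i, openOf (V i)

/-- `Y` is 1-generic relative to `X`. -/
def OneGenericIn (X Y : ℕ → Bool) : Prop :=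
  ∀ W : Set (List Bool), CEIn X W →
    ∃ σ : List Bool, extendsStr Y σ ∧ (σ ∈ W ∨ ∀ τ : List Bool, σ <+: τ → τ ∉ W)

/-- `Y` is 1-generic. -/
def OneGeneric (Y : ℕ → Bool) : Prop := OneGenericIn (fun _ => false) Y

/-- `Y` is 2-generic: 1-generic relative to `∅'`. -/
def TwoGeneric (Y : ℕ → Bool) : Prop := OneGenericIn zeroJump Y

/-- The Turing functional coded by `c` is total on oracle `X` with value `Y ∈ 2^ω`
    (i.e. `Ψ^X = Y`). -/
def FTotal (c : OracleCode) (X : ℕ → Bool) (Y : ℕ → Bool) : Prop :=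
  c.eval (chi X) = chi Y

/-- `Ψ^X ⊇ σ`: the output of the functional `c` on oracle `X` extends the string `σ`. -/
def FExtends (c : OracleCode) (X : ℕ → Bool) (σ : List Bool) : Prop :=
  ∀ i : Fin σ.length, c.eval (chi X) i.1 = Part.some (cond (σ.get i) 1 0)

/-- `π(Ψ,σ) = μ({X : Ψ^X ⊇ σ})`. -/
noncomputable def piMeasure (c : OracleCode) (σ : List Bool) : ℝ≥0∞ :=
  cantorMeasure {X | FExtends c X σ}

/-- A Turing functional is special if every infinite binary sequence
    in its range is incomputable. -/
def Special (c : OracleCode) : Prop :=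
  ∀ X Y : ℕ → Bool, FTotal c X Y → ¬ ComputableSeq Y

/-- The code `c` computes the total function `T` on strings (no oracle). -/
def ComputesFun (c : OracleCode) (T : List Bool → Bool) : Prop :=
  ∀ σ : List Bool, c.eval (chi fun _ => false) (Encodable.encode σ) = Part.some (cond (T σ) 1 0)

/-- `T` is (the characteristic function of) a tree: closed under prefixes. -/
def IsTree (T : List Bool → Bool) : Prop :=
  ∀ σ τ : List Bool, σ <+: τ → T τ = true → T σ = true

/-- The set of infinite paths through the tree `T`; `Π⁰₁` classes are the
    sets of paths through computable trees. -/
def pathsOf (T : List Bool → Bool) : Set (ℕ → Bool) :=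
  {X | ∀ n : ℕ, T (List.ofFn fun i : Fin n => X i.1) = true}

/-- The computable join `X ⊕ Y`. -/
def join (X Y : ℕ → Bool) : ℕ → Bool := fun n =>
  if n % 2 = 0 then X (n / 2) else Y (n / 2)

/-- A finite string used as a (partial) oracle. -/
def strOracle (τ : List Bool) : ℕ →. ℕ := fun n =>
  if h : n < τ.length then Part.some (cond (τ.get ⟨n, h⟩) 1 0) else Part.none

/-- `Ψ^{τ₀}` and `Ψ^{τ₁}` are incompatible: they give different outputs somewhere. -/
def SplitPair (c : OracleCode) (τ₀ τ₁ : List Bool) : Prop :=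
  ∃ (n v₀ v₁ : ℕ), v₀ ∈ c.eval (strOracle τ₀) n ∧ v₁ ∈ c.eval (strOracle τ₁) n ∧ v₀ ≠ v₁

/-- `(U,V)` is a `Ψ`-splitting above `τ`. -/
def SplittingAbove (c : OracleCode) (τ : List Bool) (U V : Finset (List Bool)) : Prop :=
  (∃ ℓ : ℕ, ∀ σ ∈ U ∪ V, σ.length = ℓ ∧ τ <+: σ) ∧
    ∀ σ₀ ∈ U, ∀ σ₁ ∈ V, SplitPair c σ₀ σ₁

/-- The output sequence `Ψ^X` of the functional `c` on oracle `X`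
    (defaults to `false` when not total). -/
noncomputable def outSeq (c : OracleCode) (X : ℕ → Bool) : ℕ → Bool := fun n =>
  @dite _ (∃ Y : ℕ → Bool, FTotal c X Y) (Classical.dec _) (fun h => h.choose n) fun _ => false

/-- `Ψ^X ↾ n`, as a finite string. -/
noncomputable def outStr (c : OracleCode) (X : ℕ → Bool) (n : ℕ) : List Bool :=
  List.ofFn fun i : Fin n => outSeq c X i.1

/-- The degree of `M` is a minimal Turing degree. -/
def MinimalDeg (M : ℕ → Bool) : Prop :=
  ¬ ComputableSeq M ∧ ∀ Z : ℕ → Bool, TRed Z M → ComputableSeq Z ∨ TRed M Z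


end TypicalDegree

namespace TypicalDegree

open Encodable

theorem redIn_of_recursiveIn {f g : ℕ →. ℕ} (h : Nat.RecursiveIn {g} f) : RedIn f g := by
  induction h with
  | zero => exact ⟨.zero, rfl⟩
  | succ => exact ⟨.succ, rfl⟩
  | left => exact ⟨.left, rfl⟩
  | right => exact ⟨.right, rfl⟩
  | oracle g' hg => exact ⟨.oracle, by rw [Set.mem_singleton_iff] at hg; subst hg; rfl⟩
  | pair _ _ ih1 ih2 =>
    obtain ⟨c1, rfl⟩ := ih1; obtain ⟨c2, rfl⟩ := ih2
    exact ⟨.pair c1 c2, rfl⟩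
  | comp _ _ ih1 ih2 =>
    obtain ⟨c1, rfl⟩ := ih1; obtain ⟨c2, rfl⟩ := ih2
    exact ⟨.comp c1 c2, rfl⟩
  | prec _ _ ih1 ih2 =>
    obtain ⟨c1, rfl⟩ := ih1; obtain ⟨c2, rfl⟩ := ih2
    exact ⟨.prec c1 c2, rfl⟩
  | rfind _ ih =>
    obtain ⟨c, rfl⟩ := ih
    refine ⟨.comp (.rfind' c) (.pair (.pair .left .right) .zero), ?_⟩
    funext n
    simp [OracleCode.eval, Nat.unpaired, Seq.seq, pure, PFun.pure]
    exact Part.map_id' (fun _ => rfl) _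

theorem recursiveIn_eval (g : ℕ →. ℕ) (c : OracleCode) : Nat.RecursiveIn {g} (c.eval g) := by
  induction c with
  | zero => exact .zero
  | succ => exact .succ
  | left => exact .left
  | right => exact .right
  | oracle => exact .oracle _ rfl
  | pair _ _ ih1 ih2 => exact .pair ih1 ih2
  | comp _ _ ih1 ih2 => exact .comp ih1 ih2
  | prec _ _ ih1 ih2 => exact .prec ih1 ih2
  | rfind' c ih =>
    have h0 : Nat.RecursiveIn {g} (fun x => (Part.some (Nat.pair x.unpair.1.unpair.1
        (x.unpair.2 + x.unpair.1.unpair.2))) >>= c.eval g) := by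
      apply Nat.RecursiveIn.comp ih
      apply Nat.Partrec.recursiveIn
      apply Nat.Partrec.of_primrec
      exact Primrec.nat_iff.1 (Primrec₂.natPair.comp (Primrec.fst.comp (Primrec.unpair.comp (Primrec.fst.comp Primrec.unpair))) (Primrec.nat_add.comp (Primrec.snd.comp Primrec.unpair) (Primrec.snd.comp (Primrec.unpair.comp (Primrec.fst.comp Primrec.unpair)))))
    have h1 := Nat.RecursiveIn.rfind h0
    have h2 : Nat.RecursiveIn {g} (fun n : ℕ => (Part.some (n.unpair.1 + n.unpair.2))) := by
      apply Nat.Partrec.recursiveIn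
      apply Nat.Partrec.of_primrec
      exact Primrec.nat_iff.1 (Primrec.nat_add.comp (Primrec.fst.comp Primrec.unpair) (Primrec.snd.comp (Primrec.unpair)))
    have h3 : Nat.RecursiveIn {g} (fun n : ℕ => (Part.some (n.unpair.2))) := by
      apply Nat.Partrec.recursiveIn
      apply Nat.Partrec.of_primrec
      exact Primrec.nat_iff.1 ((Primrec.snd.comp (Primrec.unpair)))
    refine (Nat.RecursiveIn.comp h2 (Nat.RecursiveIn.pair h1 h3)).of_eq ?_
    intro n
    simp [OracleCode.eval, Nat.unpaired, Seq.seq]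
    rw [← Part.bind_some_eq_map, Part.bind_assoc] <;> try rfl
    congr 1
    · congr 1
      funext k
      congr 1
      exact Part.bind_some _ _
    · funext y
      simp

theorem redIn_iff {f g : ℕ →. ℕ} : RedIn f g ↔ Nat.RecursiveIn {g} f :=
  ⟨fun ⟨c, h⟩ => h ▸ recursiveIn_eval g c, redIn_of_recursiveIn⟩

theorem TRed.trans {X Y Z : ℕ → Bool} (h1 : TRed X Y) (h2 : TRed Y Z) : TRed X Z := by
  unfold TRed at *
  rw [redIn_iff] at *
  exact h1.subst (by rintro g rfl; exact h2)

theorem TRed.refl (X : ℕ → Bool) : TRed X X := ⟨.oracle, rfl⟩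
end TypicalDegree

namespace TypicalDegree
open Encodable

attribute [fun_prop] Primrec

section PrimLib
variable {α β γ δ σ : Type*} [Primcodable α] [Primcodable β] [Primcodable γ] [Primcodable δ] [Primcodable σ]
@[fun_prop] theorem pr_id : Primrec (fun x : α => x) := Primrec.id
@[fun_prop] theorem pr_const (c : β) : Primrec (fun _ : α => c) := Primrec.const c
@[fun_prop] theorem pr_comp {f : β → γ} {g : α → β} (hf : Primrec f) (hg : Primrec g) :
    Primrec (fun x => f (g x)) := hf.comp hg
@[fun_prop] theorem pr_mk {f : α → β} {g : α → γ} (hf : Primrec f) (hg : Primrec g) :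
    Primrec (fun x => (f x, g x)) := hf.pair hg
@[fun_prop] theorem pr_fst {f : α → β × γ} (hf : Primrec f) : Primrec (fun x => (f x).1) :=
  Primrec.fst.comp hf
@[fun_prop] theorem pr_snd {f : α → β × γ} (hf : Primrec f) : Primrec (fun x => (f x).2) :=
  Primrec.snd.comp hf
@[fun_prop] theorem pr_add {f g : α → ℕ} (hf : Primrec f) (hg : Primrec g) :
    Primrec (fun x => f x + g x) := Primrec.nat_add.comp hf hg
@[fun_prop] theorem pr_mul {f g : α → ℕ} (hf : Primrec f) (hg : Primrec g) :
    Primrec (fun x => f x * g x) := Primrec.nat_mul.comp hf hg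
@[fun_prop] theorem pr_sub {f g : α → ℕ} (hf : Primrec f) (hg : Primrec g) :
    Primrec (fun x => f x - g x) := Primrec.nat_sub.comp hf hg
@[fun_prop] theorem pr_pair {f g : α → ℕ} (hf : Primrec f) (hg : Primrec g) :
    Primrec (fun x => Nat.pair (f x) (g x)) := Primrec₂.natPair.comp hf hg
@[fun_prop] theorem pr_unpair {f : α → ℕ} (hf : Primrec f) :
    Primrec (fun x => Nat.unpair (f x)) := Primrec.unpair.comp hf
@[fun_prop] theorem pr_rec {f : α → ℕ} {g : α → σ} {h : α → ℕ → σ → σ} (hf : Primrec f)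
    (hg : Primrec g) (hh : Primrec fun p : α × ℕ × σ => h p.1 p.2.1 p.2.2) :
    Primrec (fun x => (Nat.rec (g x) (h x) (f x) : σ)) :=
  Primrec.nat_rec' hf hg (h := fun a p => h a p.1 p.2) hh
theorem pr_two_pow0 : Primrec (fun n : ℕ => 2 ^ n) := by
  have : Primrec (fun n : ℕ => (Nat.rec 1 (fun _ y => y * 2) n : ℕ)) := by fun_prop
  refine this.of_eq fun n => ?_
  induction n with
  | zero => rfl
  | succ n ih => rw [pow_succ, ← ih]
@[fun_prop] theorem pr_two_pow {f : α → ℕ} (hf : Primrec f) : Primrec (fun x => 2 ^ (f x)) :=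
  pr_two_pow0.comp hf
@[fun_prop] theorem pr_map {f : α → List β} {g : α → β → σ} (hf : Primrec f)
    (hg : Primrec fun p : α × β => g p.1 p.2) : Primrec (fun x => (f x).map (g x)) :=
  Primrec.list_map hf hg
@[fun_prop] theorem pr_flatMap {f : α → List β} {g : α → β → List σ} (hf : Primrec f)
    (hg : Primrec fun p : α × β => g p.1 p.2) : Primrec (fun x => (f x).flatMap (g x)) :=
  Primrec.list_flatMap hf hg
@[fun_prop] theorem pr_filterMap {f : α → List β} {g : α → β → Option σ} (hf : Primrec f)
    (hg : Primrec fun p : α × β => g p.1 p.2) : Primrec (fun x => (f x).filterMap (g x)) :=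
  Primrec.listFilterMap hf hg
@[fun_prop] theorem pr_cond {c : α → Bool} {f g : α → σ} (hc : Primrec c) (hf : Primrec f)
    (hg : Primrec g) : Primrec (fun x => cond (c x) (f x) (g x)) := Primrec.cond hc hf hg
@[fun_prop] theorem pr_ite {c : α → Bool} {f g : α → σ} (hc : Primrec c) (hf : Primrec f)
    (hg : Primrec g) : Primrec (fun x => if c x = true then f x else g x) :=
  (Primrec.cond hc hf hg).of_eq fun x => by cases c x <;> rfl
@[fun_prop] theorem pr_some {f : α → β} (hf : Primrec f) : Primrec (fun x => some (f x)) :=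
  Primrec.option_some.comp hf
@[fun_prop] theorem pr_filter {f : α → List β} {g : α → β → Bool} (hf : Primrec f)
    (hg : Primrec fun p : α × β => g p.1 p.2) : Primrec (fun x => (f x).filter (g x)) := by
  have : Primrec (fun x => (f x).filterMap (fun y => if g x y = true then some y else none)) := by
    fun_prop
  refine this.of_eq fun x => ?_
  generalize f x = l
  induction l with
  | nil => rfl
  | cons a l ih => by_cases h : g x a = true <;> simp [h, ih]
@[fun_prop] theorem pr_length {f : α → List β} (hf : Primrec f) :
    Primrec (fun x => (f x).length) := Primrec.list_length.comp hf
@[fun_prop] theorem pr_range {f : α → ℕ} (hf : Primrec f) : Primrec (fun x => List.range (f x)) :=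
  Primrec.list_range.comp hf
@[fun_prop] theorem pr_append {f g : α → List β} (hf : Primrec f) (hg : Primrec g) :
    Primrec (fun x => f x ++ g x) := Primrec.list_append.comp hf hg
@[fun_prop] theorem pr_cons {f : α → β} {g : α → List β} (hf : Primrec f) (hg : Primrec g) :
    Primrec (fun x => f x :: g x) := Primrec.list_cons.comp hf hg
@[fun_prop] theorem pr_take {f : α → ℕ} {g : α → List β} (hf : Primrec f) (hg : Primrec g) :
    Primrec (fun x => (g x).take (f x)) := Primrec.list_take.comp hf hg
@[fun_prop] theorem pr_head? {g : α → List β} (hg : Primrec g) :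
    Primrec (fun x => (g x).head?) := Primrec.list_head?.comp hg
@[fun_prop] theorem pr_getElem? {f : α → ℕ} {g : α → List β} (hf : Primrec f) (hg : Primrec g) :
    Primrec (fun x => (g x)[f x]?) := Primrec.list_getElem?.comp hg hf
@[fun_prop] theorem pr_getD {f : α → ℕ} {g : α → List β} (d : β) (hf : Primrec f)
    (hg : Primrec g) : Primrec (fun x => (g x).getD (f x) d) := (Primrec.list_getD d).comp hg hf
@[fun_prop] theorem pr_isSome {g : α → Option β} (hg : Primrec g) :
    Primrec (fun x => (g x).isSome) := Primrec.option_isSome.comp hg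
@[fun_prop] theorem pr_elim {f : α → Option β} {g : α → σ} {h : α → β → σ} (hf : Primrec f)
    (hg : Primrec g) (hh : Primrec fun p : α × β => h p.1 p.2) :
    Primrec (fun x => (f x).elim (g x) (h x)) :=
  (Primrec.option_casesOn hf hg hh).of_eq fun x => by cases f x <;> rfl
@[fun_prop] theorem pr_encode {f : α → β} (hf : Primrec f) : Primrec (fun x => encode (f x)) :=
  Primrec.encode.comp hf
@[fun_prop] theorem pr_decode {f : α → ℕ} (hf : Primrec f) :
    Primrec (fun x => (decode (f x) : Option β)) := Primrec.decode.comp hf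
@[fun_prop] theorem pr_not {f : α → Bool} (hf : Primrec f) : Primrec (fun x => !(f x)) :=
  Primrec.not.comp hf
@[fun_prop] theorem pr_and {f g : α → Bool} (hf : Primrec f) (hg : Primrec g) :
    Primrec (fun x => f x && g x) := Primrec.and.comp hf hg
@[fun_prop] theorem pr_or {f g : α → Bool} (hf : Primrec f) (hg : Primrec g) :
    Primrec (fun x => f x || g x) := Primrec.or.comp hf hg
@[fun_prop] theorem pr_beq {β : Type*} [Primcodable β] [DecidableEq β] {f g : α → β}
    (hf : Primrec f) (hg : Primrec g) :
    Primrec (fun x => decide (f x = g x)) :=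
  PrimrecPred.decide (Primrec.eq.comp hf hg)
@[fun_prop] theorem pr_le {f g : α → ℕ} (hf : Primrec f) (hg : Primrec g) :
    Primrec (fun x => decide (f x ≤ g x)) := PrimrecPred.decide (Primrec.nat_le.comp hf hg)
@[fun_prop] theorem pr_lt {f g : α → ℕ} (hf : Primrec f) (hg : Primrec g) :
    Primrec (fun x => decide (f x < g x)) := PrimrecPred.decide (Primrec.nat_lt.comp hf hg)
@[fun_prop] theorem pr_any {f : α → List β} {g : α → β → Bool} (hf : Primrec f)
    (hg : Primrec fun p : α × β => g p.1 p.2) : Primrec (fun x => (f x).any (g x)) := by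
  have : Primrec (fun x => !decide (((f x).filter (g x)).length = 0)) := by fun_prop
  refine this.of_eq fun x => ?_
  generalize f x = l
  induction l with
  | nil => rfl
  | cons a l ih => by_cases h : g x a = true <;> simp_all
@[fun_prop] theorem pr_all {f : α → List β} {g : α → β → Bool} (hf : Primrec f)
    (hg : Primrec fun p : α × β => g p.1 p.2) : Primrec (fun x => (f x).all (g x)) := by
  have : Primrec (fun x => !((f x).any fun y => !(g x y))) := by fun_prop
  refine this.of_eq fun x => ?_
  generalize f x = l
  induction l with
  | nil => rfl
  | cons a l ih => by_cases h : g x a = true <;> simp_all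
@[fun_prop] theorem pr_evaln {k : α → ℕ} {c : α → Nat.Partrec.Code} {n : α → ℕ} (hk : Primrec k)
    (hc : Primrec c) (hn : Primrec n) : Primrec (fun x => (c x).evaln (k x) (n x)) :=
  (Nat.Partrec.Code.primrec_evaln.comp ((hk.pair hc).pair hn))
@[fun_prop] theorem pr_ofNatCode {n : α → ℕ} (hn : Primrec n) :
    Primrec (fun x => Denumerable.ofNat Nat.Partrec.Code (n x)) := (Primrec.ofNat _).comp hn
end PrimLib

/-- initial segment -/
def pre (X : ℕ → Bool) (n : ℕ) : List Bool := (List.range n).map X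

@[simp] theorem pre_length (X : ℕ → Bool) (n : ℕ) : (pre X n).length = n := by simp [pre]
@[simp] theorem pre_zero (X : ℕ → Bool) : pre X 0 = [] := rfl
theorem pre_succ (X : ℕ → Bool) (n : ℕ) : pre X (n+1) = pre X n ++ [X n] := by
  simp [pre, List.range_succ]
theorem pre_getElem (X : ℕ → Bool) (n i : ℕ) (h : i < (pre X n).length) : (pre X n)[i] = X i := by
  simp [pre]
theorem pre_getElem? (X : ℕ → Bool) (n i : ℕ) (h : i < n) : (pre X n)[i]? = some (X i) := by
  simp [pre, h]
theorem pre_take (X : ℕ → Bool) (n m : ℕ) (h : m ≤ n) : (pre X n).take m = pre X m := by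
  apply List.ext_getElem
  · simp [h]
  · intro i h1 h2; simp [pre]
theorem pre_initOf (X : ℕ → Bool) {n m : ℕ} (h : m ≤ n) : pre X m <+: pre X n := by
  rw [← pre_take X n m h]; exact List.take_prefix _ _

/-- `a` is an initial segment of `X` -/
def Sub (a : List Bool) (X : ℕ → Bool) : Prop := pre X a.length = a

theorem sub_pre (X : ℕ → Bool) (n : ℕ) : Sub (pre X n) X := by simp [Sub]
theorem Sub.initOf {a : List Bool} {X : ℕ → Bool} (h : Sub a X) {n : ℕ} (hn : a.length ≤ n) :
    a <+: pre X n := by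
  rw [← h]; simpa using pre_initOf X hn
theorem Sub.mono {a b : List Bool} {X : ℕ → Bool} (h : Sub b X) (hab : a <+: b) : Sub a X := by
  unfold Sub at *
  rw [List.prefix_iff_eq_take] at hab
  rw [← h, pre_take _ _ _ (by have := congrArg List.length hab; simp at this; omega)] at hab
  exact hab.symm
theorem sub_of_prefix_pre {a : List Bool} {X : ℕ → Bool} {n : ℕ} (h : a <+: pre X n) : Sub a X :=
  (sub_pre X n).mono h
theorem Sub.compat {a b : List Bool} {X : ℕ → Bool} (h : Sub a X) (h' : Sub b X) :
    a <+: b ∨ b <+: a := by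
  rcases le_total a.length b.length with hl | hl
  · left; rw [← h']; exact h.initOf hl
  · right; rw [← h]; exact h'.initOf hl
theorem Sub.getElem {a : List Bool} {X : ℕ → Bool} (h : Sub a X) (i : ℕ) (hi : i < a.length) :
    a[i] = X i := by
  have := pre_getElem X a.length i (by simpa using hi)
  rw [← this]; congr 1; exact h.symm
theorem sub_iff {a : List Bool} {X : ℕ → Bool} : Sub a X ↔ ∀ i (hi : i < a.length), a[i] = X i := by
  refine ⟨fun h i hi => h.getElem i hi, fun h => ?_⟩
  apply List.ext_getElem
  · simp
  · intro i h1 h2; rw [h i h2, pre_getElem]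
theorem extendsStr_iff {a : List Bool} {X : ℕ → Bool} : extendsStr X a ↔ Sub a X := by
  rw [sub_iff]; unfold extendsStr
  constructor
  · intro h i hi; exact (h ⟨i, hi⟩).symm
  · intro h i; exact (h i.1 i.2).symm
theorem sub_extend (a : List Bool) : ∃ X, Sub a X := ⟨fun n => a.getD n false, by
  rw [sub_iff]; intro i hi; simp [hi]⟩

theorem recIn_prim {g : ℕ →. ℕ} {f : ℕ → ℕ} (hf : Primrec f) :
    Nat.RecursiveIn {g} (fun n => Part.some (f n)) :=
  Nat.Partrec.recursiveIn (Nat.Partrec.of_primrec (Primrec.nat_iff.1 hf))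

theorem recIn_pre (X : ℕ → Bool) :
    Nat.RecursiveIn {chi X} (fun n => Part.some (encode (pre X n))) := by
  have h1 : Nat.RecursiveIn {chi X} (fun p => Part.some p.unpair.2.unpair.1 >>= chi X) :=
    .comp (.oracle _ rfl) (recIn_prim (by fun_prop))
  have h2 : Nat.RecursiveIn {chi X} (fun p => Nat.pair <$> Part.some p.unpair.2.unpair.2 <*>
     (Part.some p.unpair.2.unpair.1 >>= chi X)) := .pair (recIn_prim (by fun_prop)) h1
  have h3 : Nat.RecursiveIn {chi X} (fun p => Part.some (encode ((decode p.unpair.1 : Option (List Bool)).elim []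
      (fun x => x ++ [decide (p.unpair.2 = 1)])))) := recIn_prim (by fun_prop)
  have h4 := Nat.RecursiveIn.prec (.zero) (Nat.RecursiveIn.comp h3 h2)
  have h5 := Nat.RecursiveIn.comp h4 (recIn_prim (f := fun n => Nat.pair 0 n) (by fun_prop))
  refine h5.of_eq fun n => ?_
  simp only [Part.bind_eq_bind, Part.bind_some, Nat.unpair_pair]
  induction n with
  | zero => rfl
  | succ n ih =>
    simp only [ih, Part.bind_some]
    have e : (Part.some n >>= chi X) = Part.some (cond (X n) 1 0) := Part.bind_some _ _
    simp [e, Seq.seq, pre_succ]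
    cases X n <;> rfl

theorem search_tool (X : ℕ → Bool) (F : List Bool → ℕ → Option ℕ)
    (hF : Primrec fun p : List Bool × ℕ => F p.1 p.2) :
    RedIn (fun n => Nat.rfindOpt fun k => F (pre X k) n) (chi X) := by
  refine redIn_iff.2 ?_
  have h1 : Nat.RecursiveIn {chi X} (fun x => Nat.pair <$> Part.some x.unpair.1 <*>
      (Part.some x.unpair.2 >>= fun n => Part.some (encode (pre X n)))) :=
    .pair (recIn_prim (by fun_prop)) (.comp (recIn_pre X) (recIn_prim (by fun_prop)))
  have h2 : Nat.RecursiveIn {chi X} (fun p => Part.some (encode ((decode p.unpair.2 : Option (List Bool)).elim none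
      (fun x => F x p.unpair.1)))) := recIn_prim (by
        have : Primrec fun q : ℕ × List Bool => F q.2 q.1.unpair.1 :=
          hF.comp (g := fun q : ℕ × List Bool => (q.2, q.1.unpair.1)) (by fun_prop)
        fun_prop)
  have h3 := (Nat.RecursiveIn.comp h2 h1).of_eq (g := fun x => Part.some (encode (F (pre X x.unpair.2) x.unpair.1)))
    (by intro n; simp [Seq.seq])
  have h4 : Nat.RecursiveIn {chi X} (fun p => Part.some (cond (decide (p = 0)) 1 0)) :=
    recIn_prim (by fun_prop)
  have h5 := Nat.RecursiveIn.rfind (Nat.RecursiveIn.comp h4 h3)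
  have h6 := Nat.RecursiveIn.comp h3 (Nat.RecursiveIn.pair (recIn_prim (f := fun n => n) (by fun_prop)) h5)
  have h7 := Nat.RecursiveIn.comp (recIn_prim (f := fun n => n - 1) (by fun_prop)) h6
  refine h7.of_eq fun n => ?_
  simp only [Part.bind_eq_bind, Part.bind_some, Nat.unpair_pair]
  unfold Nat.rfindOpt
  have e : (fun n_1 : ℕ => (fun m : ℕ => decide (m = 0)) <$>
      (Part.some (bif decide (encode (F (pre X n_1) n) = 0) then 1 else 0) : Part ℕ)) =
      (fun k => Part.some (F (pre X k) n).isSome) := by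
    funext k
    cases F (pre X k) n <;> simp
  simp only [e]
  apply Part.ext
  intro v
  simp only [Seq.seq, Part.map_some, Part.map_eq_map, Part.bind_some, Part.mem_bind_iff, Part.mem_map_iff]
  constructor
  · rintro ⟨a, ⟨b, ⟨k, hk, rfl⟩, hb⟩, hv⟩
    refine ⟨k, by simpa using hk, ?_⟩
    have := Nat.rfind_spec hk
    simp at hb hv this
    subst hb hv
    cases h : F (pre X k) n with
    | none => rw [h] at this; simp at this
    | some v => simp
  · rintro ⟨k, hk, hv⟩
    refine ⟨_, ⟨_, ⟨k, hk, rfl⟩, by simp; rfl⟩, ?_⟩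
    have : F (pre X k) n = some v := by simpa using hv
    simp [this]

/-- Tool: computing a sequence from another. -/
theorem TRed.of_search (X Y : ℕ → Bool) (F : List Bool → ℕ → Option Bool)
    (hF : Primrec fun p : List Bool × ℕ => F p.1 p.2)
    (h1 : ∀ k n b, F (pre X k) n = some b → b = Y n)
    (h2 : ∀ n, ∃ k, (F (pre X k) n).isSome) : TRed Y X := by
  have := search_tool X (fun a n => (F a n).elim none (fun b => some (cond b 1 0))) (by fun_prop)
  unfold TRed
  refine Eq.mp ?_ this
  refine congrArg (fun f => RedIn f (chi X)) ?_
  funext n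
  have hd : (Nat.rfindOpt fun k => (F (pre X k) n).elim none (fun b => some (cond b 1 0))).Dom := by
    rw [Nat.rfindOpt_dom]
    obtain ⟨k, hk⟩ := h2 n
    obtain ⟨b, hb⟩ := Option.isSome_iff_exists.1 hk
    exact ⟨k, cond b 1 0, by simp [hb]⟩
  obtain ⟨v, hv⟩ := Part.dom_iff_mem.1 hd
  rw [Part.eq_some_iff.2 hv]
  obtain ⟨k, hk⟩ := Nat.rfindOpt_spec hv
  cases h : F (pre X k) n with
  | none => simp [h] at hk
  | some b =>
    simp [h] at hk
    rw [← hk, h1 k n b h]; rfl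

/-- Tool: sets c.e. relative to X. -/
theorem ce_search (X : ℕ → Bool) (F : List Bool → ℕ → Bool)
    (hF : Primrec fun p : List Bool × ℕ => F p.1 p.2) :
    ∃ c : OracleCode, ∀ n, (c.eval (chi X) n).Dom ↔ ∃ k, F (pre X k) n = true := by
  obtain ⟨c, hc⟩ := search_tool X (fun a n => if F a n = true then some 0 else none) (by fun_prop)
  refine ⟨c, fun n => ?_⟩
  rw [hc, Nat.rfindOpt_dom]
  apply exists_congr
  intro k
  by_cases h : F (pre X k) n = true <;> simp [h]
end TypicalDegree

namespace TypicalDegree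
open Encodable

theorem mem_comp {g : ℕ →. ℕ} {a b : OracleCode} {n v : ℕ} :
    v ∈ (OracleCode.comp a b).eval g n ↔ ∃ x ∈ b.eval g n, v ∈ a.eval g x := Part.mem_bind_iff

theorem mem_rfind' {g : ℕ →. ℕ} {a : OracleCode} {n v : ℕ} :
    v ∈ (OracleCode.rfind' a).eval g n ↔ ∃ x, ((0 ∈ a.eval g (Nat.pair n.unpair.1 (x + n.unpair.2))) ∧
      ∀ m < x, ∃ z ∈ a.eval g (Nat.pair n.unpair.1 (m + n.unpair.2)), z ≠ 0) ∧ x + n.unpair.2 = v := by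
  have : ∀ v, v ∈ (OracleCode.rfind' a).eval g n ↔ _ := fun v => Part.mem_map_iff _
  rw [this]
  apply exists_congr
  intro x
  apply and_congr_left
  intro _
  refine Nat.mem_rfind.trans (and_congr ?_ (forall_congr' fun m => forall_congr' fun hm => ?_))
  · refine (Part.mem_map_iff _).trans ?_
    simp
  · refine (Part.mem_map_iff _).trans ?_
    simp

theorem eval_mono {g g' : ℕ →. ℕ} (hg : ∀ n v, v ∈ g n → v ∈ g' n) (c : OracleCode) :
    ∀ n v, v ∈ c.eval g n → v ∈ c.eval g' n := by
  induction c with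
  | zero => intro n v h; exact h
  | succ => intro n v h; exact h
  | left => intro n v h; exact h
  | right => intro n v h; exact h
  | oracle => exact hg
  | pair a b iha ihb =>
    intro n v h
    simp only [OracleCode.eval, Seq.seq, Part.mem_bind_iff, Part.map_eq_map, Part.mem_map_iff] at h ⊢
    obtain ⟨f, ⟨x, hx, rfl⟩, y, hy, rfl⟩ := h
    exact ⟨_, ⟨x, iha _ _ hx, rfl⟩, y, ihb _ _ hy, rfl⟩
  | comp a b iha ihb =>
    intro n v h
    simp only [mem_comp] at h ⊢
    obtain ⟨x, hx, hy⟩ := h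
    exact ⟨x, ihb _ _ hx, iha _ _ hy⟩
  | prec a b iha ihb =>
    intro n
    simp only [OracleCode.eval, Nat.unpaired]
    generalize n.unpair.1 = u
    induction n.unpair.2 with
    | zero => intro v h; exact iha _ _ h
    | succ k ih =>
      intro v h
      simp only [Part.bind_eq_bind, Part.mem_bind_iff] at h ih ⊢
      obtain ⟨x, hx, hy⟩ := h
      exact ⟨x, ih _ hx, ihb _ _ hy⟩
  | rfind' a iha =>
    intro n v h
    rw [mem_rfind'] at h ⊢
    obtain ⟨x, ⟨hy, hx⟩, rfl⟩ := h
    refine ⟨x, ⟨iha _ _ hy, ?_⟩, rfl⟩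
    intro m hm
    obtain ⟨z, hz, hz'⟩ := hx m hm
    exact ⟨z, iha _ _ hz, hz'⟩

theorem strOracle_mem {τ : List Bool} {n v : ℕ} :
    v ∈ strOracle τ n ↔ ∃ h : n < τ.length, v = cond (τ[n]) 1 0 := by
  unfold strOracle
  split <;> simp_all

theorem strOracle_mono {τ τ' : List Bool} (h : τ <+: τ') (n v : ℕ) (hv : v ∈ strOracle τ n) :
    v ∈ strOracle τ' n := by
  rw [strOracle_mem] at *
  obtain ⟨hn, rfl⟩ := hv
  obtain ⟨s, rfl⟩ := h
  exact ⟨by simp; omega, by simp [List.getElem_append_left hn]⟩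

theorem strOracle_chi {τ : List Bool} {X : ℕ → Bool} (h : Sub τ X) (n v : ℕ)
    (hv : v ∈ strOracle τ n) : v ∈ chi X n := by
  rw [strOracle_mem] at *
  obtain ⟨hn, rfl⟩ := hv
  rw [h.getElem]; simp [chi]

theorem eval_pre_mono (X : ℕ → Bool) (c : OracleCode) {k k' : ℕ} (h : k ≤ k') (n v : ℕ)
    (hv : v ∈ c.eval (strOracle (pre X k)) n) : v ∈ c.eval (strOracle (pre X k')) n :=
  eval_mono (strOracle_mono (pre_initOf X h)) c n v hv

theorem eval_compact (X : ℕ → Bool) (c : OracleCode) :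
    ∀ n v, v ∈ c.eval (chi X) n → ∃ k, v ∈ c.eval (strOracle (pre X k)) n := by
  induction c with
  | zero => intro n v h; exact ⟨0, h⟩
  | succ => intro n v h; exact ⟨0, h⟩
  | left => intro n v h; exact ⟨0, h⟩
  | right => intro n v h; exact ⟨0, h⟩
  | oracle =>
    intro n v h
    refine ⟨n+1, strOracle_mem.2 ⟨by simp, ?_⟩⟩
    rw [pre_getElem]; simpa [OracleCode.eval, chi] using h
  | pair a b iha ihb =>
    intro n v h
    simp only [OracleCode.eval, Seq.seq, Part.mem_bind_iff, Part.map_eq_map, Part.mem_map_iff] at h ⊢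
    obtain ⟨f, ⟨x, hx, rfl⟩, y, hy, rfl⟩ := h
    obtain ⟨k1, h1⟩ := iha _ _ hx
    obtain ⟨k2, h2⟩ := ihb _ _ hy
    exact ⟨max k1 k2, _, ⟨x, eval_pre_mono X a (le_max_left _ _) _ _ h1, rfl⟩, y,
      eval_pre_mono X b (le_max_right _ _) _ _ h2, rfl⟩
  | comp a b iha ihb =>
    intro n v h
    simp only [mem_comp] at h ⊢
    obtain ⟨x, hx, hy⟩ := h
    obtain ⟨k1, h1⟩ := iha _ _ hy
    obtain ⟨k2, h2⟩ := ihb _ _ hx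
    exact ⟨max k1 k2, _, eval_pre_mono X b (le_max_right _ _) _ _ h2,
      eval_pre_mono X a (le_max_left _ _) _ _ h1⟩
  | prec a b iha ihb =>
    intro n
    simp only [OracleCode.eval, Nat.unpaired]
    generalize n.unpair.1 = u
    have key : ∀ m v, (v ∈ (Nat.rec (a.eval (chi X) u) (fun y IH => IH >>= fun i =>
        b.eval (chi X) (Nat.pair u (Nat.pair y i))) m : Part ℕ)) → ∃ k, 
        v ∈ OracleCode.eval (strOracle (pre X k)) (.prec a b) (Nat.pair u m) := by
      intro m
      induction m with
      | zero =>
        intro v h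
        obtain ⟨k, hk⟩ := iha _ _ h
        exact ⟨k, by simpa [OracleCode.eval, Nat.unpaired] using hk⟩
      | succ m ih =>
        intro v h
        simp only [Part.bind_eq_bind, Part.mem_bind_iff] at h ih
        obtain ⟨x, hx, hy⟩ := h
        obtain ⟨k1, h1⟩ := ihb _ _ hy
        obtain ⟨k2, h2⟩ := ih _ hx
        have h1 := eval_pre_mono X b (le_max_left k1 k2) _ _ h1
        have h2 := eval_pre_mono X (.prec a b) (le_max_right k1 k2) _ _ h2
        refine ⟨max k1 k2, ?_⟩
        simp only [OracleCode.eval, Nat.unpaired, Nat.unpair_pair, Part.bind_eq_bind,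
          Part.mem_bind_iff] at h2 ⊢
        exact ⟨x, h2, h1⟩
    intro v h
    obtain ⟨k, hk⟩ := key _ _ h
    exact ⟨k, by simpa [OracleCode.eval, Nat.unpaired] using hk⟩
  | rfind' a iha =>
    intro n v h
    rw [mem_rfind'] at h
    obtain ⟨x, ⟨hy, hx⟩, rfl⟩ := h
    obtain ⟨k0, hk0⟩ := iha _ _ hy
    have : ∀ x', (∀ m < x', ∃ z ∈ a.eval (chi X) (Nat.pair n.unpair.1 (m + n.unpair.2)),
        z ≠ 0) → ∃ k, ∀ m < x',
        ∃ z ∈ a.eval (strOracle (pre X k)) (Nat.pair n.unpair.1 (m + n.unpair.2)),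
        z ≠ 0 := by
      intro x'
      induction x' with
      | zero => intro _; exact ⟨0, by simp⟩
      | succ x' ih =>
        intro h
        obtain ⟨k1, h1⟩ := ih (fun m hm => h m (by omega))
        obtain ⟨z, hz, hz'⟩ := h x' (Nat.lt_succ_self x')
        obtain ⟨k2, h2⟩ := iha _ _ hz
        refine ⟨max k1 k2, fun m hm => ?_⟩
        rcases Nat.lt_succ_iff_lt_or_eq.1 hm with hm | rfl
        · obtain ⟨w, hw, hw'⟩ := h1 m hm
          exact ⟨w, eval_pre_mono X a (le_max_left _ _) _ _ hw, hw'⟩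
        · exact ⟨z, eval_pre_mono X a (le_max_right _ _) _ _ h2, hz'⟩
    obtain ⟨k, hk⟩ := this x hx
    refine ⟨max k0 k, mem_rfind'.2 ⟨x, ⟨eval_pre_mono X a (le_max_left _ _) _ _ hk0, ?_⟩, rfl⟩⟩
    intro m hm
    obtain ⟨w, hw, hw'⟩ := hk m hm
    exact ⟨w, eval_pre_mono X a (le_max_right _ _) _ _ hw, hw'⟩

theorem partrec_str (c : OracleCode) :
    Partrec (fun q : List Bool × ℕ => c.eval (strOracle q.1) q.2) := by
  induction c with
  | zero => exact Computable.const 0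
  | succ => exact Computable.succ.comp Computable.snd
  | left => exact (Primrec.to_comp (by fun_prop : Primrec fun q : List Bool × ℕ => q.2.unpair.1))
  | right => exact (Primrec.to_comp (by fun_prop : Primrec fun q : List Bool × ℕ => q.2.unpair.2))
  | oracle =>
    have h : Primrec (fun q : List Bool × ℕ => (q.1[q.2]?).elim none (fun b => some (cond b 1 0))) := by fun_prop
    refine (Computable.ofOption h.to_comp).of_eq fun q => ?_
    apply Part.ext; intro v
    simp only [OracleCode.eval, strOracle_mem, Part.mem_ofOption]
    by_cases h : q.2 < q.1.length <;> simp [h]; grind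
  | pair a b iha ihb =>
    have h1 : Partrec (fun p : (List Bool × ℕ) × ℕ => b.eval (strOracle p.1.1) p.1.2) :=
      ihb.comp Computable.fst
    have h0 : Primrec fun p : ((List Bool × ℕ) × ℕ) × ℕ => Nat.pair p.1.2 p.2 := by fun_prop
    have h2 : Partrec (fun p : (List Bool × ℕ) × ℕ =>
        (b.eval (strOracle p.1.1) p.1.2).map (Nat.pair p.2)) := h1.map h0.to_comp
    have h3 : Partrec (fun q : List Bool × ℕ => (a.eval (strOracle q.1) q.2).bind fun x =>
        (b.eval (strOracle q.1) q.2).map (Nat.pair x)) := iha.bind h2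
    refine h3.of_eq fun q => ?_
    apply Part.ext; intro v
    simp [OracleCode.eval, Seq.seq]
  | comp a b iha ihb =>
    refine (ihb.bind (g := fun q y => a.eval (strOracle q.1) y) ?_).of_eq fun q => ?_
    · exact iha.comp (Primrec.to_comp (by fun_prop : Primrec fun p : (List Bool × ℕ) × ℕ => (p.1.1, p.2)))
    · rfl
  | prec a b iha ihb =>
    refine (Partrec.nat_rec (f := fun q : List Bool × ℕ => q.2.unpair.2)
       (g := fun q => a.eval (strOracle q.1) q.2.unpair.1)
       (h := fun q p => b.eval (strOracle q.1) (Nat.pair q.2.unpair.1 (Nat.pair p.1 p.2))) ?_ ?_ ?_).of_eq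
         fun q => ?_
    · exact (Primrec.to_comp (by fun_prop))
    · exact iha.comp (Primrec.to_comp (by fun_prop : Primrec fun q : (List Bool × ℕ) => (q.1, q.2.unpair.1)))
    · exact ihb.comp (Primrec.to_comp (by fun_prop : Primrec fun q : (List Bool × ℕ) × ℕ × ℕ => (q.1.1, (Nat.pair q.1.2.unpair.1 (Nat.pair q.2.1 q.2.2)))))
    · rfl
  | rfind' a iha =>
    refine (Partrec.map (f := fun q : List Bool × ℕ => Nat.rfind fun n => (fun m => decide (m = 0)) <$>
      a.eval (strOracle q.1) (Nat.pair q.2.unpair.1 (n + q.2.unpair.2)))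
      (g := fun q n => n + q.2.unpair.2) ?_ ?_).of_eq fun q => rfl
    · refine Partrec.rfind (p := fun (q : List Bool × ℕ) n => (fun m => decide (m = 0)) <$>
        a.eval (strOracle q.1) (Nat.pair q.2.unpair.1 (n + q.2.unpair.2))) ?_
      refine Partrec.map (f := fun p : (List Bool × ℕ) × ℕ =>
        a.eval (strOracle p.1.1) (Nat.pair p.1.2.unpair.1 (p.2 + p.1.2.unpair.2)))
        (g := fun _ m => decide (m = 0)) ?_ ?_
      · exact iha.comp (Primrec.to_comp (by fun_prop : Primrec fun q : (List Bool × ℕ) × ℕ => (q.1.1, (Nat.pair q.1.2.unpair.1 (q.2 + q.1.2.unpair.2)))))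
      · exact (Primrec.to_comp (by fun_prop : Primrec fun q : ((List Bool × ℕ) × ℕ) × ℕ => decide (q.2 = 0)))
    · exact (Primrec.to_comp (by fun_prop : Primrec fun q : (List Bool × ℕ) × ℕ => q.2 + q.1.2.unpair.2))

/-- `p` represents the oracle code `c` on strings -/
def Rep (c : OracleCode) (p : Nat.Partrec.Code) : Prop :=
  ∀ (ρ : List Bool) (x : ℕ), p.eval (encode (ρ, x)) = c.eval (strOracle ρ) x

theorem exists_rep (c : OracleCode) : ∃ p, Rep c p := by
  have h := partrec_str c
  obtain ⟨p, hp⟩ := Nat.Partrec.Code.exists_code.1 h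
  refine ⟨p, fun ρ x => ?_⟩
  rw [hp]
  simp only [encodek, Part.coe_some, Part.bind_some]
  exact Part.map_id' (fun _ => rfl) _

theorem encodeCode_inj : ∀ c d : OracleCode, c.encodeCode = d.encodeCode → c = d := by
  intro c
  induction c with
  | zero => intro d h; cases d <;> simp [OracleCode.encodeCode] at h ⊢
  | succ => intro d h; cases d <;> simp [OracleCode.encodeCode] at h ⊢
  | left => intro d h; cases d <;> simp [OracleCode.encodeCode] at h ⊢
  | right => intro d h; cases d <;> simp [OracleCode.encodeCode] at h ⊢
  | oracle => intro d h; cases d <;> simp [OracleCode.encodeCode] at h ⊢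
  | pair a b iha ihb =>
    intro d h
    cases d <;> simp only [OracleCode.encodeCode] at h <;> try omega
    rename_i x y
    have := Nat.pair_eq_pair.1 (show Nat.pair a.encodeCode b.encodeCode = Nat.pair x.encodeCode y.encodeCode by omega)
    rw [iha _ this.1, ihb _ this.2]
  | comp a b iha ihb =>
    intro d h
    cases d <;> simp only [OracleCode.encodeCode] at h <;> try omega
    rename_i x y
    have := Nat.pair_eq_pair.1 (show Nat.pair a.encodeCode b.encodeCode = Nat.pair x.encodeCode y.encodeCode by omega)
    rw [iha _ this.1, ihb _ this.2]
  | prec a b iha ihb =>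
    intro d h
    cases d <;> simp only [OracleCode.encodeCode] at h <;> try omega
    rename_i x y
    have := Nat.pair_eq_pair.1 (show Nat.pair a.encodeCode b.encodeCode = Nat.pair x.encodeCode y.encodeCode by omega)
    rw [iha _ this.1, ihb _ this.2]
  | rfind' a iha =>
    intro d h
    cases d <;> simp only [OracleCode.encodeCode] at h <;> try omega
    rename_i x
    have := Nat.pair_eq_pair.1 (show Nat.pair a.encodeCode a.encodeCode = Nat.pair x.encodeCode x.encodeCode by omega)
    rw [iha _ this.1]

/-- constant code -/
def constC : ℕ → OracleCode
  | 0 => .zero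
  | n+1 => .comp .succ (constC n)

theorem constC_eval (g : ℕ →. ℕ) (n x : ℕ) : (constC n).eval g x = Part.some n := by
  induction n with
  | zero => rfl
  | succ n ih =>
    refine Part.eq_some_iff.2 (mem_comp.2 ⟨n, ?_, ?_⟩)
    · rw [ih]; exact Part.mem_some _
    · exact Part.mem_some _

theorem pr_constC : Primrec (fun n => (constC n).encodeCode) := by
  have : Primrec (fun n : ℕ => (Nat.rec 0 (fun _ y => 4 * Nat.pair 1 y + 6) n : ℕ)) := by fun_prop
  refine this.of_eq fun n => ?_
  induction n with
  | zero => rfl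
  | succ n ih => simp [constC, OracleCode.encodeCode, ih]

/-- Jump tool: existential questions are decided by the halting problem. -/
theorem jump_tool {β : Type*} [Primcodable β] (D : β → ℕ → Bool)
    (hD : Primrec fun p : β × ℕ => D p.1 p.2) :
    ∃ h : β → ℕ, Primrec h ∧ ∀ w, zeroJump (h w) = true ↔ ∃ t, D w t = true := by
  obtain ⟨c, hc⟩ := ce_search (fun _ => false)
    (fun a n => (decode n : Option β).elim false (fun w => D w a.length)) (by
      have : Primrec (fun q : (List Bool × ℕ) × β => D q.2 q.1.1.length) := 
        hD.comp (g := fun q : (List Bool × ℕ) × β => (q.2, q.1.1.length)) (by fun_prop)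
      fun_prop)
  refine ⟨fun w => (OracleCode.comp c (constC (encode w))).encodeCode, ?_, fun w => ?_⟩
  · have := pr_constC.comp (Primrec.encode (α := β))
    simp only [OracleCode.encodeCode]
    fun_prop
  · unfold zeroJump jump
    rw [@decide_eq_true_iff _ (Classical.dec _)]
    have h2 : ((OracleCode.comp c (constC (encode w))).eval (chi fun _ => false)
        (OracleCode.comp c (constC (encode w))).encodeCode).Dom ↔ ∃ t, D w t = true := by
      rw [Part.dom_iff_mem]
      simp only [mem_comp, constC_eval]
      have := hc (encode w)
      rw [Part.dom_iff_mem] at this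
      simp only [Part.mem_some_iff, exists_eq_left, this]
      simp only [encodek, Option.elim, pre_length]
    rw [← h2]
    constructor
    · rintro ⟨d, hd, hd'⟩
      rw [encodeCode_inj _ _ hd] at hd'
      exact hd'
    · intro h; exact ⟨_, rfl, h⟩
end TypicalDegree

namespace TypicalDegree
open Encodable

abbrev Str := List Bool
/-- State: list of records, root, current string -/
abbrev State := List (ℕ × Option (Str × Str)) × ℕ × Str

def pfx (a b : Str) : Bool := decide (b.take a.length = a)
def cpt (a b : Str) : Bool := pfx a b || pfx b a
def out (t : ℕ) (p : Nat.Partrec.Code) (ρ a : Str) : Bool :=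
  (List.range a.length).all fun x => (List.range (ρ.length + 1)).any fun i =>
    decide (p.evaln t (encode (ρ.take i, x)) = some (cond (a.getD x false) 1 0))
def allStr (t : ℕ) : List Str :=
  Nat.rec [[]] (fun _ L => L.flatMap fun a => [a ++ [false], a ++ [true]]) t
def strs (t : ℕ) : List Str := (List.range (t+1)).flatMap fun i => allStr i
def cnt (t : ℕ) (f : Str → Bool) : ℕ := ((allStr t).filter f).length
def un (k : ℕ) : Str := (List.range k).map (fun _ => false) ++ [true]
def key (z : Str) (l : ℕ) : ℕ := encode (z, l)

def wit (t l : ℕ) (σ z : Str) : Option Str :=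
  ((List.range t).filterMap fun n => (decode n : Option (Str × ℕ)).elim none fun p =>
    if (pfx (σ ++ un (key z l)) p.1 && out p.2 (Denumerable.ofNat Nat.Partrec.Code l) p.1 z) = true
      then some p.1 else none).head?
def inS (t l : ℕ) (σ z : Str) : Bool := (wit t l σ z).isSome
def pairEv (t l : ℕ) (σ : Str) : Bool :=
  (strs t).any fun z0 => (strs t).any fun z1 => inS t l σ z0 && inS t l σ z1 && !cpt z0 z1

def bad (t : ℕ) (L : List (ℕ × Option (Str × Str))) (i : ℕ) : Bool :=
  (L[i]?).elim false fun r => r.2.elim false fun q => inS t i q.1 q.2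
def failAt (t : ℕ) (L : List (ℕ × Option (Str × Str))) : Option ℕ :=
  ((List.range L.length).filter (bad t L)).head?
def quiet (t : ℕ) (s : State) : Bool := !(failAt t s.1).isSome && !pairEv t s.1.length s.2.2

section
variable (P H : Nat.Partrec.Code)
def wt (t : ℕ) (z : Str) : ℕ :=
  cnt t fun ρ => (strs t).any fun a => out t P ρ a && out t H a z
def light (j t : ℕ) (s : State) (z : Str) : Bool :=
  decide (wt P H t z * 2 ^ (2 * (j + s.2.1 + 2) + 20 + encode s) ≤ 2 ^ t)
def isKey (j t : ℕ) (s : State) (z : Str) : Bool :=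
  light P H j t s z && (List.range z.length).all fun m => !light P H j t s (z.take m)
def cst (T : List (Str × State)) (a : Str) (s : State) : Bool :=
  T.all fun p => !pfx a p.1 || decide (p.2 = s)
def VV (t : ℕ) (T : List (Str × State)) (s : State) (ρ : Str) : Bool :=
  (strs t).any fun a => cst T a s && out t P ρ a
def QK (j t : ℕ) (T : List (Str × State)) (s : State) (z : Str) (ρ : Str) : Bool :=
  isKey P H j t s z && (strs t).any fun a => cst T a s && out t P ρ a && out t H a z
def Qm (j t : ℕ) (T : List (Str × State)) (s : State) (ρ : Str) : Bool :=
  (strs t).any fun z => QK P H j t T s z ρ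
def active (j t : ℕ) (T : List (Str × State)) (s : State) : Bool :=
  quiet t s && decide (cnt t (VV P t T s) ≤ cnt t (Qm P H j t T s) * 2 ^ (j + s.2.1 + 4))
def ovf (j t : ℕ) (T : List (Str × State)) (r : ℕ) : Bool :=
  decide (2 ^ t < 2 ^ (j + r + 3) * cnt t fun ρ => T.any fun p =>
    decide (p.2.2.1 = r) && active P H j t T p.2 && Qm P H j t T p.2 ρ)
def rel (j t : ℕ) (T : List (Str × State)) (s : State) (z : Str) : Bool :=
  decide (2 * (cnt t fun ρ => (strs t).any fun z' => decide (encode z' ≤ encode z) &&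
    QK P H j t T s z' ρ) ≤ cnt t (Qm P H j t T s))
def relz (j t : ℕ) (T : List (Str × State)) (s : State) (α : Str) : Option Str :=
  ((strs t).filter fun z => isKey P H j t s z && out t H α z && rel P H j t T s z).head?
def confl (t l : ℕ) (σ α : Str) : Option Str :=
  ((strs t).filter fun z => inS t l σ z && (strs t).any fun y => out t H α y && !cpt y z).head?
def upd (j t : ℕ) (T : List (Str × State)) (α : Str) (s : State) : State :=
  (failAt t s.1).elim
    (if pairEv t s.1.length s.2.2 = true then
      (confl H t s.1.length s.2.2 α).elim s fun z => (wit t s.1.length s.2.2 z).elim s fun τ =>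
        (s.1 ++ [(s.2.1, none)], t + 1, τ ++ un (encode α))
    else if (ovf P H j t T s.2.1 && active P H j t T s) = true then
      (relz P H j t T s α).elim s fun z =>
        (s.1 ++ [(s.2.1, some (s.2.2, z))], t + 1, s.2.2 ++ un (key z s.1.length) ++ un (encode α))
    else s)
    fun i => (s.1.take i, (s.1.getD i (0, none)).1, s.2.2)
def tbl (j t : ℕ) : List (Str × State) :=
  Nat.rec [([], ([], 0, []))] (fun t T => T.flatMap fun p =>
    [(p.1 ++ [false], upd P H j t T (p.1 ++ [false]) p.2),
     (p.1 ++ [true], upd P H j t T (p.1 ++ [true]) p.2)]) t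
def st (j : ℕ) (X : ℕ → Bool) (t : ℕ) : State :=
  Nat.rec ([], 0, []) (fun t s => upd P H j t (tbl P H j t) (pre X (t+1)) s) t
end

section
variable {γ : Type*} [Primcodable γ]
  {j t l r : γ → ℕ} {a b σ z ρ α : γ → Str} {s : γ → State} {T : γ → List (Str × State)}
  {p : γ → Nat.Partrec.Code} {L : γ → List (ℕ × Option (Str × Str))}
@[fun_prop] theorem pr_pfx (ha : Primrec a) (hb : Primrec b) : Primrec fun x => pfx (a x) (b x) := by
  unfold pfx; fun_prop
@[fun_prop] theorem pr_cpt (ha : Primrec a) (hb : Primrec b) : Primrec fun x => cpt (a x) (b x) := by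
  unfold cpt; fun_prop
@[fun_prop] theorem pr_out (ht : Primrec t) (hp : Primrec p) (ha : Primrec a) (hb : Primrec b) :
    Primrec fun x => out (t x) (p x) (a x) (b x) := by
  unfold out; fun_prop
@[fun_prop] theorem pr_allStr (ht : Primrec t) : Primrec fun x => allStr (t x) := by
  unfold allStr; fun_prop
@[fun_prop] theorem pr_strs (ht : Primrec t) : Primrec fun x => strs (t x) := by
  unfold strs; fun_prop
@[fun_prop] theorem pr_cnt {f : γ → Str → Bool} (ht : Primrec t)
    (hf : Primrec fun q : γ × Str => f q.1 q.2) : Primrec fun x => cnt (t x) (f x) := by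
  unfold cnt; fun_prop
@[fun_prop] theorem pr_un (ht : Primrec t) : Primrec fun x => un (t x) := by
  unfold un; fun_prop
@[fun_prop] theorem pr_key (ha : Primrec a) (ht : Primrec t) : Primrec fun x => key (a x) (t x) := by
  unfold key; fun_prop
@[fun_prop] theorem pr_wit (ht : Primrec t) (hl : Primrec l) (hs : Primrec σ) (hz : Primrec z) :
    Primrec fun x => wit (t x) (l x) (σ x) (z x) := by
  unfold wit; fun_prop
@[fun_prop] theorem pr_inS (ht : Primrec t) (hl : Primrec l) (hs : Primrec σ) (hz : Primrec z) :
    Primrec fun x => inS (t x) (l x) (σ x) (z x) := by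
  unfold inS; fun_prop
@[fun_prop] theorem pr_pairEv (ht : Primrec t) (hl : Primrec l) (hs : Primrec σ) :
    Primrec fun x => pairEv (t x) (l x) (σ x) := by
  unfold pairEv; fun_prop
@[fun_prop] theorem pr_bad (ht : Primrec t) (hL : Primrec L) (hl : Primrec l) :
    Primrec fun x => bad (t x) (L x) (l x) := by
  unfold bad; fun_prop
@[fun_prop] theorem pr_failAt (ht : Primrec t) (hL : Primrec L) :
    Primrec fun x => failAt (t x) (L x) := by
  unfold failAt; fun_prop
@[fun_prop] theorem pr_quiet (ht : Primrec t) (hs : Primrec s) :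
    Primrec fun x => quiet (t x) (s x) := by
  unfold quiet; fun_prop
variable (P H : Nat.Partrec.Code)
@[fun_prop] theorem pr_wt (ht : Primrec t) (hz : Primrec z) : Primrec fun x => wt P H (t x) (z x) := by
  unfold wt; fun_prop
@[fun_prop] theorem pr_light (hj : Primrec j) (ht : Primrec t) (hs : Primrec s) (hz : Primrec z) :
    Primrec fun x => light P H (j x) (t x) (s x) (z x) := by
  unfold light; fun_prop
@[fun_prop] theorem pr_isKey (hj : Primrec j) (ht : Primrec t) (hs : Primrec s) (hz : Primrec z) :
    Primrec fun x => isKey P H (j x) (t x) (s x) (z x) := by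
  unfold isKey; fun_prop
@[fun_prop] theorem pr_cst (hT : Primrec T) (ha : Primrec a) (hs : Primrec s) :
    Primrec fun x => cst (T x) (a x) (s x) := by
  unfold cst; fun_prop
@[fun_prop] theorem pr_VV (ht : Primrec t) (hT : Primrec T) (hs : Primrec s) (hr : Primrec ρ) :
    Primrec fun x => VV P (t x) (T x) (s x) (ρ x) := by
  unfold VV; fun_prop
@[fun_prop] theorem pr_QK (hj : Primrec j) (ht : Primrec t) (hT : Primrec T) (hs : Primrec s)
    (hz : Primrec z) (hr : Primrec ρ) :
    Primrec fun x => QK P H (j x) (t x) (T x) (s x) (z x) (ρ x) := by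
  unfold QK; fun_prop
@[fun_prop] theorem pr_Qm (hj : Primrec j) (ht : Primrec t) (hT : Primrec T) (hs : Primrec s)
    (hr : Primrec ρ) :
    Primrec fun x => Qm P H (j x) (t x) (T x) (s x) (ρ x) := by
  unfold Qm; fun_prop
@[fun_prop] theorem pr_active (hj : Primrec j) (ht : Primrec t) (hT : Primrec T) (hs : Primrec s) :
    Primrec fun x => active P H (j x) (t x) (T x) (s x) := by
  unfold active; fun_prop
@[fun_prop] theorem pr_ovf (hj : Primrec j) (ht : Primrec t) (hT : Primrec T) (hr : Primrec r) :
    Primrec fun x => ovf P H (j x) (t x) (T x) (r x) := by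
  unfold ovf; fun_prop
@[fun_prop] theorem pr_rel (hj : Primrec j) (ht : Primrec t) (hT : Primrec T) (hs : Primrec s)
    (hz : Primrec z) : Primrec fun x => rel P H (j x) (t x) (T x) (s x) (z x) := by
  unfold rel; fun_prop
@[fun_prop] theorem pr_relz (hj : Primrec j) (ht : Primrec t) (hT : Primrec T) (hs : Primrec s)
    (ha : Primrec α) : Primrec fun x => relz P H (j x) (t x) (T x) (s x) (α x) := by
  unfold relz; fun_prop
@[fun_prop] theorem pr_confl (ht : Primrec t) (hl : Primrec l) (hs : Primrec σ)
    (ha : Primrec α) : Primrec fun x => confl H (t x) (l x) (σ x) (α x) := by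
  unfold confl; fun_prop
@[fun_prop] theorem pr_upd (hj : Primrec j) (ht : Primrec t) (hT : Primrec T) 
    (ha : Primrec α) (hs : Primrec s) : Primrec fun x => upd P H (j x) (t x) (T x) (α x) (s x) := by
  unfold upd; fun_prop
@[fun_prop] theorem pr_tbl (hj : Primrec j) (ht : Primrec t) :
    Primrec fun x => tbl P H (j x) (t x) := by
  unfold tbl; fun_prop
end
end TypicalDegree

namespace TypicalDegree
open Encodable

theorem pfx_iff {a b : Str} : pfx a b = true ↔ a <+: b := by
  unfold pfx
  rw [decide_eq_true_iff, List.prefix_iff_eq_take, eq_comm]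
theorem cpt_iff {a b : Str} : cpt a b = true ↔ (a <+: b ∨ b <+: a) := by
  simp [cpt, pfx_iff]
theorem cpt_comm (a b : Str) : cpt a b = cpt b a := by simp [cpt, Bool.or_comm]

theorem allStr_zero : allStr 0 = [[]] := rfl
theorem allStr_succ (t : ℕ) : allStr (t+1) = (allStr t).flatMap fun a => [a ++ [false], a ++ [true]] := rfl
theorem mem_allStr {t : ℕ} {a : Str} : a ∈ allStr t ↔ a.length = t := by
  induction t generalizing a with
  | zero => simp [allStr_zero]
  | succ t ih =>
    rw [allStr_succ, List.mem_flatMap]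
    constructor
    · rintro ⟨b, hb, h⟩
      rw [ih] at hb
      simp at h
      rcases h with rfl | rfl <;> simp [hb]
    · intro h
      have hne : a ≠ [] := by rintro rfl; simp at h
      refine ⟨a.dropLast, ih.2 (by simp [h]), ?_⟩
      have := List.dropLast_append_getLast hne
      cases hb : a.getLast hne <;> rw [hb] at this <;> simp [this]
theorem nodup_allStr (t : ℕ) : (allStr t).Nodup := by
  induction t with
  | zero => simp [allStr_zero]
  | succ t ih =>
    rw [allStr_succ, List.nodup_flatMap]
    refine ⟨fun a _ => by simp, ?_⟩
    refine ih.imp ?_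
    intro a b hab
    simp [Function.onFun, List.disjoint_left]
    grind
theorem mem_strs {t : ℕ} {a : Str} : a ∈ strs t ↔ a.length ≤ t := by
  simp [strs, mem_allStr]

theorem prefix_of_pre {a : Str} {X : ℕ → Bool} : (∃ n, a <+: pre X n) ↔ Sub a X :=
  ⟨fun ⟨_, h⟩ => sub_of_prefix_pre h, fun h => ⟨_, h.initOf le_rfl⟩⟩

/-! output lemmas -/
theorem out_iff {t : ℕ} {p : Nat.Partrec.Code} {ρ a : Str} : out t p ρ a = true ↔
    ∀ x (hx : x < a.length), ∃ ρ', ρ' <+: ρ ∧ (cond a[x] 1 0) ∈ p.evaln t (encode (ρ', x)) := by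
  unfold out
  simp only [List.all_eq_true, List.mem_range, List.any_eq_true, decide_eq_true_iff]
  refine forall_congr' fun x => forall_congr' fun hx => ?_
  constructor
  · rintro ⟨i, _, h⟩
    refine ⟨ρ.take i, List.take_prefix _ _, ?_⟩
    rw [h]; simp [hx]
  · rintro ⟨ρ', h, h'⟩
    refine ⟨ρ'.length, Nat.lt_succ_of_le h.length_le, ?_⟩
    rw [← List.prefix_iff_eq_take.1 h]
    simpa [hx] using h'

theorem out_mono {t t' : ℕ} {p : Nat.Partrec.Code} {ρ ρ' a a' : Str} (h : out t p ρ a = true)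
    (ht : t ≤ t') (hρ : ρ <+: ρ') (ha : a' <+: a) : out t' p ρ' a' = true := by
  rw [out_iff] at *
  intro x hx
  obtain ⟨ρ0, h0, h1⟩ := h x (hx.trans_le ha.length_le)
  refine ⟨ρ0, h0.trans hρ, Nat.Partrec.Code.evaln_mono ht ?_⟩
  rw [ha.getElem hx]; exact h1

theorem out_nil (t : ℕ) (p : Nat.Partrec.Code) (ρ : Str) : out t p ρ [] = true := by simp [out]

/-- Output sequence, junk allowed -/
noncomputable def sOut (c : OracleCode) (R : ℕ → Bool) : ℕ → Bool := fun x =>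
  @decide (1 ∈ c.eval (chi R) x) (Classical.dec _)

theorem sOut_of_total {c : OracleCode} {R A : ℕ → Bool} (h : FTotal c R A) : sOut c R = A := by
  funext x
  unfold sOut
  rw [h]
  cases hA : A x <;> simp [chi, hA]

theorem out_sound {c : OracleCode} {p : Nat.Partrec.Code} (hp : Rep c p) {t : ℕ} {ρ a : Str}
    (h : out t p ρ a = true) {R : ℕ → Bool} (hR : Sub ρ R) : Sub a (sOut c R) := by
  rw [out_iff] at h
  rw [sub_iff]
  intro x hx
  obtain ⟨ρ', h1, h2⟩ := h x hx
  have h3 := Nat.Partrec.Code.evaln_sound h2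
  rw [hp] at h3
  have h4 := eval_mono (strOracle_chi (hR.mono h1)) c _ _ h3
  unfold sOut
  cases hA : a[x]
  · rw [eq_comm, decide_eq_false_iff_not]
    intro h5
    rw [hA] at h4
    have := Part.mem_unique h4 h5
    simp at this
  · rw [eq_comm, @decide_eq_true_iff _ (Classical.dec _)]
    rw [hA] at h4; exact h4

theorem out_cpt {c : OracleCode} {p : Nat.Partrec.Code} (hp : Rep c p) {t t' : ℕ} {ρ ρ' a a' : Str}
    (h : out t p ρ a = true) (h' : out t' p ρ' a' = true) (hc : ρ <+: ρ' ∨ ρ' <+: ρ) :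
    cpt a a' = true := by
  rw [cpt_iff]
  rcases hc with hc | hc
  · obtain ⟨R, hR⟩ := sub_extend ρ'
    exact (out_sound hp h (hR.mono hc)).compat (out_sound hp h' hR)
  · obtain ⟨R, hR⟩ := sub_extend ρ
    exact (out_sound hp h hR).compat (out_sound hp h' (hR.mono hc))

theorem out_complete {c : OracleCode} {p : Nat.Partrec.Code} (hp : Rep c p) {R A : ℕ → Bool}
    (h : FTotal c R A) (m : ℕ) : ∃ t, out t p (pre R t) (pre A m) = true := by
  have : ∃ t, ∀ x < m, ∃ k ≤ t, (cond (A x) 1 0) ∈ p.evaln t (encode (pre R k, x)) := by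
    induction m with
    | zero => exact ⟨0, by simp⟩
    | succ m ih =>
      obtain ⟨t, ht⟩ := ih
      have h1 : (cond (A m) 1 0) ∈ c.eval (chi R) m := by rw [h]; simp [chi]
      obtain ⟨k, hk⟩ := eval_compact R c _ _ h1
      rw [← hp, Nat.Partrec.Code.evaln_complete] at hk
      obtain ⟨u, hu⟩ := hk
      refine ⟨t + k + u, fun x hx => ?_⟩
      rcases Nat.lt_succ_iff_lt_or_eq.1 hx with hx | rfl
      · obtain ⟨k', h1, h2⟩ := ht x hx
        exact ⟨k', by omega, Nat.Partrec.Code.evaln_mono (by omega) h2⟩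
      · exact ⟨k, by omega, Nat.Partrec.Code.evaln_mono (by omega) hu⟩
  obtain ⟨t, ht⟩ := this
  refine ⟨t, out_iff.2 fun x hx => ?_⟩
  obtain ⟨k, h1, h2⟩ := ht x (by simpa using hx)
  exact ⟨pre R k, pre_initOf R h1, by rw [pre_getElem]; exact h2⟩

/-! unary -/
theorem un_length (k : ℕ) : (un k).length = k + 1 := by simp [un]
theorem sub_un {σ : Str} {k : ℕ} {C : ℕ → Bool} (h : Sub (σ ++ un k) C) :
    (∀ i < k, C (σ.length + i) = false) ∧ C (σ.length + k) = true := by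
  rw [sub_iff] at h
  constructor
  · intro i hi
    rw [← h (σ.length + i) (by simp [un_length]; omega)]
    simp [un, hi]
  · rw [← h (σ.length + k) (by simp [un_length])]
    simp [un]
theorem un_unique {σ : Str} {k k' : ℕ} {C : ℕ → Bool} (h : Sub (σ ++ un k) C)
    (h' : Sub (σ ++ un k') C) : k = k' := by
  have a := sub_un h
  have b := sub_un h'
  rcases lt_trichotomy k k' with hk | hk | hk
  · have := b.1 k hk; rw [a.2] at this; simp at this
  · exact hk
  · have := a.1 k' hk; rw [b.2] at this; simp at this
theorem key_inj {z z' : Str} {l l' : ℕ} (h : key z l = key z' l') : z = z' ∧ l = l' := by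
  have := Encodable.encode_injective h
  simpa using this

/-! witnesses -/
theorem wit_mono {t t' l : ℕ} {σ z τ : Str} (h : wit t l σ z = some τ) (ht : t ≤ t') :
    wit t' l σ z = some τ := by
  obtain ⟨d, rfl⟩ := Nat.exists_eq_add_of_le ht
  unfold wit at *
  rw [List.range_add, List.filterMap_append, List.head?_append, h]; rfl
theorem wit_spec {t l : ℕ} {σ z τ : Str} (h : wit t l σ z = some τ) :
    (σ ++ un (key z l)) <+: τ ∧ ∃ u, out u (Denumerable.ofNat Nat.Partrec.Code l) τ z = true := by
  unfold wit at h
  have := List.mem_of_mem_head? h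
  rw [List.mem_filterMap] at this
  obtain ⟨n, _, hn⟩ := this
  cases hd : (decode n : Option (Str × ℕ)) with
  | none => simp [hd] at hn
  | some p =>
    rw [hd] at hn
    simp only [Option.elim] at hn
    split at hn
    · next hc =>
      simp only [Option.some.injEq] at hn
      subst hn
      rw [Bool.and_eq_true, pfx_iff] at hc
      exact ⟨hc.1, _, hc.2⟩
    · simp at hn
theorem inS_ex {l : ℕ} {σ z τ : Str} {u : ℕ} (h1 : (σ ++ un (key z l)) <+: τ)
    (h2 : out u (Denumerable.ofNat Nat.Partrec.Code l) τ z = true) : ∃ t, inS t l σ z = true := by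
  refine ⟨encode (τ, u) + 1, ?_⟩
  unfold inS wit
  rw [List.isSome_head?]
  refine List.ne_nil_of_mem (a := τ) (List.mem_filterMap.2 ?_)
  refine ⟨encode (τ, u), by simp, ?_⟩
  rw [encodek]
  simp [pfx_iff.2 h1, h2]
theorem inS_mono {t t' l : ℕ} {σ z : Str} (h : inS t l σ z = true) (ht : t ≤ t') :
    inS t' l σ z = true := by
  unfold inS at *
  obtain ⟨τ, hτ⟩ := Option.isSome_iff_exists.1 h
  rw [wit_mono hτ ht]; rfl
theorem pairEv_iff {t l : ℕ} {σ : Str} : pairEv t l σ = true ↔ ∃ z0 z1 : Str, z0.length ≤ t ∧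
    z1.length ≤ t ∧ inS t l σ z0 = true ∧ inS t l σ z1 = true ∧ cpt z0 z1 = false := by
  simp only [pairEv, List.any_eq_true, mem_strs, Bool.and_eq_true, Bool.not_eq_true']
  constructor
  · rintro ⟨z0, h0, z1, h1, ⟨h2, h3⟩, h4⟩; exact ⟨z0, z1, h0, h1, h2, h3, h4⟩
  · rintro ⟨z0, z1, h0, h1, h2, h3, h4⟩; exact ⟨z0, h0, z1, h1, ⟨h2, h3⟩, h4⟩
theorem pairEv_mono {t t' l : ℕ} {σ : Str} (h : pairEv t l σ = true) (ht : t ≤ t') :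
    pairEv t' l σ = true := by
  rw [pairEv_iff] at *
  obtain ⟨z0, z1, h0, h1, h2, h3, h4⟩ := h
  exact ⟨z0, z1, h0.trans ht, h1.trans ht, inS_mono h2 ht, inS_mono h3 ht, h4⟩
theorem bad_iff {t : ℕ} {L : List (ℕ × Option (Str × Str))} {i : ℕ} : bad t L i = true ↔
    ∃ r σ z, L[i]? = some (r, some (σ, z)) ∧ inS t i σ z = true := by
  unfold bad
  cases h : L[i]? with
  | none => simp
  | some x =>
    obtain ⟨r, o⟩ := x
    cases o with
    | none => simp
    | some q => obtain ⟨a, b⟩ := q; simp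
theorem bad_mono {t t' : ℕ} {L : List (ℕ × Option (Str × Str))} {i : ℕ} (h : bad t L i = true)
    (ht : t ≤ t') : bad t' L i = true := by
  rw [bad_iff] at *
  obtain ⟨r, σ, z, h1, h2⟩ := h
  exact ⟨r, σ, z, h1, inS_mono h2 ht⟩
theorem failAt_none {t : ℕ} {L : List (ℕ × Option (Str × Str))} : failAt t L = none ↔
    ∀ i, bad t L i = false := by
  simp only [failAt, List.head?_eq_none_iff, List.filter_eq_nil_iff, List.mem_range, Bool.not_eq_true]
  constructor
  · intro h i
    by_cases hi : i < L.length
    · exact h i hi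
    · simp [bad, List.getElem?_eq_none (not_lt.1 hi)]
  · intro h i _; exact h i
theorem failAt_some {t : ℕ} {L : List (ℕ × Option (Str × Str))} {i : ℕ} (h : failAt t L = some i) :
    i < L.length ∧ bad t L i = true := by
  have := List.mem_of_mem_head? h
  simpa [List.mem_filter] using this
theorem failAt_anti {t t' : ℕ} {L : List (ℕ × Option (Str × Str))} (h : failAt t' L = none)
    (ht : t ≤ t') : failAt t L = none := by
  rw [failAt_none] at *
  intro i
  by_contra hb
  have := bad_mono (by simpa using hb) ht
  rw [h i] at this; simp at this
theorem quiet_iff {t : ℕ} {s : State} : quiet t s = true ↔ failAt t s.1 = none ∧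
    pairEv t s.1.length s.2.2 = false := by
  simp [quiet]
end TypicalDegree

namespace TypicalDegree
open Encodable

section
variable (P H : Nat.Partrec.Code) (j : ℕ)

theorem st_zero (X : ℕ → Bool) : st P H j X 0 = ([], 0, []) := rfl
theorem st_succ (X : ℕ → Bool) (t : ℕ) : st P H j X (t+1) =
    upd P H j t (tbl P H j t) (pre X (t+1)) (st P H j X t) := rfl
theorem tbl_succ (t : ℕ) : tbl P H j (t+1) = (tbl P H j t).flatMap fun p =>
    [(p.1 ++ [false], upd P H j t (tbl P H j t) (p.1 ++ [false]) p.2),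
     (p.1 ++ [true], upd P H j t (tbl P H j t) (p.1 ++ [true]) p.2)] := rfl

theorem st_congr {X Y : ℕ → Bool} {t : ℕ} (h : pre X t = pre Y t) : st P H j X t = st P H j Y t := by
  induction t with
  | zero => rfl
  | succ t ih =>
    have h' : pre X t = pre Y t := by
      rw [← pre_take X (t+1) t (by omega), h, pre_take Y (t+1) t (by omega)]
    rw [st_succ, st_succ, ih h', h]

theorem mem_tbl {t : ℕ} {p : Str × State} : p ∈ tbl P H j t ↔ ∃ X, p = (pre X t, st P H j X t) := by
  induction t generalizing p with
  | zero => simp [tbl, st_zero]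
  | succ t ih =>
    rw [tbl_succ, List.mem_flatMap]
    have key : ∀ (X : ℕ → Bool) (b : Bool), ∃ Y, pre Y t = pre X t ∧ Y t = b := by
      intro X b
      refine ⟨fun n => if n < t then X n else b, ?_, by simp⟩
      apply List.ext_getElem
      · simp
      · intro i h1 h2
        rw [pre_getElem, pre_getElem]
        have : i < t := by simpa using h1
        simp [this]
    constructor
    · rintro ⟨q, hq, hp⟩
      obtain ⟨X, rfl⟩ := ih.1 hq
      have : ∃ b, p = (pre X t ++ [b], upd P H j t (tbl P H j t) (pre X t ++ [b]) (st P H j X t)) := by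
        simp at hp; rcases hp with hp | hp
        · exact ⟨false, hp⟩
        · exact ⟨true, hp⟩
      obtain ⟨b, rfl⟩ := this
      obtain ⟨Y, h1, h2⟩ := key X b
      refine ⟨Y, ?_⟩
      rw [st_succ, st_congr P H j h1, pre_succ, h1, h2]
    · rintro ⟨X, rfl⟩
      refine ⟨_, ih.2 ⟨X, rfl⟩, ?_⟩
      rw [st_succ, pre_succ]
      cases X t <;> simp

theorem cst_iff {t : ℕ} {a : Str} {s : State} (ha : a.length ≤ t) :
    cst (tbl P H j t) a s = true ↔ ∀ X, Sub a X → st P H j X t = s := by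
  simp only [cst, List.all_eq_true, Bool.or_eq_true, Bool.not_eq_true', decide_eq_true_iff]
  constructor
  · intro h X hX
    rcases h _ ((mem_tbl P H j).2 ⟨X, rfl⟩) with h | h
    · have := pfx_iff.2 (hX.initOf ha)
      rw [h] at this; simp at this
    · exact h
  · intro h p hp
    obtain ⟨X, rfl⟩ := (mem_tbl P H j).1 hp
    by_cases hx : pfx a (pre X t) = true
    · right; exact h X (sub_of_prefix_pre (pfx_iff.1 hx))
    · left; simpa using hx

theorem upd_cases (t : ℕ) (T : List (Str × State)) (α : Str) (s : State) :
    (failAt t s.1 = none ∧ upd P H j t T α s = s) ∨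
    (∃ i, failAt t s.1 = some i ∧
      upd P H j t T α s = (s.1.take i, (s.1.getD i (0, none)).1, s.2.2)) ∨
    (∃ z τ, failAt t s.1 = none ∧ pairEv t s.1.length s.2.2 = true ∧
      confl H t s.1.length s.2.2 α = some z ∧ wit t s.1.length s.2.2 z = some τ ∧
      upd P H j t T α s = (s.1 ++ [(s.2.1, none)], t + 1, τ ++ un (encode α))) ∨
    (∃ z, failAt t s.1 = none ∧ pairEv t s.1.length s.2.2 = false ∧
      ovf P H j t T s.2.1 = true ∧ active P H j t T s = true ∧ relz P H j t T s α = some z ∧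
      upd P H j t T α s = (s.1 ++ [(s.2.1, some (s.2.2, z))], t + 1,
        s.2.2 ++ un (key z s.1.length) ++ un (encode α))) := by
  unfold upd
  cases hf : failAt t s.1 with
  | some i => right; left; exact ⟨i, rfl, rfl⟩
  | none =>
    by_cases hp : pairEv t s.1.length s.2.2 = true
    · cases hc : confl H t s.1.length s.2.2 α with
      | none => left; simp [hp]
      | some z =>
        cases hw : wit t s.1.length s.2.2 z with
        | none => left; simp [hp, hw]
        | some τ => right; right; left; exact ⟨z, τ, rfl, hp, rfl, hw, by simp [hp, hw]⟩
    · have hp : pairEv t s.1.length s.2.2 = false := by simpa using hp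
      by_cases ho : (ovf P H j t T s.2.1 && active P H j t T s) = true
      · cases hc : relz P H j t T s α with
        | none => left; simp [hp, ho]
        | some z =>
          right; right; right
          rw [Bool.and_eq_true] at ho
          exact ⟨z, rfl, hp, ho.1, ho.2, rfl, by simp [hp, ho]⟩
      · left; simp [hp, ho]

theorem upd_keep1 {t : ℕ} {T : List (Str × State)} {α : Str} {s : State} (hq : quiet t s = true)
    (h : (ovf P H j t T s.2.1 && active P H j t T s) = false ∨ relz P H j t T s α = none) :
    upd P H j t T α s = s := by
  obtain ⟨h1, h2⟩ := quiet_iff.1 hq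
  unfold upd
  rw [h1]
  rcases h with h | h
  · simp [h2, h]
  · simp [h2, h]

/-- list of roots -/
def rl (s : State) : List ℕ := s.1.map Prod.fst ++ [s.2.1]

theorem rl_root (s : State) : (rl s)[s.1.length]? = some s.2.1 := by
  simp [rl]
theorem rl_length (s : State) : (rl s).length = s.1.length + 1 := by simp [rl]
theorem rl_rec {s : State} {i : ℕ} {r : ℕ} {o} (h : s.1[i]? = some (r, o)) : (rl s)[i]? = some r := by
  obtain ⟨hi, h⟩ := List.getElem?_eq_some_iff.1 h
  simp [rl, List.getElem?_append_left, hi, h]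

theorem rl_step (t : ℕ) (T : List (Str × State)) (α : Str) (s : State) :
    rl (upd P H j t T α s) = rl s ∨
    (∃ i, failAt t s.1 = some i ∧ rl (upd P H j t T α s) = (rl s).take (i+1)) ∨
    rl (upd P H j t T α s) = rl s ++ [t+1] := by
  rcases upd_cases P H j t T α s with ⟨_, h⟩ | ⟨i, hi, h⟩ | ⟨z, τ, _, _, _, _, h⟩ | ⟨z, _, _, _, _, _, h⟩
  · left; rw [h]
  · right; left
    refine ⟨i, hi, ?_⟩
    have hl := (failAt_some hi).1
    rw [h]
    simp only [rl]
    rw [List.take_append_of_le_length (by simpa using hl), List.take_add_one, ← List.map_take]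
    simp [hl]
  · right; right; rw [h]; simp [rl]
  · right; right; rw [h]; simp [rl]

theorem wf (X : ℕ → Bool) (t : ℕ) : (rl (st P H j X t)).Nodup ∧ ∀ r ∈ rl (st P H j X t), r ≤ t := by
  induction t with
  | zero => simp [st_zero, rl]
  | succ t ih =>
    rw [st_succ]
    rcases rl_step P H j t (tbl P H j t) (pre X (t+1)) (st P H j X t) with h | ⟨i, _, h⟩ | h
    · rw [h]; exact ⟨ih.1, fun r hr => (ih.2 r hr).trans (by omega)⟩
    · rw [h]
      exact ⟨ih.1.sublist (List.take_sublist _ _), fun r hr =>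
        (ih.2 r (List.mem_of_mem_take hr)).trans (by omega)⟩
    · rw [h]
      constructor
      · rw [List.nodup_append]
        refine ⟨ih.1, by simp, ?_⟩
        intro a ha b hb
        have := ih.2 a ha
        simp at hb; omega
      · intro r hr
        rw [List.mem_append] at hr
        rcases hr with hr | hr
        · exact (ih.2 r hr).trans (by omega)
        · simp at hr; omega

theorem notin_persist {X : ℕ → Bool} {t t' r : ℕ} (hr : r ≤ t) (h : r ∉ rl (st P H j X t))
    (ht : t ≤ t') : r ∉ rl (st P H j X t') := by
  induction t', ht using Nat.le_induction with
  | base => exact h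
  | succ t' ht ih =>
    rw [st_succ]
    rcases rl_step P H j t' (tbl P H j t') (pre X (t'+1)) (st P H j X t') with h | ⟨i, _, h⟩ | h
    · rw [h]; exact ih
    · rw [h]; exact fun h => ih (List.mem_of_mem_take h)
    · rw [h]
      simp only [List.mem_append, List.mem_singleton, not_or]
      exact ⟨ih, by omega⟩

theorem notin_take {l : List ℕ} (hn : l.Nodup) {i k r : ℕ} (h : l[k]? = some r) (hi : i ≤ k) :
    r ∉ l.take i := by
  intro hm
  obtain ⟨m, hm, hr⟩ := List.getElem_of_mem hm
  simp at hm hr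
  obtain ⟨hk, h⟩ := List.getElem?_eq_some_iff.1 h
  have := (hn.getElem_inj_iff (i := m) (j := k) (hi := by omega) (hj := hk)).1 (by rw [hr, h])
  omega

theorem recs_step (t : ℕ) (T : List (Str × State)) (α : Str) (s : State) :
    (∃ i, failAt t s.1 = some i ∧ (upd P H j t T α s).1 = s.1.take i ∧
      rl (upd P H j t T α s) = (rl s).take (i+1)) ∨
    (s.1 <+: (upd P H j t T α s).1 ∧ rl s <+: rl (upd P H j t T α s)) := by
  rcases upd_cases P H j t T α s with ⟨_, h⟩ | ⟨i, hi, h⟩ | ⟨z, τ, _, _, _, _, h⟩ | ⟨z, _, _, _, _, _, h⟩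
  · right; rw [h]; exact ⟨List.prefix_rfl, List.prefix_rfl⟩
  · left
    refine ⟨i, hi, by rw [h], ?_⟩
    rcases rl_step P H j t T α s with h' | ⟨i', hi', h'⟩ | h'
    · have := congrArg List.length h'
      have hl := (failAt_some hi).1
      rw [rl_length, rl_length, h] at this
      simp at this; omega
    · rw [hi] at hi'; simp at hi'; rw [hi']; exact h'
    · have := congrArg List.length h'
      have hl := (failAt_some hi).1
      rw [List.length_append, rl_length, rl_length, h] at this
      simp at this; omega
  · right; rw [h]; simp [rl]
  · right; rw [h]; simp [rl]

theorem prefix_getElem? {β : Type*} {l l' : List β} (h : l <+: l') {i : ℕ} {x : β} (hx : l[i]? = some x) :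
    l'[i]? = some x := by
  obtain ⟨hi, hx⟩ := List.getElem?_eq_some_iff.1 hx
  rw [List.getElem?_eq_getElem (hi.trans_le h.length_le), ← hx, h.getElem hi]

theorem base_persist {X : ℕ → Bool} {t t' r : ℕ} {L} (h1 : L <+: (st P H j X t).1)
    (h2 : (rl (st P H j X t))[L.length]? = some r) (ht : t ≤ t') :
    (L <+: (st P H j X t').1 ∧ (rl (st P H j X t'))[L.length]? = some r) ∨ r ∉ rl (st P H j X t') := by
  have hr : r ≤ t := (wf P H j X t).2 r (List.mem_of_getElem? h2)
  induction t', ht using Nat.le_induction with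
  | base => exact .inl ⟨h1, h2⟩
  | succ t' ht ih =>
    rcases ih with ⟨i1, i2⟩ | ih
    · rw [st_succ]
      rcases recs_step P H j t' (tbl P H j t') (pre X (t'+1)) (st P H j X t') with ⟨i, hi, h, h'⟩ | ⟨h, h'⟩
      · by_cases hl : L.length ≤ i
        · left
          rw [h, h']
          refine ⟨?_, by rw [List.getElem?_take_of_lt (by omega)]; exact i2⟩
          rw [List.prefix_iff_eq_take] at i1 ⊢
          rw [List.take_take, min_eq_left hl]; exact i1
        · right
          rw [h']
          exact notin_take (wf P H j X t').1 i2 (by omega)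
      · left
        exact ⟨i1.trans h, prefix_getElem? h' i2⟩
    · right; exact notin_persist P H j (by omega) ih (Nat.le_succ _)

theorem entry_persist {X : ℕ → Bool} {t t' r : ℕ} {L o} (h1 : (L ++ [(r, o)]) <+: (st P H j X t).1)
    (ht : t ≤ t') :
    ((L ++ [(r, o)]) <+: (st P H j X t').1) ∨ (∃ σ z, o = some (σ, z) ∧ inS t' L.length σ z = true) ∨
      r ∉ rl (st P H j X t') := by
  have g : ∀ s : State, (L ++ [(r, o)]) <+: s.1 → s.1[L.length]? = some (r, o) := fun s hs =>
    prefix_getElem? hs (by simp)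
  have hr : r ≤ t := (wf P H j X t).2 r (List.mem_of_getElem? (rl_rec (g _ h1)))
  induction t', ht using Nat.le_induction with
  | base => exact .inl h1
  | succ t' ht ih =>
    rcases ih with i1 | ⟨σ, z, h, h'⟩ | ih
    · rw [st_succ]
      rcases recs_step P H j t' (tbl P H j t') (pre X (t'+1)) (st P H j X t') with ⟨i, hi, h, h'⟩ | ⟨h, h'⟩
      · rcases lt_trichotomy i L.length with hl | hl | hl
        · right; right
          rw [h']
          exact notin_take (wf P H j X t').1 (rl_rec (g _ i1)) (by omega)
        · right; left
          obtain ⟨r', σ, z, e, e'⟩ := bad_iff.1 (failAt_some hi).2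
          rw [hl, g _ i1] at e
          simp at e
          rw [hl] at e'
          exact ⟨σ, z, e.2, inS_mono e' (Nat.le_succ _)⟩
        · left
          rw [h]
          rw [List.prefix_iff_eq_take] at i1 ⊢
          rw [List.take_take, min_eq_left (by simp; omega)]; exact i1
      · left
        exact i1.trans h
    · right; left; exact ⟨σ, z, h, inS_mono h' (Nat.le_succ _)⟩
    · right; right; exact notin_persist P H j (by omega) ih (Nat.le_succ _)

theorem same_root {s : State} (hn : (rl s).Nodup) {L r} (h1 : L <+: s.1)
    (h2 : (rl s)[L.length]? = some r) (h3 : s.2.1 = r) : s.1 = L := by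
  have h4 := rl_root s
  rw [h3] at h4
  obtain ⟨a, ha⟩ := List.getElem?_eq_some_iff.1 h2
  obtain ⟨b, hb⟩ := List.getElem?_eq_some_iff.1 h4
  have := (hn.getElem_inj_iff (hi := a) (hj := b)).1 (by rw [ha, hb])
  exact (h1.eq_of_length this).symm

theorem sg_step (t : ℕ) (T : List (Str × State)) (α : Str) (s : State) :
    s.2.2 <+: (upd P H j t T α s).2.2 := by
  rcases upd_cases P H j t T α s with ⟨_, h⟩ | ⟨i, hi, h⟩ | ⟨z, τ, _, _, _, hw, h⟩ | ⟨z, _, _, _, _, _, h⟩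
  · rw [h]
  · rw [h]
  · rw [h]
    exact ((List.prefix_append _ _).trans (wit_spec hw).1).trans (List.prefix_append _ _)
  · rw [h]; simp

theorem sg_mono (X : ℕ → Bool) {t t' : ℕ} (ht : t ≤ t') :
    (st P H j X t).2.2 <+: (st P H j X t').2.2 := by
  induction t', ht using Nat.le_induction with
  | base => exact List.prefix_rfl
  | succ t' ht ih => rw [st_succ]; exact ih.trans (sg_step P H j _ _ _ _)
end
end TypicalDegree

namespace TypicalDegree
open Encodable MeasureTheory

noncomputable def coin : Measure Bool := (PMF.uniformOfFintype Bool).toMeasure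
instance : IsProbabilityMeasure coin := by unfold coin; infer_instance
noncomputable def mu : Measure (ℕ → Bool) := Measure.infinitePi fun _ => coin
instance : IsProbabilityMeasure mu := by unfold mu; infer_instance

theorem coin_single (b : Bool) : coin {b} = 2⁻¹ := by
  unfold coin
  rw [PMF.toMeasure_apply_singleton _ _ (MeasurableSet.singleton b)]
  simp

theorem sub_set (a : Str) : {R : ℕ → Bool | Sub a R} =
    Set.pi (Finset.range a.length : Set ℕ) (fun i => {a.getD i false}) := by
  ext R
  simp only [Set.mem_ofPred_eq, sub_iff, Set.mem_pi, Finset.coe_range, Set.mem_Iio, Set.mem_singleton_iff]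
  constructor
  · intro h i hi; rw [← h i hi]; simp [hi]
  · intro h i hi; rw [h i hi]; simp [hi]

theorem mu_sub (a : Str) : mu {R | Sub a R} = 2⁻¹ ^ a.length := by
  rw [sub_set, mu, Measure.infinitePi_pi]
  · simp [coin_single]
  · intro i _; exact MeasurableSet.singleton _

theorem measurableSet_sub (a : Str) : MeasurableSet {R : ℕ → Bool | Sub a R} := by
  rw [sub_set]
  exact MeasurableSet.pi (Set.to_countable _) fun i _ => MeasurableSet.singleton _

/-- clopen set given by a Boolean function on strings of length t -/
def ms (t : ℕ) (f : Str → Bool) : Set (ℕ → Bool) := {R | f (pre R t) = true}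

theorem ms_eq (t : ℕ) (f : Str → Bool) :
    ms t f = ⋃ a ∈ ((allStr t).filter f).toFinset, {R | Sub a R} := by
  ext R
  simp only [ms, Set.mem_ofPred_eq, Set.mem_iUnion, List.mem_toFinset, List.mem_filter, mem_allStr]
  constructor
  · intro h; exact ⟨pre R t, ⟨by simp, h⟩, sub_pre R t⟩
  · rintro ⟨a, ⟨h1, h2⟩, h3⟩
    have : pre R t = a := by rw [← h1]; exact h3
    rw [this]; exact h2

theorem measurableSet_ms (t : ℕ) (f : Str → Bool) : MeasurableSet (ms t f) := by
  rw [ms_eq]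
  exact Finset.measurableSet_biUnion _ fun a _ => measurableSet_sub a

theorem mu_ms (t : ℕ) (f : Str → Bool) : mu.real (ms t f) = cnt t f / 2 ^ t := by
  rw [ms_eq, measureReal_biUnion_finset]
  · have : ∀ a ∈ ((allStr t).filter f).toFinset, mu.real {R | Sub a R} = (2⁻¹ : ℝ) ^ t := by
      intro a ha
      simp only [List.mem_toFinset, List.mem_filter, mem_allStr] at ha
      rw [measureReal_def, mu_sub, ha.1]; simp
    rw [Finset.sum_congr rfl this, Finset.sum_const, List.toFinset_card_of_nodup ((nodup_allStr t).filter _)]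
    simp [cnt, div_eq_mul_inv]
  · intro a ha b hb hab
    simp only [Finset.mem_coe, List.mem_toFinset, List.mem_filter, mem_allStr] at ha hb
    rw [Function.onFun, Set.disjoint_left]
    intro R h1 h2
    apply hab
    have h1 : pre R _ = a := h1
    have h2 : pre R _ = b := h2
    rw [← h1, ← h2, ha.1, hb.1]
  · intro a _; exact measurableSet_sub a

theorem cnt_le (t : ℕ) (f : Str → Bool) : cnt t f ≤ 2 ^ t := by
  have h := mu_ms t f
  have h1 : mu.real (ms t f) ≤ 1 := measureReal_le_one
  rw [h, div_le_one (by positivity)] at h1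
  exact_mod_cast h1

theorem cnt_mono {t t' : ℕ} {f f' : Str → Bool} (hle : ms t f ⊆ ms t' f') :
    (cnt t f : ℝ) / 2 ^ t ≤ cnt t' f' / 2 ^ t' := by
  rw [← mu_ms, ← mu_ms]
  exact measureReal_mono hle

section
variable (P H : Nat.Partrec.Code) (j : ℕ)

/-- set for the weight -/
theorem mem_wset {t : ℕ} {z : Str} {R : ℕ → Bool} :
    R ∈ ms t (fun ρ => (strs t).any fun a => out t P ρ a && out t H a z) ↔
    ∃ a : Str, a.length ≤ t ∧ out t P (pre R t) a = true ∧ out t H a z = true := by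
  simp [ms, mem_strs]

theorem wset_mono {t t' : ℕ} {z z' : Str} (ht : t ≤ t') (hz : z' <+: z) :
    ms t (fun ρ => (strs t).any fun a => out t P ρ a && out t H a z) ⊆ 
    ms t' (fun ρ => (strs t').any fun a => out t' P ρ a && out t' H a z') := by
  intro R hR
  rw [mem_wset] at *
  obtain ⟨a, h1, h2, h3⟩ := hR
  exact ⟨a, h1.trans ht, out_mono h2 ht (pre_initOf R ht) List.prefix_rfl, out_mono h3 ht List.prefix_rfl hz⟩

theorem wt_mono {t t' : ℕ} {z z' : Str} (ht : t ≤ t') (hz : z' <+: z) :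
    (wt P H t z : ℝ) / 2 ^ t ≤ wt P H t' z' / 2 ^ t' := cnt_mono (wset_mono P H ht hz)

/-- the lightness threshold -/
noncomputable def dl (s : State) : ℝ := (2⁻¹ : ℝ) ^ (2 * (j + s.2.1 + 2) + 20 + encode s)

theorem light_iff {t : ℕ} {s : State} {z : Str} :
    light P H j t s z = true ↔ (wt P H t z : ℝ) / 2 ^ t ≤ dl j s := by
  unfold light dl
  rw [decide_eq_true_iff, div_le_iff₀ (by positivity), inv_pow, inv_mul_eq_div, le_div_iff₀ (by positivity)]
  exact_mod_cast Iff.rfl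

theorem light_mono {t t' : ℕ} {s : State} {z z' : Str} (h : light P H j t' s z' = true) (ht : t ≤ t')
    (hz : z' <+: z) : light P H j t s z = true := by
  rw [light_iff] at *
  exact (wt_mono P H ht hz).trans h

theorem isKey_iff {t : ℕ} {s : State} {z : Str} : isKey P H j t s z = true ↔
    light P H j t s z = true ∧ ∀ z', z' <+: z → light P H j t s z' = true → z' = z := by
  unfold isKey
  simp only [Bool.and_eq_true, List.all_eq_true, List.mem_range, Bool.not_eq_true']
  apply and_congr_right
  intro hz
  constructor
  · intro h z' h1 h2
    by_contra hne
    have hlt : z'.length < z.length := lt_of_le_of_ne h1.length_le fun e => hne (h1.eq_of_length e)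
    have := h _ hlt
    rw [← List.prefix_iff_eq_take.1 h1, h2] at this
    simp at this
  · intro h m hm
    by_contra hl
    have := congrArg List.length (h _ (List.take_prefix m z) (by simpa using hl))
    simp at this; omega

theorem key_exists {t : ℕ} {s : State} {z : Str} (h : light P H j t s z = true) :
    ∃ z', z' <+: z ∧ isKey P H j t s z' = true := by
  classical
  have hex : ∃ m, light P H j t s (z.take m) = true := ⟨z.length, by simpa using h⟩
  refine ⟨z.take (Nat.find hex), List.take_prefix _ _, (isKey_iff P H j).2 ⟨Nat.find_spec hex, ?_⟩⟩
  intro z' h1 h2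
  have h3 := h1.trans (List.take_prefix _ _)
  rw [List.prefix_iff_eq_take.1 h3] at h2
  have h4 := Nat.find_min' hex h2
  refine h1.eq_of_length_le ?_
  rw [List.length_take]; omega

theorem key_unique {t : ℕ} {s : State} {z z' : Str} (h : isKey P H j t s z = true)
    (h' : isKey P H j t s z' = true) (hc : cpt z z' = true) : z = z' := by
  rw [isKey_iff] at h h'
  rcases cpt_iff.1 hc with hc | hc
  · exact h'.2 z hc h.1
  · exact (h.2 z' hc h'.1).symm
end
end TypicalDegree

namespace TypicalDegree
open Encodable MeasureTheory

section
variable (P H : Nat.Partrec.Code) (j : ℕ)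

def Vs (t : ℕ) (s : State) : Set (ℕ → Bool) := ms t (VV P t (tbl P H j t) s)
def Qs (t : ℕ) (s : State) : Set (ℕ → Bool) := ms t (Qm P H j t (tbl P H j t) s)
def QKs (t : ℕ) (s : State) (z : Str) : Set (ℕ → Bool) := ms t (QK P H j t (tbl P H j t) s z)
def Us (t : ℕ) (s : State) (z : Str) : Set (ℕ → Bool) :=
  ms t fun ρ => (strs t).any fun z' => decide (encode z' ≤ encode z) &&
    QK P H j t (tbl P H j t) s z' ρ
def Rs (t : ℕ) (s : State) : Set (ℕ → Bool) :=
  ms t fun ρ => (strs t).any fun z => rel P H j t (tbl P H j t) s z &&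
    QK P H j t (tbl P H j t) s z ρ

variable {P H j}
theorem mem_Vs {t : ℕ} {s : State} {R : ℕ → Bool} : R ∈ Vs P H j t s ↔
    ∃ a : Str, a.length ≤ t ∧ cst (tbl P H j t) a s = true ∧ out t P (pre R t) a = true := by
  simp [Vs, ms, VV, mem_strs]
theorem mem_QKs {t : ℕ} {s : State} {z : Str} {R : ℕ → Bool} : R ∈ QKs P H j t s z ↔
    isKey P H j t s z = true ∧ ∃ a : Str, a.length ≤ t ∧ cst (tbl P H j t) a s = true ∧
      out t P (pre R t) a = true ∧ out t H a z = true := by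
  simp [QKs, ms, QK, mem_strs, and_assoc]
theorem mem_Qs {t : ℕ} {s : State} {R : ℕ → Bool} : R ∈ Qs P H j t s ↔
    ∃ z : Str, z.length ≤ t ∧ R ∈ QKs P H j t s z := by
  simp [Qs, QKs, ms, Qm, mem_strs]
theorem mem_Us {t : ℕ} {s : State} {z : Str} {R : ℕ → Bool} : R ∈ Us P H j t s z ↔
    ∃ z' : Str, z'.length ≤ t ∧ encode z' ≤ encode z ∧ R ∈ QKs P H j t s z' := by
  simp [Us, QKs, ms, mem_strs]
theorem mem_Rs {t : ℕ} {s : State} {R : ℕ → Bool} : R ∈ Rs P H j t s ↔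
    ∃ z : Str, z.length ≤ t ∧ rel P H j t (tbl P H j t) s z = true ∧ R ∈ QKs P H j t s z := by
  simp [Rs, QKs, ms, mem_strs]
theorem rel_iff {t : ℕ} {s : State} {z : Str} : rel P H j t (tbl P H j t) s z = true ↔
    2 * mu.real (Us P H j t s z) ≤ mu.real (Qs P H j t s) := by
  unfold Us Qs rel
  rw [mu_ms, mu_ms, decide_eq_true_iff, ← mul_div_assoc, div_le_div_iff_of_pos_right (by positivity)]
  exact_mod_cast Iff.rfl
theorem Rs_sub_Qs (t : ℕ) (s : State) : Rs P H j t s ⊆ Qs P H j t s := by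
  intro R hR
  obtain ⟨z, h1, _, h2⟩ := mem_Rs.1 hR
  exact mem_Qs.2 ⟨z, h1, h2⟩
theorem QKs_sub_Vs (t : ℕ) (s : State) (z : Str) : QKs P H j t s z ⊆ Vs P H j t s := by
  intro R hR
  obtain ⟨_, a, h1, h2, h3, _⟩ := mem_QKs.1 hR
  exact mem_Vs.2 ⟨a, h1, h2, h3⟩
theorem Qs_sub_Vs (t : ℕ) (s : State) : Qs P H j t s ⊆ Vs P H j t s := by
  intro R hR
  obtain ⟨z, _, h2⟩ := mem_Qs.1 hR
  exact QKs_sub_Vs t s z h2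
theorem meas_Vs (t : ℕ) (s : State) : MeasurableSet (Vs P H j t s) := measurableSet_ms _ _
theorem meas_Qs (t : ℕ) (s : State) : MeasurableSet (Qs P H j t s) := measurableSet_ms _ _
theorem meas_Rs (t : ℕ) (s : State) : MeasurableSet (Rs P H j t s) := measurableSet_ms _ _
theorem mu_QKs (t : ℕ) (s : State) (z : Str) : mu.real (QKs P H j t s z) ≤ dl j s := by
  by_cases hk : isKey P H j t s z = true
  · have := (light_iff P H j).1 ((isKey_iff P H j).1 hk).1
    refine le_trans ?_ this
    unfold wt
    rw [← mu_ms]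
    refine measureReal_mono ?_
    intro R hR
    obtain ⟨_, a, h1, h2, h3, h4⟩ := mem_QKs.1 hR
    rw [mem_wset]
    exact ⟨a, h1, h3, h4⟩
  · have : QKs P H j t s z = ∅ := by
      ext R
      rw [mem_QKs]; simp [hk]
    rw [this]; simp; unfold dl; positivity

theorem mu_Rs_le (t : ℕ) (s : State) : 2 * mu.real (Rs P H j t s) ≤ mu.real (Qs P H j t s) := by
  classical
  let S := (strs t).toFinset.filter (fun z => rel P H j t (tbl P H j t) s z = true)
  by_cases hS : S.Nonempty
  · obtain ⟨z, hz, hmax⟩ := S.exists_max_image (fun z => encode z) hS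
    have hz' := (Finset.mem_filter.1 hz).2
    refine le_trans ?_ (rel_iff.1 hz')
    refine mul_le_mul_of_nonneg_left (measureReal_mono ?_) (by norm_num)
    intro R hR
    obtain ⟨z', h1, h2, h3⟩ := mem_Rs.1 hR
    exact mem_Us.2 ⟨z', h1, hmax z' (Finset.mem_filter.2 ⟨by simpa [mem_strs] using h1, h2⟩), h3⟩
  · have : Rs P H j t s = ∅ := by
      ext R
      simp only [Set.mem_empty_iff_false, iff_false]
      intro hR
      obtain ⟨z', h1, h2, h3⟩ := mem_Rs.1 hR
      exact hS ⟨z', Finset.mem_filter.2 ⟨by simpa [mem_strs] using h1, h2⟩⟩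
    rw [this]; simp

theorem mu_Rs_ge (t : ℕ) (s : State) :
    mu.real (Qs P H j t s) / 2 - dl j s ≤ mu.real (Rs P H j t s) := by
  classical
  let S := (strs t).toFinset.filter (fun z => ¬ rel P H j t (tbl P H j t) s z = true)
  by_cases hS : S.Nonempty
  · obtain ⟨z, hz, hmin⟩ := S.exists_min_image (fun z => encode z) hS
    have hz' := (Finset.mem_filter.1 hz).2
    rw [rel_iff, not_le] at hz'
    have h1 : Us P H j t s z ⊆ Rs P H j t s ∪ QKs P H j t s z := by
      intro R hR
      obtain ⟨z', h1, h2, h3⟩ := mem_Us.1 hR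
      by_cases he : z' = z
      · right; rw [← he]; exact h3
      · left
        refine mem_Rs.2 ⟨z', h1, ?_, h3⟩
        by_contra hr
        have := hmin z' (Finset.mem_filter.2 ⟨by simpa [mem_strs] using h1, hr⟩)
        exact he (encode_injective (le_antisymm h2 this))
    have h2 := (measureReal_mono (μ := mu) h1).trans (measureReal_union_le _ _)
    have h3 := mu_QKs (P := P) (H := H) (j := j) t s z
    linarith
  · have : Qs P H j t s ⊆ Rs P H j t s := by
      intro R hR
      obtain ⟨z', h1, h3⟩ := mem_Qs.1 hR
      refine mem_Rs.2 ⟨z', h1, ?_, h3⟩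
      by_contra hr
      exact hS ⟨z', Finset.mem_filter.2 ⟨by simpa [mem_strs] using h1, hr⟩⟩
    have h2 := measureReal_mono (μ := mu) this
    have h3 : 0 ≤ dl j s := by unfold dl; positivity
    have h4 : 0 ≤ mu.real (Qs P H j t s) := measureReal_nonneg
    linarith

theorem cst_succ {t : ℕ} {s : State} {a : Str} (ha : a.length ≤ t)
    (h : cst (tbl P H j t) a s = true)
    (hk : ∀ X, Sub a X → upd P H j t (tbl P H j t) (pre X (t+1)) s = s) :
    cst (tbl P H j (t+1)) a s = true := by
  rw [cst_iff P H j (by omega)]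
  rw [cst_iff P H j ha] at h
  intro X hX
  rw [st_succ, h X hX, hk X hX]

theorem Vs_step1 {t : ℕ} {s : State} (hq : quiet t s = true)
    (h : (ovf P H j t (tbl P H j t) s.2.1 && active P H j t (tbl P H j t) s) = false) :
    Vs P H j t s ⊆ Vs P H j (t+1) s := by
  intro R hR
  obtain ⟨a, h1, h2, h3⟩ := mem_Vs.1 hR
  refine mem_Vs.2 ⟨a, by omega, cst_succ h1 h2 ?_, out_mono h3 (Nat.le_succ t)
    (pre_initOf R (Nat.le_succ t)) List.prefix_rfl⟩
  intro X _
  exact upd_keep1 P H j hq (.inl h)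

theorem relz_spec {t : ℕ} {s : State} {α z : Str} (h : relz P H j t (tbl P H j t) s α = some z) :
    isKey P H j t s z = true ∧ out t H α z = true ∧ rel P H j t (tbl P H j t) s z = true := by
  have := List.mem_of_mem_head? h
  simp only [List.mem_filter, Bool.and_eq_true] at this
  exact ⟨this.2.1.1, this.2.1.2, this.2.2⟩

variable {cH : OracleCode} (hH : Rep cH H)
include hH
theorem Vs_step2 {t : ℕ} {s : State} (hq : quiet t s = true) :
    Qs P H j t s \ Rs P H j t s ⊆ Vs P H j (t+1) s := by
  rintro R ⟨hR, hR'⟩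
  obtain ⟨z, hz, hRz⟩ := mem_Qs.1 hR
  obtain ⟨hk, a, h1, h2, h3, h4⟩ := mem_QKs.1 hRz
  refine mem_Vs.2 ⟨a, by omega, cst_succ h1 h2 ?_, out_mono h3 (Nat.le_succ t)
    (pre_initOf R (Nat.le_succ t)) List.prefix_rfl⟩
  intro X hX
  refine upd_keep1 P H j hq (.inr ?_)
  cases hr : relz P H j t (tbl P H j t) s (pre X (t+1)) with
  | none => rfl
  | some z' =>
    exfalso
    obtain ⟨e1, e2, e3⟩ := relz_spec hr
    have : z' = z := key_unique P H j e1 hk (out_cpt hH e2 h4 (.inr (hX.initOf (by omega))))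
    subst this
    exact hR' (mem_Rs.2 ⟨z', hz, e3, hRz⟩)

theorem Vs_step {t : ℕ} {s : State} (hq : quiet t s = true) :
    mu.real (Vs P H j t s) ≤
      (if ovf P H j t (tbl P H j t) s.2.1 = true then 2 ^ (j + s.2.1 + 5) else 1) *
        mu.real (Vs P H j (t+1) s) := by
  by_cases ho : (ovf P H j t (tbl P H j t) s.2.1 && active P H j t (tbl P H j t) s) = true
  · rw [Bool.and_eq_true] at ho
    rw [if_pos ho.1]
    have ha := ho.2
    unfold active at ha
    rw [Bool.and_eq_true, decide_eq_true_iff] at ha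
    have h1 : mu.real (Vs P H j t s) ≤ mu.real (Qs P H j t s) * 2 ^ (j + s.2.1 + 4) := by
      unfold Vs Qs
      rw [mu_ms, mu_ms, div_mul_eq_mul_div, div_le_div_iff_of_pos_right (by positivity)]
      exact_mod_cast ha.2
    have h2 := measureReal_mono (μ := mu) (Vs_step2 (P := P) (j := j) hH hq)
    have h3 : mu.real (Qs P H j t s) = mu.real (Rs P H j t s) + mu.real (Qs P H j t s \ Rs P H j t s) := by
      rw [measureReal_sdiff (Rs_sub_Qs t s) (meas_Rs t s)]; ring
    have h4 := mu_Rs_le (P := P) (H := H) (j := j) t s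
    have h5 : mu.real (Qs P H j t s) ≤ 2 * mu.real (Vs P H j (t+1) s) := by linarith
    calc _ ≤ _ := h1
      _ ≤ (2 * mu.real (Vs P H j (t+1) s)) * 2 ^ (j + s.2.1 + 4) := by gcongr
      _ = _ := by ring
  · have h := measureReal_mono (μ := mu) (Vs_step1 (P := P) (H := H) (j := j) hq (by simpa using ho))
    refine h.trans ?_
    have h0 : 0 ≤ mu.real (Vs P H j (t+1) s) := measureReal_nonneg
    split
    · refine le_mul_of_one_le_left h0 (one_le_pow₀ (by norm_num))
    · simp

theorem Vs_steps {t t' : ℕ} {s : State} (ht : t ≤ t') (hq : ∀ u, t ≤ u → u < t' → quiet u s = true) :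
    mu.real (Vs P H j t s) ≤ (2 ^ (j + s.2.1 + 5)) ^
      (Nat.count (fun u => ovf P H j u (tbl P H j u) s.2.1 = true) t' -
       Nat.count (fun u => ovf P H j u (tbl P H j u) s.2.1 = true) t) * mu.real (Vs P H j t' s) := by
  induction t', ht using Nat.le_induction with
  | base => simp
  | succ t' ht ih =>
    have h1 := ih fun u h1 h2 => hq u h1 (by omega)
    have h2 := Vs_step (P := P) (j := j) hH (hq t' ht (by omega))
    have h3 := Nat.count_monotone (fun u => ovf P H j u (tbl P H j u) s.2.1 = true) ht
    refine h1.trans ((mul_le_mul_of_nonneg_left h2 (by positivity)).trans (le_of_eq ?_))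
    rw [Nat.count_succ]
    split
    · rw [Nat.sub_add_comm h3]
      rw [pow_succ]; ring
    · simp
omit hH

variable {cP : OracleCode} (hP : Rep cP P)
include hP
theorem Vs_state {t : ℕ} {s : State} {R : ℕ → Bool} (h : R ∈ Vs P H j t s) :
    st P H j (sOut cP R) t = s := by
  obtain ⟨a, h1, h2, h3⟩ := mem_Vs.1 h
  exact (cst_iff P H j h1).1 h2 _ (out_sound hP h3 (sub_pre R t))

include hH
theorem released {t : ℕ} {s : State} {z : Str} {R : ℕ → Bool} (hz : z.length ≤ t)
    (hr : rel P H j t (tbl P H j t) s z = true) (hR : R ∈ QKs P H j t s z)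
    (ho : ovf P H j t (tbl P H j t) s.2.1 = true) (ha : active P H j t (tbl P H j t) s = true) :
    (st P H j (sOut cP R) (t+1)).1 = s.1 ++ [(s.2.1, some (s.2.2, z))] := by
  have hs := Vs_state hP (QKs_sub_Vs t s z hR)
  obtain ⟨hk, a, h1, h2, h3, h4⟩ := mem_QKs.1 hR
  have hX := out_sound hP h3 (sub_pre R t)
  rw [st_succ, hs]
  have hq : quiet t s = true := by
    unfold active at ha; rw [Bool.and_eq_true] at ha; exact ha.1
  obtain ⟨q1, q2⟩ := quiet_iff.1 hq
  have hout := out_mono h4 le_rfl (hX.initOf (n := t+1) (by omega)) List.prefix_rfl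
  have hrz : relz P H j t (tbl P H j t) s (pre (sOut cP R) (t+1)) = some z := by
    cases hh : relz P H j t (tbl P H j t) s (pre (sOut cP R) (t+1)) with
    | none =>
      unfold relz at hh
      rw [List.head?_eq_none_iff, List.filter_eq_nil_iff] at hh
      have := hh z (mem_strs.2 hz)
      rw [hk, hout, hr] at this
      simp at this
    | some z' =>
      obtain ⟨e1, e2, e3⟩ := relz_spec hh
      rw [key_unique P H j e1 hk (out_cpt hH e2 hout (.inl List.prefix_rfl))]
  unfold upd
  simp [q1, q2, ho, ha, hrz]
end
end TypicalDegree

namespace TypicalDegree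
open Encodable MeasureTheory

section
variable {P H : Nat.Partrec.Code} {j : ℕ}

theorem root_contra {s : State} (hn : (rl s).Nodup) {L r o} (h1 : (L ++ [(r, o)]) <+: s.1)
    (h3 : s.2.1 = r) : False := by
  have h5 : s.1[L.length]? = some (r, o) := prefix_getElem? h1 (by simp)
  have h2 := same_root hn ((List.prefix_append _ _).trans h1) (rl_rec h5) h3
  rw [h2] at h5
  simp at h5

theorem pair_persist {X : ℕ → Bool} {t t' : ℕ} {s : State} (h : st P H j X t = s)
    (hp : pairEv t s.1.length s.2.2 = true) (ht : t ≤ t') :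
    st P H j X t' = s ∨ (s.1 ++ [(s.2.1, none)]) <+: (st P H j X t').1 ∨
      s.2.1 ∉ rl (st P H j X t') := by
  have hr : s.2.1 ≤ t := (wf P H j X t).2 _ (by rw [h]; exact List.mem_of_getElem? (rl_root s))
  induction t', ht using Nat.le_induction with
  | base => exact .inl h
  | succ t' ht ih =>
    rcases ih with ih | ih | ih
    · have hn := (wf P H j X t').1
      rw [ih] at hn
      rw [st_succ, ih]
      rcases upd_cases P H j t' (tbl P H j t') (pre X (t'+1)) s with ⟨_, h⟩ | ⟨i, hi, h⟩ | ⟨z, τ, _, _, _, _, h⟩ | ⟨z, _, hpe, _, _, _, h⟩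
      · exact .inl h
      · right; right
        have hi2 := (failAt_some hi).1
        rcases rl_step P H j t' (tbl P H j t') (pre X (t'+1)) s with g | ⟨i', hi', g⟩ | g
        · have := congrArg List.length g
          rw [rl_length, rl_length, h] at this
          simp at this; omega
        · rw [hi] at hi'; cases hi'
          rw [g]
          exact notin_take hn (rl_root s) (by omega)
        · have := congrArg List.length g
          rw [List.length_append, rl_length, rl_length, h] at this
          simp at this; omega
      · right; left; rw [h]
      · rw [pairEv_mono hp ht] at hpe; simp at hpe
    · rcases entry_persist P H j ih (Nat.le_succ t') with h | ⟨_, _, h, _⟩ | h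
      · exact .inr (.inl h)
      · cases h
      · exact .inr (.inr h)
    · exact .inr (.inr (notin_persist P H j (by omega) ih (Nat.le_succ t')))

variable {cP : OracleCode} (hP : Rep cP P)
include hP
theorem pair_disj {t t' : ℕ} {s s' : State} {R : ℕ → Bool} (h : R ∈ Vs P H j t s)
    (h' : R ∈ Vs P H j t' s') (hp : pairEv t s.1.length s.2.2 = true) (ht : t ≤ t')
    (hr : s.2.1 = s'.2.1) : s = s' := by
  have e' := Vs_state hP h'
  have hn := (wf P H j (sOut cP R) t').1
  rcases pair_persist (Vs_state hP h) hp ht with h1 | h1 | h1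
  · rw [← h1, e']
  · rw [e'] at h1 hn
    exact (root_contra hn h1 hr.symm).elim
  · rw [e', hr] at h1
    exact (h1 (List.mem_of_getElem? (rl_root s'))).elim

variable {cH : OracleCode} (hH : Rep cH H)
include hH
theorem double_rel {t t' : ℕ} {s s' : State} {z : Str} {R : ℕ → Bool} (hz : z.length ≤ t)
    (hr : rel P H j t (tbl P H j t) s z = true) (hR : R ∈ QKs P H j t s z)
    (ho : ovf P H j t (tbl P H j t) s.2.1 = true) (ha : active P H j t (tbl P H j t) s = true)
    (ht : t < t') (h' : R ∈ Vs P H j t' s') (hrr : s'.2.1 = s.2.1) (hf : failAt t' s'.1 = none) :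
    failAt t' s.1 = none ∧ inS t' s.1.length s.2.2 z = true := by
  have h1 := released hH hP hz hr hR ho ha
  have e := Vs_state hP (QKs_sub_Vs t s z hR)
  have e' := Vs_state hP h'
  have hn := (wf P H j (sOut cP R) t').1
  rw [e'] at hn
  have hmem : s.2.1 ∈ rl s' := by rw [← hrr]; exact List.mem_of_getElem? (rl_root s')
  constructor
  · have := base_persist P H j (X := sOut cP R) (t := t) (t' := t') (L := s.1) (r := s.2.1)
      (by rw [e]) (by rw [e]; exact rl_root s) ht.le
    rw [e'] at this
    rcases this with ⟨g1, g2⟩ | g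
    · rw [← same_root hn g1 g2 hrr]; exact hf
    · exact (g hmem).elim
  · have := entry_persist P H j (X := sOut cP R) (t := t+1) (t' := t') (L := s.1) (r := s.2.1)
      (by rw [h1]) ht
    rw [e'] at this
    rcases this with g | ⟨σ, z', g1, g2⟩ | g
    · exact (root_contra hn g hrr).elim
    · cases g1; exact g2
    · exact (g hmem).elim
omit hP hH

/-- sum of thresholds -/
theorem sum_dl (F : Finset State) (r : ℕ) (hF : ∀ s ∈ F, s.2.1 = r) :
    ∑ s ∈ F, dl j s ≤ 2 * 2⁻¹ ^ (2 * (j + r + 2) + 20) := by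
  have h1 : ∀ s ∈ F, dl j s = 2⁻¹ ^ (2 * (j + r + 2) + 20) * (2⁻¹ : ℝ) ^ encode s := by
    intro s hs; unfold dl; rw [hF s hs, pow_add]
  rw [Finset.sum_congr rfl h1, ← Finset.mul_sum, mul_comm]
  refine mul_le_mul_of_nonneg_right ?_ (by positivity)
  have h2 : ∑ s ∈ F, (2⁻¹ : ℝ) ^ encode s = ∑ n ∈ F.image (fun s => encode s), (2⁻¹ : ℝ) ^ n := by
    rw [Finset.sum_image]
    intro a _ b _ h; exact encode_injective h
  rw [h2]
  have := (summable_geometric_of_lt_one (r := (2⁻¹ : ℝ)) (by norm_num) (by norm_num)).sum_le_tsum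
    (F.image (fun s => encode s)) (fun _ _ => by positivity)
  rw [tsum_geometric_of_lt_one (by norm_num) (by norm_num)] at this
  norm_num at this ⊢; linarith

open scoped Classical in
variable (P H j) in
/-- active states of root r at time t -/
noncomputable def Act (t r : ℕ) : Finset State :=
  ((tbl P H j t).map Prod.snd).toFinset.filter fun s => s.2.1 = r ∧ active P H j t (tbl P H j t) s = true

variable (P H j) in
def RelS (t r : ℕ) : Set (ℕ → Bool) := ⋃ s ∈ Act P H j t r, Rs P H j t s

theorem mem_Act {t r : ℕ} {s : State} : s ∈ Act P H j t r → s.2.1 = r ∧ quiet t s = true ∧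
    active P H j t (tbl P H j t) s = true := by
  intro h
  have h := (Finset.mem_filter.1 h).2
  refine ⟨h.1, ?_, h.2⟩
  have := h.2
  unfold active at this
  rw [Bool.and_eq_true] at this
  exact this.1

theorem ovf_iff {t r : ℕ} : ovf P H j t (tbl P H j t) r = true ↔
    2⁻¹ ^ (j + r + 3) < mu.real (⋃ s ∈ Act P H j t r, Qs P H j t s) := by
  have : (⋃ s ∈ Act P H j t r, Qs P H j t s) = ms t (fun ρ => (tbl P H j t).any fun p =>
    decide (p.2.2.1 = r) && active P H j t (tbl P H j t) p.2 && Qm P H j t (tbl P H j t) p.2 ρ) := by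
    ext R
    simp only [Set.mem_iUnion, Act, Finset.mem_filter, List.mem_toFinset, List.mem_map, Qs, ms,
      Set.mem_ofPred_eq, List.any_eq_true, Bool.and_eq_true, decide_eq_true_iff]
    constructor
    · rintro ⟨s, ⟨⟨p, hp, rfl⟩, h1, h2⟩, h3⟩
      exact ⟨p, hp, ⟨h1, h2⟩, h3⟩
    · rintro ⟨p, hp, ⟨h1, h2⟩, h3⟩
      exact ⟨p.2, ⟨⟨p, hp, rfl⟩, h1, h2⟩, h3⟩
  rw [this, mu_ms, lt_div_iff₀ (by positivity), inv_pow, inv_mul_eq_div, div_lt_iff₀' (by positivity)]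
  unfold ovf
  rw [decide_eq_true_iff]
  exact_mod_cast Iff.rfl

include hP in
theorem Vs_disj {t : ℕ} {s s' : State} (h : s ≠ s') : Disjoint (Vs P H j t s) (Vs P H j t s') := by
  rw [Set.disjoint_left]
  intro R h1 h2
  exact h ((Vs_state hP h1).symm.trans (Vs_state hP h2))

theorem meas_RelS (t r : ℕ) : MeasurableSet (RelS P H j t r) :=
  Finset.measurableSet_biUnion _ fun s _ => meas_Rs t s

include hP in
theorem mu_RelS {t r : ℕ} (ho : ovf P H j t (tbl P H j t) r = true) :
    2⁻¹ ^ (j + r + 5) ≤ mu.real (RelS P H j t r) := by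
  have h1 : mu.real (RelS P H j t r) = ∑ s ∈ Act P H j t r, mu.real (Rs P H j t s) := by
    unfold RelS
    rw [measureReal_biUnion_finset]
    · intro s _ s' _ hne
      exact (Vs_disj hP hne).mono ((Rs_sub_Qs t s).trans (Qs_sub_Vs t s))
        ((Rs_sub_Qs t s').trans (Qs_sub_Vs t s'))
    · intro s _; exact meas_Rs t s
  have h2 := ovf_iff.1 ho
  have h3 : mu.real (⋃ s ∈ Act P H j t r, Qs P H j t s) ≤ ∑ s ∈ Act P H j t r, mu.real (Qs P H j t s) :=
    measureReal_biUnion_finset_le _ _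
  have h4 : ∑ s ∈ Act P H j t r, (mu.real (Qs P H j t s) / 2 - dl j s) ≤ mu.real (RelS P H j t r) := by
    rw [h1]; exact Finset.sum_le_sum fun s _ => mu_Rs_ge t s
  rw [Finset.sum_sub_distrib, ← Finset.sum_div] at h4
  have h5 := sum_dl (j := j) (Act P H j t r) r fun s hs => (mem_Act hs).1
  have h6 : (2:ℝ) * 2⁻¹ ^ (2 * (j + r + 2) + 20) ≤ 2⁻¹ ^ (j + r + 5) := by
    have : (2⁻¹:ℝ) ^ (2 * (j + r + 2) + 20) ≤ 2⁻¹ ^ (j + r + 6) :=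
      pow_le_pow_of_le_one (by norm_num) (by norm_num) (by omega)
    calc _ ≤ 2 * (2⁻¹:ℝ) ^ (j + r + 6) := by linarith
      _ = _ := by rw [pow_succ _ (j + r + 5)]; ring
  have h7 : (2⁻¹:ℝ) ^ (j + r + 3) = 4 * 2⁻¹ ^ (j + r + 5) := by
    rw [pow_add _ (j+r) 3, pow_add _ (j+r) 5]; ring
  have h8 := h2.trans_le h3
  linarith
end
end TypicalDegree

namespace TypicalDegree
open Encodable MeasureTheory

section
variable {P H : Nat.Partrec.Code} {j : ℕ}

/-- first time at which a pair is found -/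
noncomputable def tst (s : State) : ℕ := sInf {t | pairEv t s.1.length s.2.2 = true}
def good (r : ℕ) (s : State) : Prop := s.2.1 = r ∧ ∃ t, pairEv t s.1.length s.2.2 = true

theorem tst_spec {r : ℕ} {s : State} (h : good r s) : pairEv (tst s) s.1.length s.2.2 = true :=
  Nat.sInf_mem (s := {t | pairEv t s.1.length s.2.2 = true}) h.2
theorem tst_le {t : ℕ} {s : State} (h : pairEv t s.1.length s.2.2 = true) : tst s ≤ t :=
  Nat.sInf_le (s := {t | pairEv t s.1.length s.2.2 = true}) h

variable {cP : OracleCode} (hP : Rep cP P)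
include hP
open scoped Classical in
theorem good_sum (r : ℕ) (F : Finset State) :
    ∑ s ∈ F, (if good r s then mu.real (Vs P H j (tst s) s) else 0) ≤ 1 := by
  rw [← Finset.sum_filter, ← measureReal_biUnion_finset]
  · exact measureReal_le_one
  · intro s hs s' hs' hne
    have g := (Finset.mem_filter.1 (Finset.mem_coe.1 hs)).2
    have g' := (Finset.mem_filter.1 (Finset.mem_coe.1 hs')).2
    rw [Function.onFun, Set.disjoint_left]
    intro R h1 h2
    rcases le_total (tst s) (tst s') with h | h
    · exact hne (pair_disj hP h1 h2 (tst_spec g) h (g.1.trans g'.1.symm))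
    · exact hne (pair_disj hP h2 h1 (tst_spec g') h (g'.1.trans g.1.symm)).symm
  · intro s _; exact meas_Vs _ s

/-- abstract double counting -/
theorem double_count {K : ℕ} (S : ℕ → Set (ℕ → Bool)) (hS : ∀ i, MeasurableSet (S i)) {c : ℝ}
    (hc : ∀ i < K, c ≤ mu.real (S i)) :
    K * c - 1 ≤ ∑ i ∈ Finset.range K, mu.real {R | R ∈ S i ∧ ∃ i', i < i' ∧ i' < K ∧ R ∈ S i'} := by
  let D : ℕ → Set (ℕ → Bool) := fun i => {R | R ∈ S i ∧ ∃ i', i < i' ∧ i' < K ∧ R ∈ S i'}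
  have hD : ∀ i, MeasurableSet (D i) := by
    intro i
    have : D i = S i ∩ ⋃ i', ⋃ (_ : i < i' ∧ i' < K), S i' := by
      ext R; simp [D, and_assoc]
    rw [this]
    exact (hS i).inter (MeasurableSet.iUnion fun i' => MeasurableSet.iUnion fun _ => hS i')
  have hsub : ∀ i, D i ⊆ S i := fun i R h => h.1
  have h1 : ∑ i ∈ Finset.range K, mu.real (S i \ D i) ≤ 1 := by
    rw [← measureReal_biUnion_finset]
    · exact measureReal_le_one
    · intro i hi i' hi' hne
      rw [Function.onFun, Set.disjoint_left]
      rintro R ⟨h1, h2⟩ ⟨h3, h4⟩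
      simp at hi hi'
      rcases lt_or_gt_of_ne hne with h | h
      · exact h2 ⟨h1, i', h, hi', h3⟩
      · exact h4 ⟨h3, i, h, hi, h1⟩
    · intro i _; exact (hS i).diff (hD i)
  have h2 : ∀ i ∈ Finset.range K, c - mu.real (S i \ D i) ≤ mu.real (D i) := by
    intro i hi
    have := hc i (Finset.mem_range.1 hi)
    rw [measureReal_sdiff (hsub i) (hD i)]; linarith
  have h3 := Finset.sum_le_sum h2
  rw [Finset.sum_sub_distrib] at h3
  simp at h3
  show _ ≤ ∑ i ∈ Finset.range K, mu.real (D i)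
  linarith

variable {cH : OracleCode} (hH : Rep cH H)
include hH
open scoped Classical in
theorem block {r : ℕ} (hinf : {u | ovf P H j u (tbl P H j u) r = true}.Infinite) (N : ℕ) :
    ∃ F : Finset State, (∀ s ∈ F, good r s ∧ N < tst s) ∧
      1 / 2 ≤ (2 ^ (j + r + 6) * (2 ^ (j + r + 5)) ^ (2 ^ (j + r + 6)) : ℝ) *
        ∑ s ∈ F, mu.real (Vs P H j (tst s) s) := by
  set p : ℕ → Prop := fun u => ovf P H j u (tbl P H j u) r = true with hp
  have hinf : (Set.ofPred p).Infinite := hinf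
  set K : ℕ := 2 ^ (j + r + 6) with hK
  set tm : ℕ → ℕ := fun i => Nat.nth p (N + i) with htm
  have tm_p : ∀ i, ovf P H j (tm i) (tbl P H j (tm i)) r = true := fun i => Nat.nth_mem_of_infinite hinf _
  have tm_mono : StrictMono tm := fun a b h => Nat.nth_strictMono hinf (by omega)
  have tm_ge : ∀ i, N ≤ tm i := fun i =>
    le_trans (by omega) ((Nat.nth_strictMono hinf).le_apply (x := N + i))
  have tm_cnt : ∀ i, Nat.count p (tm i) = N + i := fun i => Nat.count_nth_of_infinite hinf _
  let F : Finset State := ((Finset.range K).biUnion fun i => Act P H j (tm i) r).filter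
    fun s => pairEv (tm K) s.1.length s.2.2 = true ∧ failAt (tst s) s.1 = none
  have hFg : ∀ s ∈ F, good r s := by
    intro s hs
    obtain ⟨h1, h2, _⟩ := Finset.mem_filter.1 hs
    obtain ⟨i, _, hi⟩ := Finset.mem_biUnion.1 h1
    exact ⟨(mem_Act hi).1, _, h2⟩
  have hlt : ∀ i s, s ∈ Act P H j (tm i) r → good r s → tm i < tst s := by
    intro i s h1 h2
    by_contra h
    have := pairEv_mono (tst_spec h2) (not_lt.1 h)
    rw [(quiet_iff.1 (mem_Act h1).2.1).2] at this
    simp at this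
  refine ⟨F, fun s hs => ⟨hFg s hs, ?_⟩, ?_⟩
  · obtain ⟨h1, h2, _⟩ := Finset.mem_filter.1 hs
    obtain ⟨i, _, hi⟩ := Finset.mem_biUnion.1 h1
    exact (tm_ge i).trans_lt (hlt i s hi (hFg s hs))
  have hdc := double_count (K := K) hP (fun i => RelS P H j (tm i) r) (fun i => meas_RelS _ r)
    (c := 2⁻¹ ^ (j + r + 5)) (fun i _ => mu_RelS hP (tm_p i))
  have hKc : (K : ℝ) * 2⁻¹ ^ (j + r + 5) = 2 := by
    rw [hK]; push_cast
    rw [pow_succ _ (j+r+5), mul_right_comm, ← mul_pow]; norm_num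
  rw [hKc] at hdc
  -- bound for each i
  have hb : ∀ i ∈ Finset.range K, mu.real {R | R ∈ RelS P H j (tm i) r ∧ ∃ i', i < i' ∧ i' < K ∧ R ∈ RelS P H j (tm i') r}
      ≤ (2 ^ (j + r + 5)) ^ K * ∑ s ∈ F, mu.real (Vs P H j (tst s) s) + 2 * 2⁻¹ ^ (2 * (j + r + 2) + 20) := by
    intro i hi
    have hi := Finset.mem_range.1 hi
    let Ds : State → Set (ℕ → Bool) := fun s => {R | R ∈ Rs P H j (tm i) s ∧ ∃ i', i < i' ∧ i' < K ∧ R ∈ RelS P H j (tm i') r}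
    have e1 : {R | R ∈ RelS P H j (tm i) r ∧ ∃ i', i < i' ∧ i' < K ∧ R ∈ RelS P H j (tm i') r} =
        ⋃ s ∈ Act P H j (tm i) r, Ds s := by
      ext R
      simp only [RelS, Set.mem_iUnion, Ds, Set.mem_ofPred_eq]
      constructor
      · rintro ⟨⟨s, h1, h2⟩, h3⟩; exact ⟨s, h1, h2, h3⟩
      · rintro ⟨s, h1, h2, h3⟩; exact ⟨⟨s, h1, h2⟩, h3⟩
    rw [e1]
    refine (measureReal_biUnion_finset_le _ _).trans ?_
    -- key facts about members
    have hmem : ∀ s ∈ Act P H j (tm i) r, ∀ R ∈ Ds s, ∃ z : Str, ∃ i', z.length ≤ tm i ∧ R ∈ QKs P H j (tm i) s z ∧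
        i' < K ∧ i < i' ∧ failAt (tm i') s.1 = none ∧ inS (tm i') s.1.length s.2.2 z = true := by
      rintro s hs R ⟨hR, i', hii, hiK, hR'⟩
      obtain ⟨z, hz, hrel, hq⟩ := mem_Rs.1 hR
      simp only [RelS, Set.mem_iUnion] at hR'
      obtain ⟨s', hs', hR'⟩ := hR'
      have a1 := mem_Act hs
      have a2 := mem_Act hs'
      obtain ⟨b1, b2⟩ := double_rel hP hH hz hrel hq (by rw [a1.1]; exact tm_p i) a1.2.2 (tm_mono hii)
        (Qs_sub_Vs _ _ (Rs_sub_Qs _ _ hR')) (a2.1.trans a1.1.symm) (quiet_iff.1 a2.2.1).1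
      exact ⟨z, i', hz, hq, hiK, hii, b1, b2⟩
    have hsm : ∀ s ∈ Act P H j (tm i) r, mu.real (Ds s) ≤
        (if s ∈ F then (2 ^ (j + r + 5)) ^ K * mu.real (Vs P H j (tst s) s) else 0) + dl j s := by
      intro s hs
      have hdl : 0 ≤ dl j s := by unfold dl; positivity
      have a1 := mem_Act hs
      split
      · rename_i hsF
        have hg := hFg s hsF
        obtain ⟨_, f1, f2⟩ := Finset.mem_filter.1 hsF
        have h1 : Ds s ⊆ Vs P H j (tm i) s := fun R hR => Qs_sub_Vs _ _ (Rs_sub_Qs _ _ hR.1)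
        have h2 := Vs_steps (P := P) (j := j) hH (hlt i s hs hg).le (s := s) (by
          intro u _ hu
          refine quiet_iff.2 ⟨failAt_anti f2 hu.le, ?_⟩
          by_contra hc
          have := tst_le (s := s) (t := u) (by simpa using hc)
          omega)
        rw [a1.1] at h2
        have h3 : Nat.count p (tst s) - Nat.count p (tm i) ≤ K := by
          have := Nat.count_monotone p (tst_le f1)
          rw [tm_cnt] at this ⊢
          omega
        have h4 : ((2 : ℝ) ^ (j + r + 5)) ^ (Nat.count p (tst s) - Nat.count p (tm i)) ≤ (2 ^ (j + r + 5)) ^ K :=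
          pow_le_pow_right₀ (one_le_pow₀ (by norm_num)) h3
        have h5 := measureReal_mono (μ := mu) h1
        have h6 := mul_le_mul_of_nonneg_right h4 (measureReal_nonneg (μ := mu) (s := Vs P H j (tst s) s))
        have h7 := h5.trans (h2.trans h6)
        linarith
      · rename_i hsF
        rw [zero_add]
        by_cases hne : (Ds s).Nonempty
        · obtain ⟨R0, hR0⟩ := hne
          obtain ⟨z0, i0, c1, c2, c3, c4, c5, c6⟩ := hmem s hs R0 hR0
          refine le_trans (measureReal_mono ?_) (mu_QKs (P := P) (H := H) (j := j) (tm i) s z0)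
          intro R hR
          obtain ⟨z, i1, d1, d2, d3, d4, d5, d6⟩ := hmem s hs R hR
          have : z = z0 := by
            refine key_unique P H j (mem_QKs.1 d2).1 (mem_QKs.1 c2).1 ?_
            by_contra hc
            apply hsF
            have m0 : i0 ≤ max i0 i1 := le_max_left _ _
            have m1 : i1 ≤ max i0 i1 := le_max_right _ _
            have mi : tm i ≤ tm (max i0 i1) := tm_mono.monotone (by omega)
            have mK : max i0 i1 ≤ K := by omega
            have hpe : pairEv (tm (max i0 i1)) s.1.length s.2.2 = true :=
              pairEv_iff.2 ⟨z, z0, by omega, by omega, inS_mono d6 (tm_mono.monotone m1),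
                inS_mono c6 (tm_mono.monotone m0), by simpa using hc⟩
            refine Finset.mem_filter.2 ⟨Finset.mem_biUnion.2 ⟨i, Finset.mem_range.2 hi, hs⟩,
              pairEv_mono hpe (tm_mono.monotone mK), failAt_anti (t' := tm (max i0 i1)) ?_ (tst_le hpe)⟩
            rcases max_choice i0 i1 with h | h <;> rw [h] <;> assumption
          rw [← this]; exact d2
        · rw [Set.not_nonempty_iff_eq_empty.1 hne]; simpa using hdl
    refine (Finset.sum_le_sum hsm).trans ?_
    rw [Finset.sum_add_distrib]
    refine add_le_add ?_ (sum_dl _ r fun s hs => (mem_Act hs).1)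
    rw [← Finset.sum_filter, Finset.mul_sum]
    refine Finset.sum_le_sum_of_subset_of_nonneg ?_ ?_
    · intro s hs; exact (Finset.mem_filter.1 hs).2
    · intro s _ _; exact mul_nonneg (by positivity) measureReal_nonneg
  have h1 := hdc.trans (Finset.sum_le_sum hb)
  simp only [Finset.sum_const, Finset.card_range, nsmul_eq_mul] at h1
  have h2 : (K : ℝ) * (2 * 2⁻¹ ^ (2 * (j + r + 2) + 20)) ≤ 1 / 2 := by
    have : (2⁻¹ : ℝ) ^ (2 * (j + r + 2) + 20) ≤ 2⁻¹ ^ (j + r + 8) :=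
      pow_le_pow_of_le_one (by norm_num) (by norm_num) (by omega)
    have h3 : (K : ℝ) * 2⁻¹ ^ (j + r + 8) = 1 / 4 := by
      have : (2⁻¹ : ℝ) ^ (j + r + 8) = 2⁻¹ ^ (j + r + 5) * (1 / 8) := by
        rw [pow_add _ (j+r) 8, pow_add _ (j+r) 5]; ring
      rw [this, ← mul_assoc, hKc]; norm_num
    have h4 := mul_le_mul_of_nonneg_left this (Nat.cast_nonneg (α := ℝ) K)
    linarith
  have h3 : (K : ℝ) = 2 ^ (j + r + 6) := by rw [hK]; push_cast; rfl
  rw [← h3]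
  rw [mul_add] at h1
  rw [mul_assoc]
  linarith

open scoped Classical in
theorem ovf_finite (r : ℕ) : ∃ N, ∀ t, N ≤ t → ovf P H j t (tbl P H j t) r = false := by
  by_contra hcon
  push Not at hcon
  have hinf : {u | ovf P H j u (tbl P H j u) r = true}.Infinite := by
    rw [Set.infinite_iff_exists_gt]
    intro a
    obtain ⟨t, h1, h2⟩ := hcon (a+1)
    exact ⟨t, by simpa using h2, by omega⟩
  have hsum : Summable fun s : State => if good r s then mu.real (Vs P H j (tst s) s) else 0 :=
    summable_of_sum_le (fun s => by split <;> [exact measureReal_nonneg; exact le_rfl]) (good_sum hP r)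
  have hC : (0:ℝ) < 2 ^ (j + r + 6) * (2 ^ (j + r + 5)) ^ (2 ^ (j + r + 6)) := by positivity
  set C : ℝ := 2 ^ (j + r + 6) * (2 ^ (j + r + 5)) ^ (2 ^ (j + r + 6)) with hCd
  obtain ⟨S0, hS0⟩ := summable_iff_vanishing_norm.1 hsum (1 / (4 * C)) (by positivity)
  obtain ⟨F, hF1, hF2⟩ := block hP hH hinf (S0.sup tst)
  have hd : Disjoint F S0 := by
    rw [Finset.disjoint_left]
    intro s h1 h2
    have := Finset.le_sup (f := tst) h2
    have := (hF1 s h1).2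
    omega
  have h1 := hS0 F hd
  rw [Finset.sum_congr rfl fun s hs => if_pos (hF1 s hs).1] at h1
  have h2 := (le_abs_self _).trans_lt h1
  have h3 := mul_lt_mul_of_pos_left h2 hC
  rw [← hCd] at hF2
  have h4 : C * (1 / (4 * C)) = 1 / 4 := by field_simp
  rw [h4] at h3
  linarith
end
end TypicalDegree

namespace TypicalDegree
open Encodable MeasureTheory

section
variable (P H : Nat.Partrec.Code)

def tstat (j : ℕ) (ρ : Str) (s : State) (z : Str) : Bool :=
  decide (z.length ≤ ρ.length) && (strs ρ.length).any fun a =>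
    cst (tbl P H j ρ.length) a s && out ρ.length P ρ a && out ρ.length H a z
def tbadE (j T : ℕ) (s : State) (z : Str) (t : ℕ) : Bool :=
  decide (T ≤ t) && (ovf P H j t (tbl P H j t) s.2.1 || !quiet t s ||
    !light P H j t s z)
section
variable {γ : Type*} [Primcodable γ] {j t T : γ → ℕ} {ρ z : γ → Str} {s : γ → State}
@[fun_prop] theorem pr_tbadE (hj : Primrec j) (hT : Primrec T) (hs : Primrec s) (hz : Primrec z)
    (ht : Primrec t) : Primrec fun x => tbadE P H (j x) (T x) (s x) (z x) (t x) := by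
  unfold tbadE; fun_prop
@[fun_prop] theorem pr_tstat (hj : Primrec j) (hr : Primrec ρ) (hs : Primrec s) (hz : Primrec z) :
    Primrec fun x => tstat P H (j x) (ρ x) (s x) (z x) := by
  unfold tstat; fun_prop
end
def tbadD (w : ℕ × ℕ × State × Str) (t : ℕ) : Bool := tbadE P H w.1 w.2.1 w.2.2.1 w.2.2.2 t
theorem pr_tbadD : Primrec fun p : (ℕ × ℕ × State × Str) × ℕ => tbadD P H p.1 p.2 := by
  unfold tbadD
  have h1 : Primrec fun p : (ℕ × ℕ × State × Str) × ℕ => p.1.1 := Primrec.fst.comp Primrec.fst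
  have h2 : Primrec fun p : (ℕ × ℕ × State × Str) × ℕ => p.1.2 := Primrec.snd.comp Primrec.fst
  have h3 : Primrec fun p : (ℕ × ℕ × State × Str) × ℕ => p.1.2.1 := Primrec.fst.comp h2
  have h4 : Primrec fun p : (ℕ × ℕ × State × Str) × ℕ => p.1.2.2 := Primrec.snd.comp h2
  exact pr_tbadE P H h1 h3 (Primrec.fst.comp h4) (Primrec.snd.comp h4) Primrec.snd
def VT (j : ℕ) : Set Str := {ρ | ∃ s z, tstat P H j ρ s z = true ∧
  ∀ t, tbadD P H (j, ρ.length, s, z) t = false}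

theorem VT_ce : UniformCEIn zeroJump (VT P H) := by
  obtain ⟨h, hh, hz⟩ := jump_tool (tbadD P H) (pr_tbadD P H)
  obtain ⟨c, hc⟩ := ce_search zeroJump (fun β n => (decode n.unpair.2 : Option Str).elim false fun ρ =>
    (List.range β.length).any fun i => (decode i : Option (State × Str)).elim false fun q =>
      tstat P H n.unpair.1 ρ q.1 q.2 && decide (β[h (n.unpair.1, ρ.length, q.1, q.2)]? = some false))
    (by fun_prop)
  refine ⟨c, fun i σ => ?_⟩
  rw [hc]
  simp only [Nat.unpair_pair, encodek, Option.elim_some, List.any_eq_true, List.mem_range, pre_length]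
  have hz' : ∀ w, (∀ t, tbadD P H w t = false) ↔ zeroJump (h w) = false := by
    intro w
    rw [← Bool.not_eq_true (zeroJump (h w)), hz]; simp
  constructor
  · rintro ⟨s, z, h1, h2⟩
    rw [hz'] at h2
    refine ⟨max (encode (s, z)) (h (i, σ.length, s, z)) + 1, encode (s, z), by omega, ?_⟩
    rw [encodek, Option.elim_some, h1, pre_getElem? _ _ _ (by show h (i, σ.length, s, z) < _; omega), h2]; simp
  · rintro ⟨k, x, hx, hd⟩
    cases hdd : (decode x : Option (State × Str)) with
    | none => rw [hdd] at hd; simp at hd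
    | some q =>
      rw [hdd, Option.elim_some, Bool.and_eq_true, decide_eq_true_iff] at hd
      refine ⟨q.1, q.2, hd.1, (hz' _).2 ?_⟩
      have h1 := hd.2
      obtain ⟨hl, h1⟩ := List.getElem?_eq_some_iff.1 h1
      rw [pre_getElem] at h1
      exact h1

open scoped Classical in
/-- all states at time t -/
noncomputable def Sts (j t : ℕ) : Finset State := ((tbl P H j t).map Prod.snd).toFinset

variable {P H}
theorem st_mem_Sts (j t : ℕ) (X : ℕ → Bool) : st P H j X t ∈ Sts P H j t := by
  classical
  unfold Sts
  rw [List.mem_toFinset, List.mem_map]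
  exact ⟨_, (mem_tbl P H j).2 ⟨X, rfl⟩, rfl⟩
theorem mem_Sts {j t : ℕ} {s : State} (h : s ∈ Sts P H j t) : ∃ X, st P H j X t = s := by
  classical
  unfold Sts at h
  rw [List.mem_toFinset, List.mem_map] at h
  obtain ⟨p, hp, rfl⟩ := h
  obtain ⟨X, rfl⟩ := (mem_tbl P H j).1 hp
  exact ⟨X, rfl⟩

variable {cP : OracleCode} (hP : Rep cP P) {j : ℕ}
include hP
open scoped Classical in
theorem root_bound {n r : ℕ} (ho : ovf P H j n (tbl P H j n) r = false) :
    mu.real (⋃ s ∈ (Sts P H j n).filter (fun s => s.2.1 = r ∧ quiet n s = true), Qs P H j n s) ≤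
      2⁻¹ ^ (j + r + 2) := by
  let N := (Sts P H j n).filter (fun s => s.2.1 = r ∧ quiet n s = true ∧ active P H j n (tbl P H j n) s = false)
  have h1 : (⋃ s ∈ (Sts P H j n).filter (fun s => s.2.1 = r ∧ quiet n s = true), Qs P H j n s) ⊆
      (⋃ s ∈ Act P H j n r, Qs P H j n s) ∪ ⋃ s ∈ N, Qs P H j n s := by
    intro R hR
    simp only [Set.mem_iUnion, Set.mem_union] at hR ⊢
    obtain ⟨s, hs, hR⟩ := hR
    obtain ⟨hs1, hs2, hs3⟩ := Finset.mem_filter.1 hs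
    by_cases ha : active P H j n (tbl P H j n) s = true
    · exact .inl ⟨s, Finset.mem_filter.2 ⟨hs1, hs2, ha⟩, hR⟩
    · exact .inr ⟨s, Finset.mem_filter.2 ⟨hs1, hs2, hs3, by simpa using ha⟩, hR⟩
  have h2 : mu.real (⋃ s ∈ Act P H j n r, Qs P H j n s) ≤ 2⁻¹ ^ (j + r + 3) := by
    by_contra hc
    have := ovf_iff.2 (not_le.1 hc)
    rw [ho] at this; simp at this
  have h3 : ∀ s ∈ N, mu.real (Qs P H j n s) ≤ mu.real (Vs P H j n s) * 2⁻¹ ^ (j + r + 4) := by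
    intro s hs
    obtain ⟨_, hs2, hs3, hs4⟩ := Finset.mem_filter.1 hs
    unfold active at hs4
    rw [hs3, Bool.true_and, decide_eq_false_iff_not, not_le, hs2] at hs4
    unfold Vs Qs
    rw [mu_ms, mu_ms, inv_pow, ← div_eq_mul_inv, le_div_iff₀ (by positivity), div_mul_eq_mul_div,
      div_le_div_iff_of_pos_right (by positivity)]
    exact_mod_cast hs4.le
  have h4 : mu.real (⋃ s ∈ N, Qs P H j n s) ≤ 2⁻¹ ^ (j + r + 4) := by
    refine (measureReal_biUnion_finset_le _ _).trans ((Finset.sum_le_sum h3).trans ?_)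
    rw [← Finset.sum_mul, ← measureReal_biUnion_finset]
    · exact mul_le_of_le_one_left (by positivity) measureReal_le_one
    · intro s _ s' _ hne; exact Vs_disj hP hne
    · intro s _; exact meas_Vs n s
  have h5 := (measureReal_mono (μ := mu) h1).trans (measureReal_union_le _ _)
  have h6 : (2⁻¹:ℝ) ^ (j + r + 3) = 2⁻¹ ^ (j+r+2) / 2 := by rw [pow_succ _ (j+r+2)]; ring
  have h7 : (2⁻¹:ℝ) ^ (j + r + 4) = 2⁻¹ ^ (j+r+2) / 4 := by rw [pow_succ _ (j+r+3), h6]; ring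
  have h8 : (0:ℝ) < 2⁻¹ ^ (j+r+2) := by positivity
  linarith

omit hP in
theorem VT_mem {ρ : Str} (h : ρ ∈ VT P H j) {n : ℕ} {R : ℕ → Bool} (hR : ρ <+: pre R n) :
    ∃ s ∈ Sts P H j n, quiet n s = true ∧ ovf P H j n (tbl P H j n) s.2.1 = false ∧ R ∈ Qs P H j n s := by
  obtain ⟨s, z, h1, h2⟩ := h
  unfold tstat at h1
  simp only [Bool.and_eq_true, decide_eq_true_iff, List.any_eq_true, mem_strs] at h1
  obtain ⟨hz, a, ha, ⟨h3, h4⟩, h5⟩ := h1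
  have hn : ρ.length ≤ n := by simpa using hR.length_le
  have h2 : ∀ t, ρ.length ≤ t → ovf P H j t (tbl P H j t) s.2.1 = false ∧ quiet t s = true ∧
      light P H j t s z = true := by
    intro t ht
    have := h2 t
    unfold tbadD tbadE at this
    simpa [ht, and_assoc] using this
  have hc : ∀ t, ρ.length ≤ t → cst (tbl P H j t) a s = true := by
    intro t ht
    induction t, ht using Nat.le_induction with
    | base => exact h3
    | succ t ht ih =>
      refine cst_succ (by omega) ih fun X _ => upd_keep1 P H j (h2 t ht).2.1 (.inl ?_)
      rw [(h2 t ht).1]; rfl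
  obtain ⟨z', g1, g2⟩ := key_exists P H j (h2 n hn).2.2
  obtain ⟨X, hX⟩ := sub_extend a
  refine ⟨s, ?_, (h2 n hn).2.1, (h2 n hn).1, mem_Qs.2 ⟨z', ?_, mem_QKs.2 ⟨g2, a, by omega, hc n hn,
    out_mono h4 hn hR List.prefix_rfl, out_mono h5 hn List.prefix_rfl g1⟩⟩⟩
  · rw [← (cst_iff P H j (by omega)).1 (hc n hn) X hX]; exact st_mem_Sts _ _ _
  · exact g1.length_le.trans (by omega)

theorem VT_real (n : ℕ) : mu.real {R | ∃ ρ ∈ VT P H j, ρ <+: pre R n} ≤ 2⁻¹ ^ (j + 1) := by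
  classical
  have h1 : {R | ∃ ρ ∈ VT P H j, ρ <+: pre R n} ⊆
      ⋃ r ∈ (Finset.range (n+1)).filter (fun r => ovf P H j n (tbl P H j n) r = false),
      ⋃ s ∈ (Sts P H j n).filter (fun s => s.2.1 = r ∧ quiet n s = true), Qs P H j n s := by
    rintro R ⟨ρ, hρ, hR⟩
    obtain ⟨s, h1, h2, h3, h4⟩ := VT_mem hρ hR
    simp only [Set.mem_iUnion]
    refine ⟨s.2.1, Finset.mem_filter.2 ⟨?_, h3⟩, s, Finset.mem_filter.2 ⟨h1, rfl, h2⟩, h4⟩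
    obtain ⟨X, rfl⟩ := mem_Sts h1
    have := (wf P H j X n).2 _ (List.mem_of_getElem? (rl_root _))
    exact Finset.mem_range.2 (by omega)
  refine (measureReal_mono h1 (measure_ne_top _ _)).trans ((measureReal_biUnion_finset_le _ _).trans ?_)
  refine (Finset.sum_le_sum (g := fun r => (2⁻¹ : ℝ) ^ (j + r + 2)) fun r hr => 
    root_bound hP (Finset.mem_filter.1 hr).2).trans ?_
  have h2 := (summable_geometric_of_lt_one (r := (2⁻¹ : ℝ)) (by norm_num) (by norm_num)).sum_le_tsum
    ((Finset.range (n+1)).filter (fun r => ovf P H j n (tbl P H j n) r = false)) (fun _ _ => by positivity)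
  rw [tsum_geometric_of_lt_one (by norm_num) (by norm_num)] at h2
  have h3 : ∀ r, (2⁻¹ : ℝ) ^ (j + r + 2) = 2⁻¹ ^ (j + 2) * 2⁻¹ ^ r := by
    intro r; rw [← pow_add]; congr 1; omega
  simp only [h3]
  rw [← Finset.mul_sum]
  refine (mul_le_mul_of_nonneg_left h2 (by positivity)).trans (le_of_eq ?_)
  rw [pow_succ _ (j+1)]; ring

theorem VT_measure (j : ℕ) : stringMeasure (VT P H j) < (2 : ℝ≥0∞)⁻¹ ^ j := by
  classical
  have h : stringMeasure (VT P H j) ≤ (2 : ℝ≥0∞)⁻¹ ^ (j + 1) := by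
    unfold stringMeasure
    refine iSup_le fun n => ?_
    let f : Str → Bool := fun a => decide (∃ ρ ∈ VT P H j, ρ <+: a)
    have h1 : Nat.card {f : Fin n → Bool // ∃ σ ∈ VT P H j, σ <+: List.ofFn f} ≤ cnt n f := by
      unfold cnt
      rw [Nat.card_eq_fintype_card, Fintype.card_subtype,
        ← List.toFinset_card_of_nodup ((nodup_allStr n).filter _)]
      refine Finset.card_le_card_of_injOn List.ofFn ?_ ?_
      · intro g hg
        have hg := (Finset.mem_filter.1 (Finset.mem_coe.1 hg)).2
        simp only [List.coe_toFinset, Set.mem_ofPred_eq, List.mem_filter, mem_allStr]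
        exact ⟨by simp, by simpa [f] using hg⟩
      · intro a _ b _ hab; exact List.ofFn_injective hab
    have h2 := VT_real (H := H) hP (j := j) n
    have h3 : {R | ∃ ρ ∈ VT P H j, ρ <+: pre R n} = ms n f := by
      ext R; simp [ms, f]
    rw [h3, mu_ms, div_le_iff₀ (by positivity)] at h2
    have h4 : (Nat.card {f : Fin n → Bool // ∃ σ ∈ VT P H j, σ <+: List.ofFn f} : ℝ) ≤ 2⁻¹ ^ (j+1) * 2 ^ n :=
      le_trans (by exact_mod_cast h1) h2
    refine ENNReal.div_le_of_le_mul ?_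
    have h5 := ENNReal.ofReal_le_ofReal h4
    rw [ENNReal.ofReal_natCast] at h5
    refine h5.trans (le_of_eq ?_)
    rw [ENNReal.ofReal_mul (by positivity), ENNReal.ofReal_pow (by norm_num), ENNReal.ofReal_pow (by norm_num),
      ENNReal.ofReal_inv_of_pos (by norm_num)]
    norm_num
  refine h.trans_lt ?_
  rw [pow_succ]
  have h0 : (2 : ℝ≥0∞)⁻¹ ^ j ≠ 0 := by simp
  have h1 : (2 : ℝ≥0∞)⁻¹ ^ j ≠ ⊤ := by simp
  calc _ < (2 : ℝ≥0∞)⁻¹ ^ j * 1 := ENNReal.mul_lt_mul_right h0 h1 (by simp)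
    _ = _ := mul_one _

theorem exists_j {R : ℕ → Bool} (hR : TwoRandom R) : ∃ j, R ∉ openOf (VT P H j) :=
  hR _ ⟨VT_ce P H, fun j => VT_measure hP j⟩
end
end TypicalDegree

namespace TypicalDegree
open Encodable MeasureTheory

section
variable {P H : Nat.Partrec.Code}
variable {cP : OracleCode} (hP : Rep cP P) {cH : OracleCode} (hH : Rep cH H)

theorem wt_le_one (t : ℕ) (z : Str) : (wt P H t z : ℝ) / 2 ^ t ≤ 1 := by
  unfold wt; rw [← mu_ms]; exact measureReal_le_one

include hP hH in
theorem wt_add {t : ℕ} {y z z' : Str} (h : y <+: z) (h' : y <+: z') (hc : cpt z z' = false) :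
    (wt P H t z : ℝ) / 2 ^ t + wt P H t z' / 2 ^ t ≤ wt P H t y / 2 ^ t := by
  unfold wt
  rw [← mu_ms, ← mu_ms, ← mu_ms, ← measureReal_union]
  · exact measureReal_mono (Set.union_subset (wset_mono P H le_rfl h) (wset_mono P H le_rfl h'))
  · rw [Set.disjoint_left]
    intro R h1 h2
    rw [mem_wset] at h1 h2
    obtain ⟨a, _, h3, h4⟩ := h1
    obtain ⟨a', _, h5, h6⟩ := h2
    have := out_cpt hH h4 h6 (cpt_iff.1 (out_cpt hP h3 h5 (.inl List.prefix_rfl)))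
    rw [hc] at this; simp at this
  · exact measurableSet_ms _ _

include hP hH in
theorem light_exists {B : ℕ → Bool} (hB : ¬ ComputableSeq B) {ε : ℝ} (hε : 0 < ε) :
    ∃ m, ∀ t, (wt P H t (pre B m) : ℝ) / 2 ^ t ≤ ε := by
  by_contra hcon
  push Not at hcon
  apply hB
  let W : Str → ℝ := fun z => ⨆ t, (wt P H t z : ℝ) / 2 ^ t
  have hbdd : ∀ z, BddAbove (Set.range fun t => (wt P H t z : ℝ) / 2 ^ t) := fun z =>
    ⟨1, by rintro _ ⟨t, rfl⟩; exact wt_le_one t z⟩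
  have hle : ∀ z t, (wt P H t z : ℝ) / 2 ^ t ≤ W z := fun z t => le_ciSup (hbdd z) t
  have hW : ∀ m, ε ≤ W (pre B m) := fun m => by
    obtain ⟨t, ht⟩ := hcon m
    exact ht.le.trans (hle _ t)
  set c : ℝ := ⨅ m, W (pre B m) with hc
  have hbb : BddBelow (Set.range fun m => W (pre B m)) := ⟨ε, by rintro _ ⟨m, rfl⟩; exact hW m⟩
  have hcW : ∀ m, c ≤ W (pre B m) := fun m => ciInf_le hbb m
  have hc0 : 0 < c := hε.trans_le (le_ciInf hW)
  obtain ⟨m0, hm0⟩ := exists_lt_of_ciInf_lt (show (⨅ m, W (pre B m)) < 3 / 2 * c by rw [← hc]; linarith)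
  obtain ⟨q, hq1, hq2⟩ := exists_rat_btwn (show c / 2 < c by linarith)
  have hq0 : 0 < q := by
    have : (0:ℝ) < q := by linarith
    exact_mod_cast this
  have hqq : (q : ℝ) = (q.num.toNat : ℝ) / q.den := by
    have h1 : ((q.num.toNat : ℤ) : ℝ) = q.num := by
      rw [Int.toNat_of_nonneg (Rat.num_nonneg.2 hq0.le)]
    rw [Rat.cast_def]; congr 1
    rw [← h1, Int.cast_natCast]
  set A := q.num.toNat
  set D := q.den
  have hD : (0:ℝ) < D := by exact_mod_cast q.den_pos
  have hcmp : ∀ t z, A * 2 ^ t < wt P H t z * D ↔ (q : ℝ) < wt P H t z / 2 ^ t := by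
    intro t z
    rw [hqq, div_lt_div_iff₀ hD (by positivity)]
    exact_mod_cast Iff.rfl
  have hsup : ∀ m x, x < c → ∃ t, x < (wt P H t (pre B m) : ℝ) / 2 ^ t := fun m x hx =>
    exists_lt_of_lt_ciSup (hx.trans_le (hcW m))
  refine TRed.of_search _ _ (fun β n => ((strs β.length).filter fun z =>
    pfx (pre B m0) z && decide (n < z.length) && decide (A * 2 ^ β.length < wt P H β.length z * D)).head?.elim none
      fun z => z[n]?) (by fun_prop) ?_ ?_
  · intro k n b h
    rw [pre_length] at h
    cases hh : ((strs k).filter fun z =>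
      pfx (pre B m0) z && decide (n < z.length) && decide (A * 2 ^ k < wt P H k z * D)).head? with
    | none => rw [hh] at h; simp at h
    | some z =>
      rw [hh, Option.elim_some] at h
      have hm := List.mem_of_mem_head? hh
      simp only [List.mem_filter, Bool.and_eq_true, decide_eq_true_iff, pfx_iff, hcmp] at hm
      obtain ⟨-, ⟨h1, h2⟩, h3⟩ := hm
      have hml : m0 ≤ z.length := by simpa using h1.length_le
      have hzB : cpt z (pre B z.length) = true := by
        by_contra hcc
        obtain ⟨t, ht⟩ := hsup z.length (3 / 2 * c - q) (by linarith)
        have e1 := wt_mono P H (le_max_left k t) (List.prefix_refl z)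
        have e2 := wt_mono P H (le_max_right k t) (List.prefix_refl (pre B z.length))
        have e3 := wt_add hP hH (t := max k t) h1 (pre_initOf B hml) (by simpa using hcc)
        have e4 := hle (pre B m0) (max k t)
        linarith
      have hz : z = pre B z.length := by
        rcases cpt_iff.1 hzB with h | h
        · exact h.eq_of_length (by simp)
        · exact (h.eq_of_length (by simp)).symm
      rw [hz, pre_getElem? _ _ _ h2] at h
      exact (Option.some.inj h).symm
  · intro n
    obtain ⟨t, ht⟩ := hsup (n + m0 + 1) q hq2
    refine ⟨max t (n + m0 + 1), ?_⟩
    rw [pre_length]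
    set k := max t (n + m0 + 1)
    cases hh : ((strs k).filter fun z =>
      pfx (pre B m0) z && decide (n < z.length) && decide (A * 2 ^ k < wt P H k z * D)).head? with
    | none =>
      rw [List.head?_eq_none_iff, List.filter_eq_nil_iff] at hh
      have := hh (pre B (n + m0 + 1)) (mem_strs.2 (by simp [k]))
      exfalso; apply this
      simp only [Bool.and_eq_true, decide_eq_true_iff, pfx_iff, hcmp]
      refine ⟨⟨pre_initOf B (by omega), by rw [pre_length]; omega⟩, ht.trans_le (wt_mono P H (le_max_left _ _) List.prefix_rfl)⟩
    | some z =>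
      have hm := List.mem_of_mem_head? hh
      simp only [List.mem_filter, Bool.and_eq_true, decide_eq_true_iff] at hm
      simp [hm.2.1.2]
end
end TypicalDegree

namespace TypicalDegree
open Encodable MeasureTheory

theorem prefix_take_of {β : Type*} {L l : List β} {i : ℕ} (h : L <+: l) (hi : L.length ≤ i) : L <+: l.take i := by
  rw [List.prefix_take_iff]; exact ⟨h, hi⟩

section
variable {P H : Nat.Partrec.Code} {j : ℕ}
variable {cP : OracleCode} (hP : Rep cP P) {cH : OracleCode} (hH : Rep cH H)

theorem prefix_persist {X : ℕ → Bool} {N : ℕ} {L} (hlen : ∀ t, N ≤ t → L.length ≤ (st P H j X t).1.length)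
    (h : L <+: (st P H j X N).1) : ∀ t, N ≤ t → L <+: (st P H j X t).1 := by
  intro t ht
  induction t, ht using Nat.le_induction with
  | base => exact h
  | succ t ht ih =>
    have hl := hlen (t+1) (by omega)
    rw [st_succ] at hl ⊢
    rcases recs_step P H j t (tbl P H j t) (pre X (t+1)) (st P H j X t) with ⟨i, _, h2, _⟩ | ⟨h2, _⟩
    · rw [h2] at hl ⊢
      refine prefix_take_of ih ?_
      rw [List.length_take] at hl; omega
    · exact ih.trans h2

theorem root_persist {X : ℕ → Bool} {N : ℕ} {e r : ℕ} (hlen : ∀ t, N ≤ t → e ≤ (st P H j X t).1.length)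
    (h : (rl (st P H j X N))[e]? = some r) : ∀ t, N ≤ t → (rl (st P H j X t))[e]? = some r := by
  intro t ht
  induction t, ht using Nat.le_induction with
  | base => exact h
  | succ t ht ih =>
    have hl := hlen (t+1) (by omega)
    rw [st_succ] at hl ⊢
    rcases recs_step P H j t (tbl P H j t) (pre X (t+1)) (st P H j X t) with ⟨i, _, h2, h3⟩ | ⟨_, h2⟩
    · rw [h2, List.length_take] at hl
      rw [h3, List.getElem?_take, if_pos (by omega)]; exact ih
    · exact prefix_getElem? h2 ih

include hH in
theorem confl_ev {A B : ℕ → Bool} (hB : FTotal cH A B) {t l : ℕ} {σ : Str} (hp : pairEv t l σ = true) :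
    ∃ u0, ∀ u, u0 ≤ u → ∃ z τ, confl H u l σ (pre A (u+1)) = some z ∧ wit u l σ z = some τ := by
  obtain ⟨z0, z1, l0, l1, i0, i1, hc⟩ := pairEv_iff.1 hp
  have : ∃ z : Str, z.length ≤ t ∧ inS t l σ z = true ∧ ¬ Sub z B := by
    by_contra hcon
    push Not at hcon
    have := (hcon z0 l0 i0).compat (hcon z1 l1 i1)
    rw [← cpt_iff, hc] at this; simp at this
  obtain ⟨z, hz, hi, hn⟩ := this
  obtain ⟨u1, hu1⟩ := out_complete hH hB z.length
  refine ⟨max t u1, fun u hu => ?_⟩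
  have hmem : z ∈ (strs u).filter fun z => inS u l σ z && (strs u).any fun y => out u H (pre A (u+1)) y && !cpt y z := by
    rw [List.mem_filter, mem_strs, Bool.and_eq_true, List.any_eq_true]
    refine ⟨by omega, inS_mono hi (by omega), pre B z.length, mem_strs.2 (by simp; omega), ?_⟩
    rw [Bool.and_eq_true, Bool.not_eq_true']
    refine ⟨out_mono hu1 (by omega) (pre_initOf A (by omega)) List.prefix_rfl, ?_⟩
    by_contra hc
    rcases cpt_iff.1 (by simpa using hc) with h | h
    · exact hn (h.eq_of_length (by simp))
    · exact hn (h.eq_of_length (by simp)).symm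
  cases hf : confl H u l σ (pre A (u+1)) with
  | none =>
    unfold confl at hf
    rw [List.head?_eq_none_iff] at hf
    rw [hf] at hmem; simp at hmem
  | some z' =>
    have hm := List.mem_of_mem_head? hf
    simp only [List.mem_filter, Bool.and_eq_true] at hm
    obtain ⟨τ, hτ⟩ := Option.isSome_iff_exists.1 hm.2.1
    exact ⟨z', τ, rfl, hτ⟩

include hP hH in
theorem stab_case {A B R : ℕ → Bool} (hA : FTotal cP R A) (hB : FTotal cH A B) (hBc : ¬ ComputableSeq B)
    (hR : R ∉ openOf (VT P H j)) {t0 : ℕ} {s : State} (hs : ∀ t, t0 ≤ t → st P H j A t = s)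
    (ho : ∀ t, t0 ≤ t → ovf P H j t (tbl P H j t) s.2.1 = false) : False := by
  have hstep : ∀ t, t0 ≤ t → upd P H j t (tbl P H j t) (pre A (t+1)) s = s := by
    intro t ht
    have := hs (t+1) (by omega)
    rwa [st_succ, hs t ht] at this
  have hfail : ∀ t, t0 ≤ t → failAt t s.1 = none := by
    intro t ht
    cases hf : failAt t s.1 with
    | none => rfl
    | some i =>
      have h1 := hstep t ht
      have hi := (failAt_some hf).1
      unfold upd at h1
      rw [hf, Option.elim_some] at h1
      have := congrArg (fun s => s.1.length) h1
      simp at this; omega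
  have hpe : ∀ t, t0 ≤ t → pairEv t s.1.length s.2.2 = false := by
    intro t ht
    by_contra hc
    have hc : pairEv t s.1.length s.2.2 = true := by simpa using hc
    obtain ⟨u0, hu⟩ := confl_ev hH hB hc
    obtain ⟨z, τ, h1, h2⟩ := hu (max u0 t) (le_max_left _ _)
    have h3 := hstep (max u0 t) (by omega)
    unfold upd at h3
    rw [hfail _ (by omega), Option.elim_none, if_pos (pairEv_mono hc (le_max_right _ _)), h1, Option.elim_some, h2,
      Option.elim_some] at h3
    have := congrArg (fun s => s.1.length) h3
    simp at this
  have hq : ∀ t, t0 ≤ t → quiet t s = true := fun t ht => quiet_iff.2 ⟨hfail t ht, hpe t ht⟩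
  have hdl : 0 < dl j s := by unfold dl; positivity
  obtain ⟨m, hm⟩ := light_exists hP hH hBc hdl
  obtain ⟨t1, ht1⟩ := out_complete hH hB m
  set k := max t0 t1
  obtain ⟨t2, ht2⟩ := out_complete hP hA k
  set T := max (max k t2) m
  apply hR
  refine ⟨pre R T, ⟨s, pre B m, ?_, ?_⟩, extendsStr_iff.2 (sub_pre R T)⟩
  · unfold tstat
    simp only [Bool.and_eq_true, decide_eq_true_iff, List.any_eq_true, mem_strs, pre_length]
    refine ⟨by omega, pre A k, by simp; omega, ⟨?_, ?_⟩, ?_⟩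
    · have : ∀ t, k ≤ t → cst (tbl P H j t) (pre A k) s = true := by
        intro t ht
        induction t, ht using Nat.le_induction with
        | base =>
          rw [cst_iff P H j (by simp)]
          intro X hX
          rw [← hs k (by omega)]
          refine st_congr P H j ?_
          simpa [Sub] using hX
        | succ t ht ih =>
          refine cst_succ (by simpa using ht) ih fun X _ => upd_keep1 P H j (hq t (by omega)) (.inl ?_)
          rw [ho t (by omega)]; rfl
      exact this T (by omega)
    · exact out_mono ht2 (by omega) (pre_initOf R (by omega)) List.prefix_rfl
    · exact out_mono ht1 (by omega) (pre_initOf A (by omega)) List.prefix_rfl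
  · intro t
    unfold tbadD tbadE
    by_cases ht : T ≤ t
    · have hl : light P H j t s (pre B m) = true := (light_iff P H j).2 (hm t)
      simp [ht, ho t (by omega), hq t (by omega), hl]
    · simp [ht]

include hP hH in
theorem level_inf {A B R : ℕ → Bool} (hA : FTotal cP R A) (hB : FTotal cH A B) (hBc : ¬ ComputableSeq B)
    (hR : R ∉ openOf (VT P H j)) (e : ℕ) :
    ∃ L N, L.length = e ∧ ∀ t, N ≤ t → L <+: (st P H j A t).1 := by
  induction e with
  | zero => exact ⟨[], 0, rfl, fun t _ => List.nil_prefix⟩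
  | succ e ih =>
    obtain ⟨L, N, hL, hpre⟩ := ih
    have hlen : ∀ t, N ≤ t → e ≤ (st P H j A t).1.length := fun t ht => hL ▸ (hpre t ht).length_le
    obtain ⟨r, hr⟩ : ∃ r, (rl (st P H j A N))[e]? = some r := by
      have := hlen N le_rfl
      exact ⟨_, List.getElem?_eq_getElem (by rw [rl_length]; omega)⟩
    have hroot := root_persist hlen hr
    obtain ⟨N2, hN2⟩ := ovf_finite (j := j) hP hH r
    by_cases hcase : ∃ t, max N N2 ≤ t ∧ (st P H j A t).1.length = e
    · obtain ⟨t0, ht0, hl0⟩ := hcase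
      have hone : ∀ t, max N N2 ≤ t → (st P H j A t).1.length = e →
          st P H j A (t+1) = st P H j A t ∨ (st P H j A (t+1)).1 = L ++ [(r, none)] := by
        intro t ht hl
        have hLt : (st P H j A t).1 = L := ((hpre t (by omega)).eq_of_length (by omega)).symm
        have hrt : (st P H j A t).2.1 = r := by
          have h1 := hroot t (by omega)
          rw [← hl, rl_root] at h1
          exact Option.some.inj h1
        have hl1 := hlen (t+1) (by omega)
        rw [st_succ] at hl1 ⊢
        rcases upd_cases P H j t (tbl P H j t) (pre A (t+1)) (st P H j A t) with ⟨_, h⟩ | ⟨i, hi, h⟩ | ⟨z, τ, _, _, _, _, h⟩ | ⟨z, _, _, ho, _, _, h⟩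
        · exact .inl h
        · have := (failAt_some hi).1
          rw [h] at hl1; simp at hl1; omega
        · right; rw [h, hLt, hrt]
        · rw [hrt, hN2 t (by omega)] at ho; simp at ho
      by_cases hD : ∃ t, t0 ≤ t ∧ (st P H j A t).1 = L ++ [(r, none)]
      · obtain ⟨t1, ht1, hd⟩ := hD
        refine ⟨L ++ [(r, none)], t1, by simp [hL], fun t ht => ?_⟩
        rcases entry_persist P H j (X := A) (t := t1) (t' := t) (L := L) (r := r) (o := none) (by rw [hd]) ht with h | ⟨_, _, h, _⟩ | h
        · exact h
        · cases h
        · exact (h (List.mem_of_getElem? (hroot t (by omega)))).elim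
      · exfalso
        have hs : ∀ t, t0 ≤ t → st P H j A t = st P H j A t0 := by
          intro t ht
          induction t, ht using Nat.le_induction with
          | base => rfl
          | succ t ht ih =>
            rcases hone t (by omega) (by rw [ih]; exact hl0) with h | h
            · rw [h, ih]
            · exact (hD ⟨t+1, by omega, h⟩).elim
        refine stab_case hP hH hA hB hBc hR hs fun t ht => ?_
        have h1 := hroot t0 (by omega)
        rw [← hl0, rl_root] at h1
        rw [Option.some.inj h1]
        exact hN2 t (by omega)
    · have hlen2 : ∀ t, max N N2 ≤ t → e + 1 ≤ (st P H j A t).1.length := by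
        intro t ht
        have h1 := hlen t (by omega)
        by_contra hc
        exact hcase ⟨t, ht, by omega⟩
      have hl : ((st P H j A (max N N2)).1.take (e+1)).length = e + 1 := by
        have := hlen2 _ le_rfl
        rw [List.length_take]; omega
      exact ⟨(st P H j A (max N N2)).1.take (e+1), max N N2, hl,
        prefix_persist (by rw [hl]; exact hlen2) (List.take_prefix _ _)⟩
end
end TypicalDegree

namespace TypicalDegree
open Encodable MeasureTheory

theorem confl_spec {H : Nat.Partrec.Code} {cH : OracleCode} (hH : Rep cH H) {A B : ℕ → Bool}
    (hB : FTotal cH A B) {t l n : ℕ} {σ z : Str} (h : confl H t l σ (pre A n) = some z) : ¬ Sub z B := by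
  have hm := List.mem_of_mem_head? h
  simp only [List.mem_filter, Bool.and_eq_true, List.any_eq_true, Bool.not_eq_true'] at hm
  obtain ⟨_, _, y, _, h1, h2⟩ := hm
  intro hz
  have h3 := out_sound hH h1 (sub_pre A n)
  rw [sOut_of_total hB] at h3
  have := cpt_iff.2 (h3.compat hz)
  rw [h2] at this; simp at this

theorem step_data {P H : Nat.Partrec.Code} {j : ℕ} {cH : OracleCode} (hH : Rep cH H) {A B : ℕ → Bool}
    (hB : FTotal cH A B) (t : ℕ) :
    ((st P H j A (t+1)).1 <+: (st P H j A t).1 ∧ (st P H j A (t+1)).2.2 = (st P H j A t).2.2) ∨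
    (∃ z τ, wit t (st P H j A t).1.length (st P H j A t).2.2 z = some τ ∧ ¬ Sub z B ∧
      (st P H j A (t+1)).1 = (st P H j A t).1 ++ [((st P H j A t).2.1, none)] ∧
      (st P H j A (t+1)).2.2 = τ ++ un (encode (pre A (t+1)))) ∨
    (∃ z, Sub z B ∧
      (st P H j A (t+1)).1 = (st P H j A t).1 ++ [((st P H j A t).2.1, some ((st P H j A t).2.2, z))] ∧
      (st P H j A (t+1)).2.2 = (st P H j A t).2.2 ++ un (key z (st P H j A t).1.length) ++
        un (encode (pre A (t+1)))) := by
  rw [st_succ]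
  rcases upd_cases P H j t (tbl P H j t) (pre A (t+1)) (st P H j A t) with ⟨_, h⟩ | ⟨i, hi, h⟩ | ⟨z, τ, _, _, hc, hw, h⟩ | ⟨z, _, _, _, _, hr, h⟩
  · left; rw [h]; exact ⟨List.prefix_rfl, rfl⟩
  · left; rw [h]; exact ⟨List.take_prefix _ _, rfl⟩
  · right; left; rw [h]; exact ⟨z, τ, hw, confl_spec hH hB hc, rfl, rfl⟩
  · right; right; rw [h]
    have h3 := out_sound hH (relz_spec hr).2.1 (sub_pre A (t+1))
    rw [sOut_of_total hB] at h3
    exact ⟨z, h3, rfl, rfl⟩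

theorem lev_le {P H : Nat.Partrec.Code} {j : ℕ} {cH : OracleCode} (hH : Rep cH H) {A B : ℕ → Bool}
    (hB : FTotal cH A B) (t : ℕ) : (st P H j A t).1.length ≤ (st P H j A t).2.2.length := by
  induction t with
  | zero => simp [st_zero]
  | succ t ih =>
    rcases step_data (P := P) (j := j) hH hB t with ⟨h1, h2⟩ | ⟨z, τ, hw, _, h1, h2⟩ | ⟨z, _, h1, h2⟩
    · rw [h2]; exact h1.length_le.trans ih
    · have := (wit_spec hw).1.length_le
      rw [h1, h2]; simp [un_length] at this ⊢; omega
    · rw [h1, h2]; simp [un_length]; omega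

/-- the limit sequence -/
noncomputable def limC (P H : Nat.Partrec.Code) (j : ℕ) (A : ℕ → Bool) : ℕ → Bool := fun n =>
  @decide (∃ t, (st P H j A t).2.2[n]? = some true) (Classical.dec _)

theorem sub_limC (P H : Nat.Partrec.Code) (j : ℕ) (A : ℕ → Bool) (t : ℕ) :
    Sub (st P H j A t).2.2 (limC P H j A) := by
  rw [sub_iff]
  intro i hi
  have key : ∀ u b, (st P H j A u).2.2[i]? = some b → b = (st P H j A t).2.2[i] := by
    intro u b hu
    rcases le_total t u with h | h
    · have := prefix_getElem? (sg_mono P H j A h) (List.getElem?_eq_getElem hi)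
      rw [hu] at this; exact Option.some.inj this
    · have := prefix_getElem? (sg_mono P H j A h) hu
      rw [List.getElem?_eq_getElem hi] at this; exact (Option.some.inj this).symm
  unfold limC
  cases hb : (st P H j A t).2.2[i] with
  | true => symm; exact @decide_eq_true _ (Classical.dec _) ⟨t, by rw [List.getElem?_eq_getElem hi, hb]⟩
  | false =>
    symm; refine @decide_eq_false _ (Classical.dec _) ?_; rintro ⟨u, hu⟩
    have := key u _ hu
    rw [hb] at this; simp at this

theorem limC_red {P H : Nat.Partrec.Code} {j : ℕ} {A : ℕ → Bool}
    (hinf : ∀ n, ∃ t, n < (st P H j A t).2.2.length) : TRed (limC P H j A) A := by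
  refine TRed.of_search A _ (fun β n => ((tbl P H j β.length).filterMap fun p =>
    if decide (p.1 = β) = true then p.2.2.2[n]? else none).head?) ?_ ?_ ?_
  · fun_prop
  · intro k n b h
    have := List.mem_of_mem_head? h
    rw [List.mem_filterMap] at this
    obtain ⟨p, hp, h1⟩ := this
    rw [pre_length] at hp
    obtain ⟨X, rfl⟩ := (mem_tbl P H j).1 hp
    split at h1
    next h2 =>
      rw [decide_eq_true_iff] at h2
      dsimp only at h1 h2
      rw [st_congr P H j h2] at h1
      obtain ⟨hn, h3⟩ := List.getElem?_eq_some_iff.1 h1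
      rw [← h3]; exact (sub_limC P H j A k).getElem n hn
    next => cases h1
  · intro n
    obtain ⟨t, ht⟩ := hinf n
    refine ⟨t, ?_⟩
    rw [List.isSome_head?]
    refine List.ne_nil_of_mem (a := (st P H j A t).2.2[n]) (List.mem_filterMap.2 ?_)
    refine ⟨(pre A t, st P H j A t), ?_, ?_⟩
    · rw [pre_length]; exact (mem_tbl P H j).2 ⟨A, rfl⟩
    · simp [ht]

/-- meaning of records -/
def Ent (B : ℕ → Bool) (i : ℕ) (o : Option (Str × Str)) (σ : Str) : Prop :=
  (o = none → ∃ z τ u, out u (Denumerable.ofNat Nat.Partrec.Code i) τ z = true ∧ τ <+: σ ∧ ¬ Sub z B) ∧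
  (∀ σ' z, o = some (σ', z) → Sub z B ∧ (σ' ++ un (key z i)) <+: σ)

theorem Ent.mono {B : ℕ → Bool} {i o σ σ'} (h : Ent B i o σ) (hs : σ <+: σ') : Ent B i o σ' := by
  refine ⟨fun ho => ?_, fun σ1 z ho => ?_⟩
  · obtain ⟨z, τ, u, h1, h2, h3⟩ := h.1 ho
    exact ⟨z, τ, u, h1, h2.trans hs, h3⟩
  · exact ⟨(h.2 _ _ ho).1, (h.2 _ _ ho).2.trans hs⟩

theorem ent_inv {P H : Nat.Partrec.Code} {j : ℕ} {cH : OracleCode} (hH : Rep cH H) {A B : ℕ → Bool}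
    (hB : FTotal cH A B) (t : ℕ) : ∀ i r o, (st P H j A t).1[i]? = some (r, o) →
      Ent B i o (st P H j A t).2.2 := by
  induction t with
  | zero => simp [st_zero]
  | succ t ih =>
    intro i r o h
    have hm := sg_mono P H j A (Nat.le_succ t)
    rcases step_data (P := P) (j := j) hH hB t with ⟨h1, h2⟩ | ⟨z, τ, hw, hz, h1, h2⟩ | ⟨z, hz, h1, h2⟩
    · exact (ih i r o (prefix_getElem? h1 h)).mono hm
    · rw [h1, List.getElem?_append] at h
      split at h
      · exact (ih i r o h).mono hm
      · rw [List.getElem?_singleton] at h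
        split at h
        · have hi : i = (st P H j A t).1.length := by omega
          simp only [Option.some.injEq, Prod.mk.injEq] at h
          refine ⟨fun _ => ?_, fun σ' z' ho => by rw [← h.2] at ho; cases ho⟩
          obtain ⟨_, u, hu⟩ := wit_spec hw
          refine ⟨z, τ, u, by rw [hi]; exact hu, ?_, hz⟩
          rw [h2]; exact List.prefix_append _ _
        · cases h
    · rw [h1, List.getElem?_append] at h
      split at h
      · exact (ih i r o h).mono hm
      · rw [List.getElem?_singleton] at h
        split at h
        · have hi : i = (st P H j A t).1.length := by omega
          simp only [Option.some.injEq, Prod.mk.injEq] at h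
          refine ⟨fun ho => (by rw [← h.2] at ho; cases ho), fun σ' z' ho => ?_⟩
          rw [← h.2] at ho
          cases ho
          refine ⟨hz, ?_⟩
          rw [h2, hi]; exact List.prefix_append _ _
        · cases h

theorem not_red_limC {P H : Nat.Partrec.Code} {j : ℕ} {cH : OracleCode} (hH : Rep cH H) {A B : ℕ → Bool}
    (hB : FTotal cH A B)
    (hlev : ∀ e : ℕ, ∃ L N, L.length = e ∧ ∀ t, N ≤ t → L <+: (st P H j A t).1) :
    ¬ TRed B (limC P H j A) := by
  rintro ⟨c, hc⟩
  obtain ⟨p, hp⟩ := exists_rep c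
  set l := encode p with hl
  have hlp : Denumerable.ofNat Nat.Partrec.Code l = p := by rw [hl, Denumerable.ofNat_encode]
  obtain ⟨L, N, hL, hN⟩ := hlev (l+1)
  obtain ⟨⟨r, o⟩, hro⟩ : ∃ x, L[l]? = some x := ⟨_, List.getElem?_eq_getElem (by omega)⟩
  have hst : ∀ t, N ≤ t → (st P H j A t).1[l]? = some (r, o) := fun t ht => prefix_getElem? (hN t ht) hro
  have hE := ent_inv (P := P) (j := j) hH hB N l r o (hst N le_rfl)
  rw [Ent, hlp] at hE
  cases o with
  | none =>
    obtain ⟨z, τ, u, h1, h2, h3⟩ := hE.1 rfl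
    have := out_sound hp h1 ((sub_limC P H j A N).mono h2)
    rw [sOut_of_total hc] at this
    exact h3 this
  | some q =>
    obtain ⟨σ', z⟩ := q
    obtain ⟨h1, h2⟩ := hE.2 σ' z rfl
    obtain ⟨t1, ht1⟩ := out_complete hp hc z.length
    rw [h1] at ht1
    have hsub : Sub (σ' ++ un (key z l)) (limC P H j A) := (sub_limC P H j A N).mono h2
    obtain ⟨t2, ht2⟩ := inS_ex (l := l) (τ := pre (limC P H j A) (max t1 (σ' ++ un (key z l)).length)) (u := t1)
      (hsub.initOf (le_max_right _ _)) (by rw [hlp]; exact out_mono ht1 le_rfl (pre_initOf _ (le_max_left _ _)) List.prefix_rfl)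
    have hT := hst (max N t2) (le_max_left _ _)
    have hb : bad (max N t2) (st P H j A (max N t2)).1 l = true :=
      bad_iff.2 ⟨r, σ', z, hT, inS_mono ht2 (le_max_right _ _)⟩
    -- first failing index is at most l
    have hf : ∃ i, failAt (max N t2) (st P H j A (max N t2)).1 = some i ∧ i ≤ l := by
      have hlt := (List.getElem?_eq_some_iff.1 hT).1
      unfold failAt
      have hsplit : List.range (st P H j A (max N t2)).1.length = List.range (l+1) ++
          (List.range ((st P H j A (max N t2)).1.length - (l+1))).map (l + 1 + ·) := by
        rw [← List.range_add]; congr 1; omega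
      rw [hsplit, List.filter_append, List.head?_append]
      have : ((List.range (l+1)).filter (bad (max N t2) (st P H j A (max N t2)).1)).head?.isSome := by
        rw [List.isSome_head?]
        exact List.ne_nil_of_mem (a := l) (List.mem_filter.2 ⟨by simp, hb⟩)
      obtain ⟨i, hi⟩ := Option.isSome_iff_exists.1 this
      refine ⟨i, by rw [hi]; rfl, ?_⟩
      have := (List.mem_filter.1 (List.mem_of_mem_head? hi)).1
      simp at this; omega
    obtain ⟨i, hi, hil⟩ := hf
    have hlen := (hN (max N t2 + 1) (by omega)).length_le
    rw [st_succ] at hlen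
    rcases upd_cases P H j (max N t2) (tbl P H j (max N t2)) (pre A (max N t2+1)) (st P H j A (max N t2)) with ⟨h, _⟩ | ⟨i', hi', h⟩ | ⟨z, τ, h, _⟩ | ⟨z, h, _⟩
    · rw [hi] at h; cases h
    · rw [hi] at hi'; cases hi'
      rw [h] at hlen; simp at hlen; omega
    · rw [hi] at h; cases h
    · rw [hi] at h; cases h
end TypicalDegree

namespace TypicalDegree
open Encodable MeasureTheory

/-- decoding steps -/
def nxtv (u : ℕ) (b c σ : Str) (q : Str × ℕ × Str) : Option (Str × Str) :=
  if (pfx (σ ++ un (key q.1 q.2.1)) c && decide (q.1.length ≤ b.length)) = true then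
    (if pfx q.1 b = true then some (σ ++ un (key q.1 q.2.1)) else wit u q.2.1 σ q.1).elim none fun τ =>
      if pfx (τ ++ un (encode q.2.2)) c = true then some (τ ++ un (encode q.2.2), q.2.2) else none
  else none
def nxt (u : ℕ) (b c σ : Str) : Option (Str × Str) :=
  ((List.range u).filterMap fun n => (decode n : Option (Str × ℕ × Str)).elim none fun q =>
    nxtv u b c σ q).head?
def itr (u : ℕ) (b c : Str) (m : ℕ) : Option (Str × Str) :=
  Nat.rec (some ([], [])) (fun _ o => o.elim none fun p => nxt u b c p.1) m
def ext (β : Str) (d : ℕ) : Str := (List.range ((β.length) / 2)).map fun i => β.getD (2 * i + d) false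
def dcd (β : Str) (n : ℕ) : Option Bool :=
  ((List.range β.length).filterMap fun m => (itr β.length (ext β 0) (ext β 1) m).elim none fun p =>
    p.2[n]?).head?

section
variable {γ : Type*} [Primcodable γ] {u d m : γ → ℕ} {b c σ : γ → Str} {q : γ → Str × ℕ × Str}
@[fun_prop] theorem pr_div2 {f : γ → ℕ} (hf : Primrec f) : Primrec fun x => f x / 2 :=
  Primrec.nat_div.comp hf (Primrec.const 2)
@[fun_prop] theorem pr_nxtv (hu : Primrec u) (hb : Primrec b) (hc : Primrec c) (hs : Primrec σ)
    (hq : Primrec q) : Primrec fun x => nxtv (u x) (b x) (c x) (σ x) (q x) := by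
  unfold nxtv; fun_prop
@[fun_prop] theorem pr_nxt (hu : Primrec u) (hb : Primrec b) (hc : Primrec c) (hs : Primrec σ) :
    Primrec fun x => nxt (u x) (b x) (c x) (σ x) := by
  unfold nxt; fun_prop
@[fun_prop] theorem pr_itr (hu : Primrec u) (hb : Primrec b) (hc : Primrec c) (hm : Primrec m) :
    Primrec fun x => itr (u x) (b x) (c x) (m x) := by
  unfold itr; fun_prop
@[fun_prop] theorem pr_ext (hb : Primrec b) (hd : Primrec d) : Primrec fun x => ext (b x) (d x) := by
  unfold ext; fun_prop
@[fun_prop] theorem pr_dcd (hb : Primrec b) (hd : Primrec d) : Primrec fun x => dcd (b x) (d x) := by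
  unfold dcd; fun_prop
end

theorem ext_even (B C : ℕ → Bool) (k : ℕ) : ext (pre (join B C) k) 0 = pre B (k/2) := by
  unfold ext
  rw [pre_length]
  conv_rhs => unfold pre
  refine List.map_congr_left fun i hi => ?_
  rw [List.mem_range] at hi
  rw [List.getD_eq_getElem?_getD, pre_getElem? _ _ _ (by omega)]
  simp [join]
theorem ext_odd (B C : ℕ → Bool) (k : ℕ) : ext (pre (join B C) k) 1 = pre C (k/2) := by
  unfold ext
  rw [pre_length]
  conv_rhs => unfold pre
  refine List.map_congr_left fun i hi => ?_
  rw [List.mem_range] at hi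
  rw [List.getD_eq_getElem?_getD, pre_getElem? _ _ _ (by omega)]
  have h1 : (2 * i + 1) % 2 = 1 := by omega
  have h2 : (2 * i + 1) / 2 = i := by omega
  simp [join, h2]

/-- one coding step -/
def Stp (B C : ℕ → Bool) (σ σ' α : Str) : Prop := ∃ z l τ,
  ((Sub z B ∧ τ = σ ++ un (key z l)) ∨ (¬ Sub z B ∧ ∃ u, wit u l σ z = some τ)) ∧
  σ' = τ ++ un (encode α) ∧ Sub σ' C

theorem Stp.unique {B C : ℕ → Bool} {σ σ1 σ2 α1 α2 : Str} (h1 : Stp B C σ σ1 α1)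
    (h2 : Stp B C σ σ2 α2) : σ1 = σ2 ∧ α1 = α2 := by
  have aux : ∀ {σ' α}, (h : Stp B C σ σ' α) → ∃ z l τ,
    ((Sub z B ∧ τ = σ ++ un (key z l)) ∨ (¬ Sub z B ∧ ∃ u, wit u l σ z = some τ)) ∧
    σ' = τ ++ un (encode α) ∧ Sub σ' C ∧ Sub (σ ++ un (key z l)) C := by
    rintro σ' α ⟨z, l, τ, h, he, hs⟩
    refine ⟨z, l, τ, h, he, hs, hs.mono ?_⟩
    rw [he]
    rcases h with ⟨_, h⟩ | ⟨_, u, h⟩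
    · rw [h]; exact List.prefix_append _ _
    · exact (wit_spec h).1.trans (List.prefix_append _ _)
  obtain ⟨z, l, τ, h, he, hs, hk⟩ := aux h1
  obtain ⟨z', l', τ', h', he', hs', hk'⟩ := aux h2
  obtain ⟨rfl, rfl⟩ := key_inj (un_unique hk hk')
  have hτ : τ = τ' := by
    rcases h with ⟨a, h⟩ | ⟨a, u, h⟩ <;> rcases h' with ⟨a', h'⟩ | ⟨a', u', h'⟩
    · rw [h, h']
    · exact (a' a).elim
    · exact (a a').elim
    · have e1 := wit_mono h (le_max_left u u')
      have e2 := wit_mono h' (le_max_right u u')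
      rw [e1] at e2; exact Option.some.inj e2
  subst hτ
  rw [he] at hs; rw [he'] at hs'
  have := Encodable.encode_injective (un_unique hs hs')
  subst this
  exact ⟨he.trans he'.symm, rfl⟩

theorem sub_dec {z : Str} {B : ℕ → Bool} {k : ℕ} (hk : z.length ≤ k) : pfx z (pre B k) = true ↔ Sub z B := by
  rw [pfx_iff]
  exact ⟨sub_of_prefix_pre, fun h => h.initOf hk⟩

theorem nxtv_stp {B C : ℕ → Bool} {u k k' : ℕ} {σ σ' α : Str} {q}
    (h : nxtv u (pre B k) (pre C k') σ q = some (σ', α)) : Stp B C σ σ' α := by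
  unfold nxtv at h
  split at h
  next h1 =>
    simp only [Bool.and_eq_true, decide_eq_true_iff, pre_length] at h1
    split at h
    next h2 =>
      simp only [Option.elim_some] at h
      split at h
      next h3 =>
        simp only [Option.some.injEq, Prod.mk.injEq] at h
        obtain ⟨rfl, rfl⟩ := h
        exact ⟨q.1, q.2.1, _, .inl ⟨(sub_dec h1.2).1 h2, rfl⟩, rfl, sub_of_prefix_pre (pfx_iff.1 h3)⟩
      next => cases h
    next h2 =>
      cases hw : wit u q.2.1 σ q.1 with
      | none => rw [hw] at h; cases h
      | some τ =>
        rw [hw] at h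
        simp only [Option.elim_some] at h
        split at h
        next h3 =>
          simp only [Option.some.injEq, Prod.mk.injEq] at h
          obtain ⟨rfl, rfl⟩ := h
          exact ⟨q.1, q.2.1, _, .inr ⟨fun hs => h2 ((sub_dec h1.2).2 hs), u, hw⟩, rfl, sub_of_prefix_pre (pfx_iff.1 h3)⟩
        next => cases h
  next => cases h

theorem nxt_stp {B C : ℕ → Bool} {u k k' : ℕ} {σ σ' α : Str}
    (h : nxt u (pre B k) (pre C k') σ = some (σ', α)) : Stp B C σ σ' α := by
  have := List.mem_of_mem_head? h
  rw [List.mem_filterMap] at this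
  obtain ⟨n, _, hn⟩ := this
  cases hd : (decode n : Option (Str × ℕ × Str)) with
  | none => rw [hd] at hn; cases hn
  | some q => rw [hd] at hn; exact nxtv_stp hn

theorem stp_nxt {B C : ℕ → Bool} {σ σ' α : Str} (h : Stp B C σ σ' α) :
    ∃ K, ∀ u k, K ≤ u → K ≤ k → nxt u (pre B k) (pre C k) σ = some (σ', α) := by
  have h0 := h
  obtain ⟨z, l, τ, h, he, hs⟩ := h
  have hτ : (σ ++ un (key z l)) <+: τ := by
    rcases h with ⟨_, h⟩ | ⟨_, u, h⟩
    · rw [h]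
    · exact (wit_spec h).1
  have hτ' : τ <+: σ' := by rw [he]; exact List.prefix_append _ _
  have hW : ∃ u0, ∀ u, u0 ≤ u → ∀ k, z.length ≤ k → (if pfx z (pre B k) = true then some (σ ++ un (key z l)) else wit u l σ z) = some τ := by
    rcases h with ⟨a, h⟩ | ⟨a, u, h⟩
    · exact ⟨0, fun u _ k hk => by rw [if_pos ((sub_dec hk).2 a), h]⟩
    · exact ⟨u, fun u' hu k hk => by rw [if_neg (fun hh => a ((sub_dec hk).1 hh)), wit_mono h hu]⟩
  obtain ⟨u0, hu0⟩ := hW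
  refine ⟨u0 + z.length + σ'.length + encode (z, l, α) + 1, fun u k hu hk => ?_⟩
  have hv : nxtv u (pre B k) (pre C k) σ (z, l, α) = some (σ', α) := by
    unfold nxtv
    have e1 : pfx (σ ++ un (key z l)) (pre C k) = true :=
      pfx_iff.2 ((hτ.trans hτ').trans (hs.initOf (by omega)))
    have e2 : z.length ≤ (pre B k).length := by rw [pre_length]; omega
    have e3 : pfx (τ ++ un (encode α)) (pre C k) = true := by
      rw [← he]; exact pfx_iff.2 (hs.initOf (by omega))
    rw [if_pos (by simp only [e1, decide_eq_true e2]; rfl)]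
    dsimp only
    rw [hu0 u (by omega) k (by omega)]
    simp only [Option.elim_some]
    rw [if_pos e3, he]
  have hsome : (nxt u (pre B k) (pre C k) σ).isSome := by
    unfold nxt
    rw [List.isSome_head?]
    refine List.ne_nil_of_mem (a := (σ', α)) (List.mem_filterMap.2 ⟨encode (z, l, α), ?_, ?_⟩)
    · rw [List.mem_range]; omega
    · rw [encodek]; exact hv
  obtain ⟨⟨σ2, α2⟩, hx⟩ := Option.isSome_iff_exists.1 hsome
  obtain ⟨rfl, rfl⟩ := h0.unique (nxt_stp hx)
  exact hx

section
variable {P H : Nat.Partrec.Code} {j : ℕ} {cH : OracleCode} (hH : Rep cH H) {A B : ℕ → Bool}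
    (hB : FTotal cH A B) (hinf : ∀ n, ∃ t, n < (st P H j A t).2.2.length)
include hH hB hinf

theorem stp_next (t : ℕ) : ∃ t', t ≤ t' ∧ Stp B (limC P H j A) (st P H j A t).2.2
    (st P H j A (t'+1)).2.2 (pre A (t'+1)) := by
  obtain ⟨t1, ht1⟩ := hinf (st P H j A t).2.2.length
  have hex : ∃ d, (st P H j A (t + d + 1)).2.2 ≠ (st P H j A t).2.2 := by
    by_contra hcon
    push Not at hcon
    have := (sg_mono P H j A (show t1 ≤ t + t1 + 1 by omega)).length_le
    rw [hcon] at this; omega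
  classical
  have hd := Nat.find_spec hex
  have hmin : (st P H j A (t + Nat.find hex)).2.2 = (st P H j A t).2.2 := by
    cases hf : Nat.find hex with
    | zero => rfl
    | succ d =>
      by_contra hne
      exact Nat.find_min hex (m := d) (by omega) hne
  refine ⟨t + Nat.find hex, by omega, ?_⟩
  have hsub := sub_limC P H j A (t + Nat.find hex + 1)
  rcases step_data (P := P) (j := j) hH hB (t + Nat.find hex) with ⟨_, h2⟩ | ⟨z, τ, hw, hz, h1, h2⟩ | ⟨z, hz, h1, h2⟩
  · exact (hd (h2.trans hmin)).elim
  · rw [hmin] at hw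
    exact ⟨z, _, τ, .inr ⟨hz, _, hw⟩, h2, hsub⟩
  · rw [hmin] at h2
    exact ⟨z, _, _, .inl ⟨hz, rfl⟩, h2, hsub⟩

theorem itr_sound {u k k' m : ℕ} {σ α : Str}
    (h : itr u (pre B k) (pre (limC P H j A) k') m = some (σ, α)) :
    (∃ t, σ = (st P H j A t).2.2) ∧ Sub α A := by
  induction m generalizing σ α with
  | zero =>
    change some (([] : Str), ([] : Str)) = some (σ, α) at h
    simp only [Option.some.injEq, Prod.mk.injEq] at h
    exact ⟨⟨0, h.1.symm⟩, by rw [← h.2]; rfl⟩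
  | succ m ih =>
    change (itr u (pre B k) (pre (limC P H j A) k') m).elim none _ = _ at h
    cases hm : itr u (pre B k) (pre (limC P H j A) k') m with
    | none => rw [hm] at h; cases h
    | some p =>
      obtain ⟨σ0, α0⟩ := p
      rw [hm] at h
      obtain ⟨⟨t, rfl⟩, _⟩ := ih hm
      obtain ⟨t', _, hs⟩ := stp_next hH hB hinf t
      obtain ⟨rfl, rfl⟩ := (nxt_stp h).unique hs
      exact ⟨⟨_, rfl⟩, sub_pre _ _⟩

theorem itr_complete (m : ℕ) : ∃ t α K, m ≤ t ∧ m ≤ α.length ∧ ∀ u k, K ≤ u → K ≤ k →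
    itr u (pre B k) (pre (limC P H j A) k) m = some ((st P H j A t).2.2, α) := by
  induction m with
  | zero => exact ⟨0, [], 0, le_rfl, le_rfl, fun u k _ _ => rfl⟩
  | succ m ih =>
    obtain ⟨t, α, K, h1, h2, h3⟩ := ih
    obtain ⟨t', ht', hs⟩ := stp_next hH hB hinf t
    obtain ⟨K', hK'⟩ := stp_nxt hs
    refine ⟨t'+1, pre A (t'+1), max K K', by omega, by rw [pre_length]; omega, fun u k hu hk => ?_⟩
    change (itr u (pre B k) (pre (limC P H j A) k) m).elim none _ = _
    rw [h3 u k (by omega) (by omega)]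
    exact hK' u k (by omega) (by omega)

theorem red_join : TRed A (join B (limC P H j A)) := by
  refine TRed.of_search _ _ dcd (by fun_prop) ?_ ?_
  · intro k n b h
    have := List.mem_of_mem_head? h
    rw [List.mem_filterMap] at this
    obtain ⟨m, _, hm⟩ := this
    rw [ext_even, ext_odd] at hm
    cases hi : itr (pre (join B (limC P H j A)) k).length (pre B (k/2)) (pre (limC P H j A) (k/2)) m with
    | none => rw [hi] at hm; cases hm
    | some p =>
      obtain ⟨σ, α⟩ := p
      rw [hi] at hm
      have hs := (itr_sound hH hB hinf hi).2
      obtain ⟨hn, h3⟩ := List.getElem?_eq_some_iff.1 hm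
      rw [← h3]; exact hs.getElem n hn
  · intro n
    obtain ⟨t, α, K, _, hα, hK⟩ := itr_complete hH hB hinf (n+1)
    refine ⟨2 * (K + n + 2), ?_⟩
    unfold dcd
    rw [ext_even, ext_odd, List.isSome_head?, pre_length]
    refine List.ne_nil_of_mem (a := α[n]) (List.mem_filterMap.2 ⟨n+1, by rw [List.mem_range]; omega, ?_⟩)
    rw [hK _ _ (by omega) (by omega)]
    simp only [Option.elim_some]
    exact List.getElem?_eq_getElem _
end

theorem join_red {A B C : ℕ → Bool} (hB : TRed B A) (hC : TRed C A) : TRed (join B C) A := by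
  obtain ⟨c, hc⟩ := hB
  obtain ⟨d, hd⟩ := hC
  obtain ⟨p, hp⟩ := exists_rep c
  obtain ⟨q, hq⟩ := exists_rep d
  refine TRed.of_search _ _ (fun β n => ((strs (n+1)).filterMap fun z =>
    if (decide (z.length = n / 2 + 1) && (if decide (2 * (n / 2) = n) = true then out β.length p β z else out β.length q β z)) = true
      then z[n/2]? else none).head?) (by fun_prop) ?_ ?_
  · intro k n b h
    have := List.mem_of_mem_head? h
    rw [List.mem_filterMap] at this
    obtain ⟨z, _, hz⟩ := this
    by_cases h4 : 2 * (n / 2) = n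
    · rw [if_pos (decide_eq_true h4)] at hz
      split at hz
      next h1 =>
        obtain ⟨hn, h3⟩ := List.getElem?_eq_some_iff.1 hz
        rw [Bool.and_eq_true] at h1
        unfold join
        rw [if_pos (by omega), ← h3]
        have := out_sound hp h1.2 (sub_pre A k)
        rw [sOut_of_total hc] at this
        exact this.getElem _ hn
      next => cases hz
    · have h5 : ¬ decide (2 * (n / 2) = n) = true := by rw [decide_eq_true_iff]; exact h4
      rw [if_neg h5] at hz
      split at hz
      next h1 =>
        obtain ⟨hn, h3⟩ := List.getElem?_eq_some_iff.1 hz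
        rw [Bool.and_eq_true] at h1
        unfold join
        rw [if_neg (by omega), ← h3]
        have := out_sound hq h1.2 (sub_pre A k)
        rw [sOut_of_total hd] at this
        exact this.getElem _ hn
      next => cases hz
  · intro n
    obtain ⟨t1, ht1⟩ := out_complete hp hc (n/2+1)
    obtain ⟨t2, ht2⟩ := out_complete hq hd (n/2+1)
    by_cases h4 : 2 * (n/2) = n
    · refine ⟨t1, ?_⟩
      rw [List.isSome_head?]
      refine List.ne_nil_of_mem (a := B (n/2)) (List.mem_filterMap.2 ⟨pre B (n/2+1), mem_strs.2 (by rw [pre_length]; omega), ?_⟩)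
      rw [if_pos (by simp [h4, ht1]), pre_getElem? _ _ _ (by omega)]
    · refine ⟨t2, ?_⟩
      rw [List.isSome_head?]
      refine List.ne_nil_of_mem (a := C (n/2)) (List.mem_filterMap.2 ⟨pre C (n/2+1), mem_strs.2 (by rw [pre_length]; omega), ?_⟩)
      rw [if_pos (by simp [h4, ht2]), pre_getElem? _ _ _ (by omega)]

/-- every Turing degree that is bounded by a 2-random Turing
degree satisfies the join property. -/
theorem join_property_below_twoRandom (A R : ℕ → Bool)
    (hR : TwoRandom R) (hAR : TRed A R) :
    ∀ B : ℕ → Bool, ¬ ComputableSeq B → TRed B A → ¬ TRed A B →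
      ∃ C : ℕ → Bool, TRed C A ∧ ¬ TRed A C ∧ TEquiv (join B C) A := by
  intro B hBc hBA _
  obtain ⟨cP, hcP⟩ := hAR
  obtain ⟨cH, hcH⟩ := hBA
  obtain ⟨P, hP⟩ := exists_rep cP
  obtain ⟨H, hH⟩ := exists_rep cH
  obtain ⟨j, hj⟩ := exists_j (P := P) (H := H) hP hR
  have hlev : ∀ e : ℕ, ∃ L N, L.length = e ∧ ∀ t, N ≤ t → L <+: (st P H j A t).1 :=
    fun e => level_inf hP hH hcP hcH hBc hj e
  have hinf : ∀ n, ∃ t, n < (st P H j A t).2.2.length := by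
    intro n
    obtain ⟨L, N, hL, hN⟩ := hlev (n+1)
    refine ⟨N, ?_⟩
    have h1 := (hN N le_rfl).length_le
    have h2 := lev_le (P := P) (j := j) hH hcH N
    omega
  have hC := limC_red hinf
  have hBA : TRed B A := ⟨cH, hcH⟩
  exact ⟨limC P H j A, hC, fun h => not_red_limC hH hcH hlev (hBA.trans h),
    join_red hBA hC, red_join hH hcH hinf⟩

end TypicalDegree
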